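/- Let 0 < α < 1, let U ⊆ ℂ be a bounded open set, and let b ∈ ∂U. Then the following are equivalent: (i) there exists κ > 0 such that |(∂h/∂z)(b)| ≤ κ‖h‖_{H^α} for every h ∈ H^α_b(U), where (∂h/∂z)(b) is computed from the harmonic extension of h to a neighbourhood of b; (ii) the series Σ_{n=1}^∞ 2^n · M_*^α(A_n(b) ∖ U) converges. -/

import Mathlib

open Metric Set Filter ENNReal

noncomputable section

/-- `f` is harmonic (twice continuously real-differentiable with vanishing Laplacian)
on the open set `U ⊆ ℂ`. -/
def HarmonicOnC (f : ℂ → ℂ) (U : Set ℂ) : Prop :=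
  ContDiffOn ℝ 2 f U ∧
    ∀ z ∈ U,
      fderiv ℝ (fun w => fderiv ℝ f w 1) z 1 +
        fderiv ℝ (fun w => fderiv ℝ f w Complex.I) z Complex.I = 0

/-- `f` satisfies a Lipschitz (Hölder) condition of order `α` on `E`. -/
def HolderOfOrderOn (α : ℝ) (E : Set ℂ) (f : ℂ → ℂ) : Prop :=
  ∃ C : ℝ, ∀ x ∈ E, ∀ y ∈ E, ‖f x - f y‖ ≤ C * ‖x - y‖ ^ α

/-- `f` belongs to the little Lipschitz class of order `α` on `E`. -/
def LittleHolderOn (α : ℝ) (E : Set ℂ) (f : ℂ → ℂ) : Prop :=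
  HolderOfOrderOn α E f ∧
    Tendsto
      (fun δ : ℝ =>
        sSup {q | ∃ x ∈ E, ∃ y ∈ E, x ≠ y ∧ ‖x - y‖ ≤ δ ∧ q = ‖f x - f y‖ / ‖x - y‖ ^ α})
      (nhdsWithin 0 (Set.Ioi 0)) (nhds 0)

/-- Membership in `H^α(U)`: harmonic on `U` and little-Lipschitz-`α` on `closure U`. -/
def MemHalpha (α : ℝ) (U : Set ℂ) (f : ℂ → ℂ) : Prop :=
  HarmonicOnC f U ∧ LittleHolderOn α (closure U) f

/-- The `H^α` norm: sup of `|f|` over `closure U` plus the Hölder-`α` seminorm on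
`closure U`. -/
def HNorm (α : ℝ) (U : Set ℂ) (f : ℂ → ℂ) : ℝ :=
  sSup ((fun x => ‖f x‖) '' closure U) +
    sSup {q | ∃ x ∈ closure U, ∃ y ∈ closure U, x ≠ y ∧ q = ‖f x - f y‖ / ‖x - y‖ ^ α}

/-- The Wirtinger derivative `∂h/∂z = (∂h/∂x - i ∂h/∂y)/2` at `b`, computed from the
real Fréchet derivative. -/
def dzDeriv (h : ℂ → ℂ) (b : ℂ) : ℂ :=
  (fderiv ℝ h b 1 - Complex.I * fderiv ℝ h b Complex.I) / 2

/-- The Hausdorff `h`-content of `E ⊆ ℂ`: infimum of `∑ h(rₙ)` over countable covers of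
`E` by closed balls `B̄(aₙ, rₙ)` (with nonnegative radii). -/
def MhContent (h : ℝ → ℝ) (E : Set ℂ) : ℝ≥0∞ :=
  ⨅ (c : ℕ → ℂ × ℝ) (_ : ∀ n, 0 ≤ (c n).2)
    (_ : E ⊆ ⋃ n, Metric.closedBall (c n).1 (c n).2),
    ∑' n, ENNReal.ofReal (h ((c n).2))

/-- The lower `β`-dimensional Hausdorff content `M_*^β`: the sup of `M_h` over increasing
`h` with `0 ≤ h(r) ≤ r^β` for `r > 0` and `h(r)/r^β → 0` as `r → 0⁺`. -/
def lowerContent (β : ℝ) (E : Set ℂ) : ℝ≥0∞ :=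
  ⨆ (h : ℝ → ℝ) (_ : MonotoneOn h (Set.Ici 0) ∧
      (∀ r : ℝ, 0 < r → 0 ≤ h r ∧ h r ≤ r ^ β) ∧
      Tendsto (fun r => h r / r ^ β) (nhdsWithin 0 (Set.Ioi 0)) (nhds 0)),
    MhContent h E

/-- The annulus `A_n(b) = {z : 2^{-(n+1)} ≤ |z - b| ≤ 2^{-n}}`. -/
def Ann (b : ℂ) (n : ℕ) : Set ℂ :=
  {z | (2:ℝ) ^ (-(n:ℝ) - 1) ≤ ‖z - b‖ ∧ ‖z - b‖ ≤ (2:ℝ) ^ (-(n:ℝ))}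

/-- The admissible gauge functions in the definition of the lower content. -/
def IsGauge (β : ℝ) (h : ℝ → ℝ) : Prop :=
  MonotoneOn h (Set.Ici 0) ∧
    (∀ r : ℝ, 0 < r → 0 ≤ h r ∧ h r ≤ r ^ β) ∧
    Tendsto (fun r => h r / r ^ β) (nhdsWithin 0 (Set.Ioi 0)) (nhds 0)

lemma lowerContent_eq_iSup (β : ℝ) (E : Set ℂ) :
    lowerContent β E = ⨆ h : {h : ℝ → ℝ // IsGauge β h}, MhContent h.1 E := by
  rw [lowerContent, iSup_subtype]
  rfl

lemma MhContent_le_of_cover {h : ℝ → ℝ} {E : Set ℂ} (c : ℕ → ℂ × ℝ) (h0 : ∀ n, 0 ≤ (c n).2)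
    (hE : E ⊆ ⋃ n, closedBall (c n).1 (c n).2) :
    MhContent h E ≤ ∑' n, ENNReal.ofReal (h ((c n).2)) :=
  iInf_le_of_le c (iInf_le_of_le h0 (iInf_le _ hE))

lemma exists_cover_of_MhContent_lt {h : ℝ → ℝ} {E : Set ℂ} {a : ℝ≥0∞} (ha : MhContent h E < a) :
    ∃ c : ℕ → ℂ × ℝ, (∀ n, 0 ≤ (c n).2) ∧ (E ⊆ ⋃ n, closedBall (c n).1 (c n).2) ∧
      ∑' n, ENNReal.ofReal (h ((c n).2)) < a := by
  simp only [MhContent, iInf_lt_iff] at ha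
  obtain ⟨c, h0, hE, hlt⟩ := ha
  exact ⟨c, h0, hE, hlt⟩

lemma MhContent_mono_set {h : ℝ → ℝ} {E F : Set ℂ} (hEF : E ⊆ F) :
    MhContent h E ≤ MhContent h F :=
  le_iInf fun c => le_iInf fun h0 => le_iInf fun hF => MhContent_le_of_cover c h0 (hEF.trans hF)

lemma MhContent_mono_gauge {h k : ℝ → ℝ} (hk : ∀ r, 0 ≤ r → h r ≤ k r) (E : Set ℂ) :
    MhContent h E ≤ MhContent k E :=
  le_iInf fun c => le_iInf fun h0 => le_iInf fun hE => (MhContent_le_of_cover c h0 hE).trans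
    (ENNReal.tsum_le_tsum fun n => ENNReal.ofReal_le_ofReal (hk _ (h0 n)))

lemma MhContent_union_le (h : ℝ → ℝ) (E F : Set ℂ) :
    MhContent h (E ∪ F) ≤ MhContent h E + MhContent h F := by
  refine ENNReal.le_of_forall_pos_le_add fun ε hε hfin => ?_
  have hE : MhContent h E < MhContent h E + (ε / 2 : NNReal) :=
    ENNReal.lt_add_right (ne_top_of_le_ne_top hfin.ne le_self_add) (by simpa using hε.ne')
  have hF : MhContent h F < MhContent h F + (ε / 2 : NNReal) :=
    ENNReal.lt_add_right (ne_top_of_le_ne_top hfin.ne le_add_self) (by simpa using hε.ne')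
  obtain ⟨c, c0, cE, cs⟩ := exists_cover_of_MhContent_lt hE
  obtain ⟨d, d0, dF, ds⟩ := exists_cover_of_MhContent_lt hF
  let e : ℕ ⊕ ℕ ≃ ℕ := Equiv.natSumNatEquivNat
  have key : MhContent h (E ∪ F) ≤ ∑' n, ENNReal.ofReal (h ((Sum.elim c d (e.symm n)).2)) := by
    refine MhContent_le_of_cover (fun n => Sum.elim c d (e.symm n)) (fun n => ?_) ?_
    · rcases e.symm n with i | i
      · exact c0 i
      · exact d0 i
    · rintro z (hz | hz)
      · obtain ⟨i, hi⟩ := mem_iUnion.1 (cE hz)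
        exact mem_iUnion.2 ⟨e (Sum.inl i), by simpa using hi⟩
      · obtain ⟨i, hi⟩ := mem_iUnion.1 (dF hz)
        exact mem_iUnion.2 ⟨e (Sum.inr i), by simpa using hi⟩
  rw [e.symm.tsum_eq (fun s => ENNReal.ofReal (h ((Sum.elim c d s).2))),
    Summable.tsum_sum ENNReal.summable ENNReal.summable] at key
  simp only [Sum.elim_inl, Sum.elim_inr] at key
  refine key.trans ((add_le_add cs.le ds.le).trans (le_of_eq ?_))
  have : (ε : ℝ≥0∞) = (ε / 2 : NNReal) + (ε / 2 : NNReal) := by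
    rw [← ENNReal.coe_add, add_halves]
  rw [this]; ring

lemma IsGauge.tendsto_zero {β : ℝ} (hβ : 0 < β) {h : ℝ → ℝ} (hh : IsGauge β h) :
    Tendsto h (nhdsWithin 0 (Ioi 0)) (nhds 0) := by
  have h1 : Tendsto (fun r : ℝ => r ^ β) (nhdsWithin 0 (Ioi 0)) (nhds 0) := by
    have := (Real.continuousAt_rpow_const 0 β (Or.inr hβ.le)).tendsto
    rw [Real.zero_rpow hβ.ne'] at this
    exact this.mono_left nhdsWithin_le_nhds
  refine tendsto_of_tendsto_of_tendsto_of_le_of_le' tendsto_const_nhds h1 ?_ ?_ <;>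
    filter_upwards [self_mem_nhdsWithin] with r hr
  · exact (hh.2.1 r hr).1
  · exact (hh.2.1 r hr).2

lemma IsGauge.zero_nonpos {β : ℝ} (hβ : 0 < β) {h : ℝ → ℝ} (hh : IsGauge β h) : h 0 ≤ 0 := by
  refine ge_of_tendsto (hh.tendsto_zero hβ) ?_
  filter_upwards [self_mem_nhdsWithin] with r hr
  exact hh.1 self_mem_Ici (mem_Ici.2 (le_of_lt hr)) (le_of_lt hr)

lemma MhContent_le_of_subset_closedBall {β : ℝ} (hβ : 0 < β) {h : ℝ → ℝ} (hh : IsGauge β h)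
    {E : Set ℂ} {a : ℂ} {r : ℝ} (hr : 0 ≤ r) (hE : E ⊆ closedBall a r) :
    MhContent h E ≤ ENNReal.ofReal (h r) := by
  refine (MhContent_le_of_cover (fun n => if n = 0 then (a, r) else (a, 0)) (fun n => ?_) ?_).trans ?_
  · split_ifs <;> simp [hr]
  · exact fun z hz => mem_iUnion.2 ⟨0, by simpa using hE hz⟩
  · rw [tsum_eq_single 0]
    · simp
    · intro n hn
      simpa [hn] using hh.zero_nonpos hβ

lemma MhContent_empty {β : ℝ} (hβ : 0 < β) {h : ℝ → ℝ} (hh : IsGauge β h) :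
    MhContent h ∅ = 0 := by
  refine le_antisymm ((MhContent_le_of_subset_closedBall hβ hh le_rfl
    (empty_subset (closedBall 0 0))).trans ?_) zero_le
  simpa using hh.zero_nonpos hβ

lemma IsGauge.sup {β : ℝ} {h k : ℝ → ℝ} (hh : IsGauge β h) (hk : IsGauge β k) :
    IsGauge β (fun r => max (h r) (k r)) := by
  refine ⟨hh.1.max hk.1, fun r hr => ⟨le_max_of_le_left (hh.2.1 r hr).1,
    max_le (hh.2.1 r hr).2 (hk.2.1 r hr).2⟩, ?_⟩
  have := hh.2.2.max hk.2.2
  rw [max_self] at this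
  refine this.congr' ?_
  filter_upwards [self_mem_nhdsWithin] with r hr
  exact (max_div_div_right (Real.rpow_nonneg (le_of_lt hr) β) _ _)

/-- First coordinate of the `k`-th dyadic square of generation `n` in Morton order. -/
def mortonRe : ℕ → ℕ → ℕ
  | 0, _ => 0
  | n + 1, k => 2 * mortonRe n (k / 4) + (k % 4) / 2

/-- Second coordinate of the `k`-th dyadic square of generation `n` in Morton order. -/
def mortonIm : ℕ → ℕ → ℕ
  | 0, _ => 0
  | n + 1, k => 2 * mortonIm n (k / 4) + k % 2

/-- Position in Morton order of the generation `n` dyadic square containing `(x, y)`. -/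
def mortonCode (x y : ℝ) : ℕ → ℕ
  | 0 => 0
  | n + 1 => 4 * mortonCode x y n + 2 * (⌊2 ^ (n + 1) * x⌋₊ % 2) + ⌊2 ^ (n + 1) * y⌋₊ % 2

lemma morton_injective (n : ℕ) : ∀ k l : ℕ, k < 4 ^ n → l < 4 ^ n →
    mortonRe n k = mortonRe n l → mortonIm n k = mortonIm n l → k = l := by
  induction n with
  | zero => intro k l hk hl _ _; simp at hk hl; omega
  | succ n ih =>
    intro k l hk hl h1 h2
    simp only [mortonRe, mortonIm] at h1 h2
    rw [pow_succ] at hk hl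
    have := ih (k / 4) (l / 4) (by omega) (by omega) (by omega) (by omega)
    omega

lemma floor_two_pow_succ_div_two (x : ℝ) (n : ℕ) : ⌊2 ^ (n + 1) * x⌋₊ / 2 = ⌊2 ^ n * x⌋₊ := by
  rw [← Nat.floor_div_ofNat]
  congr 1
  rw [pow_succ]; ring

lemma mortonCode_succ_div (x y : ℝ) (n : ℕ) :
    mortonCode x y (n + 1) / 4 = mortonCode x y n := by
  simp only [mortonCode]; omega

lemma morton_mortonCode {x y : ℝ} (hx : x < 1) (hy : y < 1) (n : ℕ) :
    mortonRe n (mortonCode x y n) = ⌊2 ^ n * x⌋₊ ∧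
      mortonIm n (mortonCode x y n) = ⌊2 ^ n * y⌋₊ := by
  induction n with
  | zero => simp [mortonRe, mortonIm, Nat.floor_eq_zero.2 hx, Nat.floor_eq_zero.2 hy]
  | succ n ih =>
    have hx := floor_two_pow_succ_div_two x n
    have hy := floor_two_pow_succ_div_two y n
    simp only [mortonRe, mortonIm, mortonCode_succ_div, ih]
    simp only [mortonCode]
    omega

/-- Lower left corner of the Morton square of generation `n` with code `k`, for the square
with centre `b` and side `2`. -/
def mortonCorner (b : ℂ) (n k : ℕ) : ℂ :=
  b + ((2 * (mortonRe n k / 2 ^ n) - 1 : ℝ) + (2 * (mortonIm n k / 2 ^ n) - 1 : ℝ) * Complex.I)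

/-- The Morton code of a point in the square with centre `b` and side `2`. -/
def codeAt (b z : ℂ) (n : ℕ) : ℕ := mortonCode ((z - b).re / 2 + 1 / 2) ((z - b).im / 2 + 1 / 2) n

lemma abs_sub_floor_div (x : ℝ) (hx : 0 ≤ x) (n : ℕ) :
    0 ≤ x - ⌊2 ^ n * x⌋₊ / 2 ^ n ∧ x - ⌊2 ^ n * x⌋₊ / 2 ^ n ≤ 1 / 2 ^ n := by
  have h2 : (0 : ℝ) < 2 ^ n := by positivity
  have h3 : x = (2 ^ n * x) / 2 ^ n := by field_simp
  constructor
  · have := Nat.floor_le (mul_nonneg h2.le hx)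
    rw [sub_nonneg, div_le_iff₀ h2]; linarith
  · have := (Nat.lt_floor_add_one (2 ^ n * x)).le
    rw [sub_le_iff_le_add, ← add_div, le_div_iff₀ h2]; linarith

lemma norm_sub_mortonCorner_le {b z : ℂ} (hz : z ∈ closedBall b (1 / 2)) (n : ℕ) :
    ‖z - mortonCorner b n (codeAt b z n)‖ ≤ 4 / 2 ^ n := by
  rw [mem_closedBall, dist_eq_norm] at hz
  have hre := abs_le.1 ((Complex.abs_re_le_norm _).trans hz)
  have him := abs_le.1 ((Complex.abs_im_le_norm _).trans hz)
  obtain ⟨e1, e2⟩ := morton_mortonCode (x := (z - b).re / 2 + 1 / 2) (y := (z - b).im / 2 + 1 / 2)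
    (by linarith) (by linarith) n
  have hx := abs_sub_floor_div ((z - b).re / 2 + 1 / 2) (by linarith) n
  have hy := abs_sub_floor_div ((z - b).im / 2 + 1 / 2) (by linarith) n
  rw [mortonCorner, codeAt, e1, e2]
  refine (Complex.norm_le_abs_re_add_abs_im _).trans ?_
  have h4 : (4 : ℝ) / 2 ^ n = 2 * (1 / 2 ^ n) + 2 * (1 / 2 ^ n) := by ring
  rw [h4]
  refine add_le_add ?_ ?_
  · simp only [Complex.sub_re, Complex.add_re, Complex.ofReal_re,
      Complex.mul_re, Complex.I_re, Complex.I_im, Complex.ofReal_im] at hx ⊢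
    rw [abs_le]; constructor <;> linarith
  · simp only [Complex.sub_im, Complex.add_im, Complex.ofReal_re,
      Complex.mul_im, Complex.I_re, Complex.I_im, Complex.ofReal_im] at hy ⊢
    rw [abs_le]; constructor <;> linarith

lemma norm_mortonCorner_succ_sub_le (b : ℂ) (n k : ℕ) :
    ‖mortonCorner b n (k / 4) - mortonCorner b (n + 1) k‖ ≤ 4 / 2 / 2 ^ n := by
  have e : mortonCorner b n (k / 4) - mortonCorner b (n + 1) k =
      (-(((k % 4) / 2 : ℕ) / 2 ^ n : ℝ) : ℝ) + (-(((k % 2 : ℕ) : ℝ) / 2 ^ n) : ℝ) * Complex.I := by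
    simp only [mortonCorner, mortonRe, mortonIm, pow_succ]
    push_cast
    have : (2 : ℂ) ^ n ≠ 0 := pow_ne_zero _ two_ne_zero
    field_simp
    ring
  have h1 : (((k % 4) / 2 : ℕ) : ℝ) ≤ 1 := by exact_mod_cast (by omega)
  have h2 : ((k % 2 : ℕ) : ℝ) ≤ 1 := by exact_mod_cast (by omega)
  rw [e]
  refine (norm_add_le _ _).trans ?_
  rw [norm_mul, Complex.norm_I, Complex.norm_real, Complex.norm_real, Real.norm_eq_abs,
    Real.norm_eq_abs, abs_neg, abs_neg, abs_of_nonneg (by positivity), abs_of_nonneg (by positivity)]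
  calc _ ≤ 1 / (2 : ℝ) ^ n + 1 / 2 ^ n * 1 := by gcongr
    _ = _ := by ring

/-- Approximations of the space filling curve. -/
def mortonApprox (b : ℂ) (n : ℕ) (t : ℝ) : ℂ := mortonCorner b n ⌊4 ^ n * t⌋₊

lemma dist_mortonApprox_succ_le (b : ℂ) (t : ℝ) (n : ℕ) :
    dist (mortonApprox b n t) (mortonApprox b (n + 1) t) ≤ 4 / 2 / 2 ^ n := by
  have : ⌊4 ^ (n + 1) * t⌋₊ / 4 = ⌊4 ^ n * t⌋₊ := by
    rw [← Nat.floor_div_ofNat]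
    congr 1
    rw [pow_succ]; ring
  rw [dist_eq_norm, mortonApprox, mortonApprox, ← this]
  exact norm_mortonCorner_succ_sub_le _ _ _

/-- A measurable curve filling the square with centre `b` and side `2`. -/
def mortonCurve (b : ℂ) (t : ℝ) : ℂ := limUnder atTop fun n => mortonApprox b n t

lemma tendsto_mortonApprox (b : ℂ) (t : ℝ) :
    Tendsto (fun n => mortonApprox b n t) atTop (nhds (mortonCurve b t)) :=
  (cauchySeq_of_le_geometric_two (dist_mortonApprox_succ_le b t)).tendsto_limUnder

lemma dist_mortonApprox_le (b : ℂ) (t : ℝ) (n : ℕ) :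
    dist (mortonApprox b n t) (mortonCurve b t) ≤ 4 / 2 ^ n :=
  dist_le_of_le_geometric_two_of_tendsto (dist_mortonApprox_succ_le b t)
    (tendsto_mortonApprox b t) n

lemma measurable_mortonCurve (b : ℂ) : Measurable (mortonCurve b) := by
  refine measurable_of_tendsto_metrizable (f := fun n => mortonApprox b n) (fun n => ?_)
    (tendsto_pi_nhds.2 (tendsto_mortonApprox b))
  exact (measurable_from_nat (f := mortonCorner b n)).comp
    (Nat.measurable_floor.comp (measurable_const.mul measurable_id))

/-- At most `36` Morton squares of generation `n` have a corner within `5 / 2 ^ n` of a point. -/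
lemma card_mortonCorner_le (b x : ℂ) (n : ℕ) (s : Finset ℕ) (hs : ∀ k ∈ s, k < 4 ^ n)
    (hx : ∀ k ∈ s, ‖mortonCorner b n k - x‖ ≤ 5 / 2 ^ n) : s.card ≤ 36 := by
  let A : ℤ := ⌈2 ^ n * ((x - b).re + 1) / 2 - 5 / 2⌉
  let B : ℤ := ⌈2 ^ n * ((x - b).im + 1) / 2 - 5 / 2⌉
  have h2 : (0 : ℝ) < 2 ^ n := by positivity
  have aux : ∀ (i : ℕ) (u : ℝ), |2 * ((i : ℝ) / 2 ^ n) - 1 - u| ≤ 5 / 2 ^ n →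
      (i : ℤ) ∈ Finset.Icc ⌈2 ^ n * (u + 1) / 2 - 5 / 2⌉ (⌈2 ^ n * (u + 1) / 2 - 5 / 2⌉ + 5) := by
    intro i u hi
    have hi' : |(i : ℝ) - 2 ^ n * (u + 1) / 2| ≤ 5 / 2 := by
      have e : (2 : ℝ) * ((i : ℝ) / 2 ^ n) - 1 - u = ((i : ℝ) - 2 ^ n * (u + 1) / 2) * (2 / 2 ^ n) := by
        field_simp; ring
      rw [e, abs_mul, abs_of_pos (by positivity : (0 : ℝ) < 2 / 2 ^ n), mul_div_assoc', div_le_div_iff_of_pos_right h2] at hi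
      linarith
    rw [abs_le] at hi'
    rw [Finset.mem_Icc]
    have h3 := Int.le_ceil (2 ^ n * (u + 1) / 2 - 5 / 2)
    refine ⟨Int.ceil_le.2 (by push_cast; linarith), ?_⟩
    have : (i : ℝ) ≤ ((⌈2 ^ n * (u + 1) / 2 - 5 / 2⌉ + 5 : ℤ) : ℝ) := by push_cast; linarith
    exact_mod_cast this
  have key := Finset.card_le_card_of_injOn (s := s)
    (t := Finset.Icc A (A + 5) ×ˢ Finset.Icc B (B + 5))
    (fun k => ((mortonRe n k : ℤ), (mortonIm n k : ℤ))) ?_ ?_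
  · refine key.trans (le_of_eq ?_)
    rw [Finset.card_product, Int.card_Icc, Int.card_Icc, add_assoc, add_assoc,
      add_sub_cancel_left, add_sub_cancel_left]
    rfl
  · intro k hk
    have h := hx k hk
    simp only [Finset.coe_product, mem_prod, Finset.mem_coe]
    constructor
    · refine aux _ _ (le_trans (le_of_eq ?_) ((Complex.abs_re_le_norm _).trans h))
      simp only [mortonCorner, Complex.sub_re, Complex.add_re, Complex.ofReal_re,
        Complex.mul_re, Complex.I_re, Complex.I_im, Complex.ofReal_im]
      congr 1; ring
    · refine aux _ _ (le_trans (le_of_eq ?_) ((Complex.abs_im_le_norm _).trans h))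
      simp only [mortonCorner, Complex.sub_im, Complex.add_im, Complex.ofReal_re,
        Complex.mul_im, Complex.I_re, Complex.I_im, Complex.ofReal_im]
      congr 1; ring
  · intro k hk l hl hkl
    simp only [Prod.mk.injEq, Nat.cast_inj] at hkl
    exact morton_injective n k l (hs k hk) (hs l hl) hkl.1 hkl.2

section

open MeasureTheory

lemma codeAt_div_lt (b z : ℂ) (n m : ℕ) :
    (codeAt b z n : ℝ) / 4 ^ n < (codeAt b z m + 1) / 4 ^ m := by
  have hdiv : ∀ n, codeAt b z (n + 1) / 4 = codeAt b z n := fun n => mortonCode_succ_div _ _ n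
  have hmono : Monotone fun n => (codeAt b z n : ℝ) / 4 ^ n := by
    refine monotone_nat_of_le_succ fun n => ?_
    rw [div_le_div_iff₀ (by positivity) (by positivity), pow_succ]
    have h1 : (codeAt b z n * 4 : ℝ) ≤ codeAt b z (n + 1) := by
      exact_mod_cast (by have := hdiv n; omega)
    nlinarith [pow_pos (four_pos (α := ℝ)) n]
  have hanti : Antitone fun n => (codeAt b z n + 1 : ℝ) / 4 ^ n := by
    refine antitone_nat_of_succ_le fun n => ?_
    rw [div_le_div_iff₀ (by positivity) (by positivity), pow_succ]
    have h1 : (codeAt b z (n + 1) + 1 : ℝ) ≤ (codeAt b z n + 1) * 4 := by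
      exact_mod_cast (by have := hdiv n; omega)
    nlinarith [pow_pos (four_pos (α := ℝ)) n]
  calc (codeAt b z n : ℝ) / 4 ^ n ≤ codeAt b z (max n m) / 4 ^ (max n m) := hmono (le_max_left _ _)
    _ < (codeAt b z (max n m) + 1) / 4 ^ (max n m) := by gcongr; linarith
    _ ≤ _ := hanti (le_max_right _ _)

/-- The initial segments of the Morton order. -/
def mortonSegment (b : ℂ) (t : ℝ) : Set ℂ := {z | ∃ m, (codeAt b z m + 1 : ℝ) / 4 ^ m ≤ t}

lemma mortonSegment_mono (b : ℂ) : Monotone (mortonSegment b) :=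
  fun _ _ hst _ ⟨m, hm⟩ => ⟨m, hm.trans hst⟩

lemma codeAt_lt_of_mem_mortonSegment {b z : ℂ} {t : ℝ} (hz : z ∈ mortonSegment b t) (n : ℕ) :
    (codeAt b z n : ℝ) / 4 ^ n < t := by
  obtain ⟨m, hm⟩ := hz
  exact (codeAt_div_lt b z n m).trans_le hm

lemma lt_codeAt_of_notMem_mortonSegment {b z : ℂ} {t : ℝ} (hz : z ∉ mortonSegment b t) (n : ℕ) :
    t < (codeAt b z n + 1 : ℝ) / 4 ^ n := by
  by_contra! h
  exact hz ⟨n, h⟩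

lemma MhContent_code_eq_le {β : ℝ} (hβ : 0 < β) {h : ℝ → ℝ} (hh : IsGauge β h) {b : ℂ}
    {E : Set ℂ} (hEb : E ⊆ closedBall b (1 / 2)) (n k : ℕ) :
    MhContent h (E ∩ {z | codeAt b z n = k}) ≤ ENNReal.ofReal (h (4 / 2 ^ n)) := by
  refine MhContent_le_of_subset_closedBall hβ hh (a := mortonCorner b n k) (by positivity) ?_
  rintro z ⟨hz, rfl⟩
  rw [mem_closedBall, dist_eq_norm]
  exact norm_sub_mortonCorner_le (hEb hz) n

lemma exists_measure_Ico_eq {F : ℝ → ℝ} (hF : Monotone F) (hc : Continuous F) :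
    ∃ m : Measure ℝ, ∀ s t, m (Ico s t) = ENNReal.ofReal (F t - F s) := by
  refine ⟨(StieltjesFunction.mk F hF fun x => hc.continuousWithinAt).measure, fun s t => ?_⟩
  rw [StieltjesFunction.measure_Ico]
  have : ∀ x, Function.leftLim F x = F x := fun x =>
    leftLim_eq_of_tendsto (hc.continuousWithinAt (s := Iio x)).tendsto
  exact congrArg ENNReal.ofReal (by rw [← this s, ← this t])

/-- The distribution on `[0, 1)` whose distribution function is the content of initial segments. -/
lemma exists_morton_distribution {β : ℝ} (hβ : 0 < β) {h : ℝ → ℝ} (hh : IsGauge β h) {b : ℂ}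
    {E : Set ℂ} (hEb : E ⊆ closedBall b (1 / 2)) :
    ∃ m : Measure ℝ, m (Ico 0 1) = MhContent h E ∧ ∀ n k : ℕ,
      m (Ico ((k : ℝ) / 4 ^ n) ((k + 1) / 4 ^ n)) ≤ MhContent h (E ∩ {z | codeAt b z n = k}) := by
  have hfin : ∀ A : Set ℂ, MhContent h (E ∩ A) ≠ ⊤ := fun A =>
    ne_top_of_le_ne_top ENNReal.ofReal_ne_top
      (MhContent_le_of_subset_closedBall hβ hh (by norm_num) (inter_subset_left.trans hEb))
  let F : ℝ → ℝ := fun t => (MhContent h (E ∩ mortonSegment b t)).toReal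
  have hFmono : Monotone F := fun s t hst => ENNReal.toReal_mono (hfin _)
    (MhContent_mono_set (inter_subset_inter_right _ (mortonSegment_mono b hst)))
  have hFsub : ∀ {s t : ℝ} {A : Set ℂ}, mortonSegment b t \ mortonSegment b s ⊆ A →
      F t - F s ≤ (MhContent h (E ∩ A)).toReal := by
    intro s t A hA
    rw [sub_le_iff_le_add, ← ENNReal.toReal_add (hfin _) (hfin _)]
    refine ENNReal.toReal_mono (ENNReal.add_ne_top.2 ⟨hfin _, hfin _⟩) ?_
    refine (MhContent_mono_set ?_).trans (MhContent_union_le h _ _)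
    rintro z ⟨hz, hzt⟩
    by_cases hzs : z ∈ mortonSegment b s
    · exact Or.inr ⟨hz, hzs⟩
    · exact Or.inl ⟨hz, hA ⟨hzt, hzs⟩⟩
  have hsmall : ∀ (n : ℕ) (s t : ℝ), t - s ≤ 1 / 4 ^ n → F t - F s ≤ 3 * max (h (4 / 2 ^ n)) 0 := by
    intro n s t hst
    have h4 : (0 : ℝ) < 4 ^ n := by positivity
    let k : ℕ → Set ℂ := fun k => {z | codeAt b z n = k}
    have hsub : mortonSegment b t \ mortonSegment b s ⊆
        k ⌊4 ^ n * s⌋₊ ∪ (k (⌊4 ^ n * s⌋₊ + 1) ∪ k (⌊4 ^ n * s⌋₊ + 2)) := by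
      rintro z ⟨hzt, hzs⟩
      have h1 := codeAt_lt_of_mem_mortonSegment hzt n
      have h2 := lt_codeAt_of_notMem_mortonSegment hzs n
      rw [div_lt_iff₀ h4] at h1
      rw [lt_div_iff₀ h4] at h2
      have h3 : (t - s) * 4 ^ n ≤ 1 := by rwa [le_div_iff₀ h4] at hst
      have h5 := Nat.lt_floor_add_one (4 ^ n * s)
      have h6 : codeAt b z n < ⌊4 ^ n * s⌋₊ + 2 := by
        exact_mod_cast (by push_cast; linarith : (codeAt b z n : ℝ) < (⌊4 ^ n * s⌋₊ + 2 : ℕ))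
      have h7 : ⌊4 ^ n * s⌋₊ < codeAt b z n + 1 := by
        refine (Nat.floor_lt' (by omega)).2 ?_
        push_cast; linarith
      simp only [k, mem_union, mem_ofPred_eq]
      omega
    refine (hFsub hsub).trans ?_
    have hm : ∀ j, MhContent h (E ∩ k j) ≤ ENNReal.ofReal (h (4 / 2 ^ n)) :=
      MhContent_code_eq_le hβ hh hEb n
    have : MhContent h (E ∩ (k ⌊4 ^ n * s⌋₊ ∪ (k (⌊4 ^ n * s⌋₊ + 1) ∪ k (⌊4 ^ n * s⌋₊ + 2)))) ≤
        3 * ENNReal.ofReal (h (4 / 2 ^ n)) := by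
      rw [inter_union_distrib_left, inter_union_distrib_left]
      refine (MhContent_union_le _ _ _).trans ((add_le_add (hm _)
        ((MhContent_union_le _ _ _).trans (add_le_add (hm _) (hm _)))).trans (le_of_eq ?_))
      ring
    refine (ENNReal.toReal_mono (by finiteness) this).trans (le_of_eq ?_)
    simp [ENNReal.toReal_ofReal']
  have hcont : Continuous F := by
    have hlim : Tendsto (fun n : ℕ => 3 * max (h (4 / 2 ^ n)) 0) atTop (nhds 0) := by
      have h1 : Tendsto (fun n : ℕ => (4 : ℝ) / 2 ^ n) atTop (nhdsWithin 0 (Ioi 0)) := by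
        refine tendsto_nhdsWithin_iff.2 ⟨?_, Eventually.of_forall fun n => ?_⟩
        · exact tendsto_const_nhds.div_atTop (tendsto_pow_atTop_atTop_of_one_lt one_lt_two)
        · exact mem_Ioi.2 (by positivity)
      have h2 := (((hh.tendsto_zero hβ).comp h1).max (tendsto_const_nhds (x := (0 : ℝ)))).const_mul 3
      simpa using h2
    refine Metric.continuous_iff.2 fun s ε hε => ?_
    obtain ⟨n, hn⟩ := (hlim.eventually (gt_mem_nhds hε)).exists
    refine ⟨1 / 4 ^ n, by positivity, fun t ht => lt_of_le_of_lt ?_ hn⟩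
    rw [Real.dist_eq] at ht ⊢
    have := abs_lt.1 ht
    exact abs_le.2 ⟨by linarith [hsmall n t s (by linarith)], hsmall n s t (by linarith)⟩
  obtain ⟨m, hIco⟩ := exists_measure_Ico_eq hFmono hcont
  refine ⟨m, ?_, fun n k => ?_⟩
  · rw [hIco]
    have h0 : E ∩ mortonSegment b 0 = ∅ := by
      refine eq_empty_of_forall_notMem fun z hz => ?_
      obtain ⟨m, hm⟩ := hz.2
      exact absurd hm (not_le.2 (by positivity))
    have h1 : E ∩ mortonSegment b 1 = E := by
      refine inter_eq_left.2 fun z _ => ⟨0, ?_⟩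
      simp [codeAt, mortonCode]
    have h2 := hfin univ
    rw [inter_univ] at h2
    simp only [F, h0, h1, MhContent_empty hβ hh, ENNReal.toReal_zero, sub_zero]
    exact ENNReal.ofReal_toReal h2
  · have h4 : (0 : ℝ) < 4 ^ n := by positivity
    rw [hIco]
    refine ENNReal.ofReal_le_of_le_toReal (hFsub ?_)
    rintro z ⟨hzt, hzs⟩
    have h1 := codeAt_lt_of_mem_mortonSegment hzt n
    have h2 := lt_codeAt_of_notMem_mortonSegment hzs n
    rw [div_lt_div_iff_of_pos_right h4] at h1 h2
    have h1' : codeAt b z n < k + 1 := by exact_mod_cast h1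
    have h2' : k < codeAt b z n + 1 := by exact_mod_cast h2
    simp only [mem_ofPred_eq]; omega

/-- Frostman's lemma for gauge functions: the mass distribution is obtained from the increments
of the content along initial segments of the Morton order. -/
theorem exists_frostman_measure {β : ℝ} (hβ : 0 < β) {h : ℝ → ℝ} (hh : IsGauge β h) {b : ℂ}
    {E : Set ℂ} (hE : IsClosed E) (hEb : E ⊆ closedBall b (1 / 2)) :
    ∃ μ : Measure ℂ, μ univ = MhContent h E ∧ μ Eᶜ = 0 ∧
      ∀ x r, 0 < r → μ (closedBall x r) ≤ 36 * ENNReal.ofReal (h (8 * r)) := by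
  obtain ⟨m, hm1, hI⟩ := exists_morton_distribution hβ hh hEb
  have hmemI : ∀ (n : ℕ) (t : ℝ), 0 ≤ t → t ∈ Ico ((⌊4 ^ n * t⌋₊ : ℝ) / 4 ^ n) ((⌊4 ^ n * t⌋₊ + 1) / 4 ^ n) := by
    intro n t ht
    have h4 : (0 : ℝ) < 4 ^ n := by positivity
    refine ⟨?_, ?_⟩
    · rw [div_le_iff₀ h4, mul_comm]; exact Nat.floor_le (by positivity)
    · rw [lt_div_iff₀ h4, mul_comm]; exact Nat.lt_floor_add_one _
  have hmeas := measurable_mortonCurve b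
  have huniv : (m.restrict (Ico 0 1)).map (mortonCurve b) univ = MhContent h E := by
    rw [Measure.map_apply hmeas MeasurableSet.univ, preimage_univ, Measure.restrict_apply_univ, hm1]
  refine ⟨(m.restrict (Ico 0 1)).map (mortonCurve b), huniv, ?_, fun x r hr => ?_⟩
  · rw [Measure.map_apply hmeas hE.measurableSet.compl,
      Measure.restrict_apply (hmeas hE.measurableSet.compl)]
    let N : Set (ℕ × ℕ) := {p | E ∩ {z | codeAt b z p.1 = p.2} = ∅}
    refine measure_mono_null (t := ⋃ p ∈ N, Ico ((p.2 : ℝ) / 4 ^ p.1) ((p.2 + 1) / 4 ^ p.1)) ?_ ?_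
    · rintro t ⟨hγ, ht0, ht1⟩
      obtain ⟨ε, hε, hball⟩ := Metric.isOpen_iff.1 hE.isOpen_compl _ hγ
      have hlim : Tendsto (fun n : ℕ => (8 : ℝ) / 2 ^ n) atTop (nhds 0) :=
        tendsto_const_nhds.div_atTop (tendsto_pow_atTop_atTop_of_one_lt one_lt_two)
      obtain ⟨n, hn⟩ := (hlim.eventually (gt_mem_nhds hε)).exists
      refine mem_iUnion₂.2 ⟨(n, ⌊4 ^ n * t⌋₊), ?_, hmemI n t ht0⟩
      refine eq_empty_of_forall_notMem fun z hz => ?_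
      have hz1 := norm_sub_mortonCorner_le (hEb hz.1) n
      rw [show codeAt b z n = ⌊4 ^ n * t⌋₊ from hz.2, ← dist_eq_norm] at hz1
      have h3 := dist_mortonApprox_le b t n
      refine hball ?_ hz.1
      rw [mem_ball]
      calc dist z (mortonCurve b t) ≤ 4 / 2 ^ n + 4 / 2 ^ n :=
            (dist_triangle _ _ _).trans (add_le_add hz1 h3)
        _ = 8 / 2 ^ n := by ring
        _ < ε := hn
    · refine (measure_biUnion_null_iff N.to_countable).2 fun p hp => le_antisymm ?_ zero_le
      refine (hI p.1 p.2).trans (le_of_eq ?_)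
      rw [show E ∩ {z | codeAt b z p.1 = p.2} = ∅ from hp, MhContent_empty hβ hh]
  · rcases le_or_gt r 1 with hr1 | hr1
    · obtain ⟨n, hn1, hn2⟩ := exists_nat_pow_near_of_lt_one (y := (1 / 2 : ℝ)) hr hr1
        (by norm_num) (by norm_num)
      rw [one_div, inv_pow] at hn1 hn2
      have hγ := hmeas (isClosed_closedBall (x := x) (ε := r)).measurableSet
      rw [Measure.map_apply hmeas isClosed_closedBall.measurableSet, Measure.restrict_apply hγ]
      let P : Finset ℕ := {k ∈ Finset.range (4 ^ n) | ‖mortonCorner b n k - x‖ ≤ 5 / 2 ^ n}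
      have hP : P.card ≤ 36 := card_mortonCorner_le b x n P
        (fun k hk => Finset.mem_range.1 (Finset.mem_filter.1 hk).1)
        (fun k hk => (Finset.mem_filter.1 hk).2)
      have hcov : mortonCurve b ⁻¹' closedBall x r ∩ Ico 0 1 ⊆ ⋃ k ∈ P, Ico ((k : ℝ) / 4 ^ n) ((k + 1) / 4 ^ n) := by
        rintro t ⟨hγt, ht0, ht1⟩
        refine mem_iUnion₂.2 ⟨⌊4 ^ n * t⌋₊, Finset.mem_filter.2 ⟨Finset.mem_range.2 ?_, ?_⟩,
          hmemI n t ht0⟩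
        · refine (Nat.floor_lt (by positivity)).2 ?_
          push_cast
          nlinarith [pow_pos (four_pos (α := ℝ)) n]
        · rw [← dist_eq_norm]
          calc dist (mortonCorner b n ⌊4 ^ n * t⌋₊) x ≤ 4 / 2 ^ n + ((2 : ℝ) ^ n)⁻¹ :=
                (dist_triangle _ _ _).trans
                  (add_le_add (dist_mortonApprox_le b t n) ((mem_closedBall.1 hγt).trans hn2))
            _ = 5 / 2 ^ n := by ring
      refine (measure_mono hcov).trans ((measure_biUnion_finset_le P _).trans ?_)
      refine (Finset.sum_le_card_nsmul P _ (ENNReal.ofReal (h (8 * r))) fun k _ =>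
        (hI n k).trans ?_).trans ?_
      · refine (MhContent_code_eq_le hβ hh hEb n k).trans (ENNReal.ofReal_le_ofReal
          (hh.1 (mem_Ici.2 (by positivity)) (mem_Ici.2 (by positivity)) ?_))
        rw [pow_succ, mul_inv] at hn1
        rw [div_eq_mul_inv]; linarith
      · rw [nsmul_eq_mul]
        gcongr
        exact_mod_cast hP
    · refine (measure_mono (subset_univ _)).trans (huniv.le.trans ?_)
      refine (MhContent_le_of_subset_closedBall hβ hh (a := b) (r := 8 * r) (by positivity)
        (hEb.trans (closedBall_subset_closedBall (by linarith)))).trans ?_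
      exact le_mul_of_one_le_left' (by norm_num)

end

section

open MeasureTheory

lemma log_one_add_le_rpow {x γ : ℝ} (hx : 0 ≤ x) (hγ : 0 < γ) (hγ1 : γ ≤ 1) :
    Real.log (1 + x) ≤ x ^ γ / γ := by
  rw [le_div_iff₀ hγ, mul_comm, ← Real.log_rpow (by linarith)]
  have h1 : (1 + x) ^ γ ≤ 1 + x ^ γ := by
    simpa using Real.rpow_add_le_add_rpow zero_le_one hx hγ.le hγ1
  have h2 := Real.log_le_sub_one_of_pos (Real.rpow_pos_of_pos (by linarith : 0 < 1 + x) γ)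
  linarith

lemma abs_log_sub_log_le {a a' d : ℝ} (ha : 0 < a) (ha' : 0 < a') (hd : |a - a'| ≤ d) :
    |Real.log a - Real.log a'| ≤ Real.log (1 + d / a) + Real.log (1 + d / a') := by
  have hd0 : 0 ≤ d := (abs_nonneg _).trans hd
  obtain ⟨h1, h2⟩ := abs_le.1 hd
  have key : ∀ {x y : ℝ}, 0 < x → 0 < y → x ≤ y + d → Real.log x - Real.log y ≤ Real.log (1 + d / y) := by
    intro x y hx hy hxy
    rw [← Real.log_div hx.ne' hy.ne']
    refine Real.log_le_log (by positivity) ?_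
    rw [div_le_iff₀ hy, add_mul, div_mul_cancel₀ _ hy.ne']; linarith
  have h3 : 0 ≤ Real.log (1 + d / a) := Real.log_nonneg (by have := div_nonneg hd0 ha.le; linarith)
  have h4 : 0 ≤ Real.log (1 + d / a') := Real.log_nonneg (by have := div_nonneg hd0 ha'.le; linarith)
  have h5 := key ha ha' (by linarith)
  have h6 := key ha' ha (by linarith)
  exact abs_le.2 ⟨by linarith, by linarith⟩

/-- Weights of the dyadic shells in the estimate of a logarithmic potential. -/
def shellWeight (α : ℝ) (j : ℤ) : ℝ := Real.log (1 + (2 : ℝ) ^ (-j)) * ((2 : ℝ) ^ (j + 1)) ^ α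

lemma log_one_add_zpow_nonneg (j : ℤ) : 0 ≤ Real.log (1 + (2 : ℝ) ^ j) :=
  Real.log_nonneg (by have := zpow_pos (two_pos (α := ℝ)) j; linarith)

lemma shellWeight_nonneg (α : ℝ) (j : ℤ) : 0 ≤ shellWeight α j :=
  mul_nonneg (log_one_add_zpow_nonneg _) (by positivity)

lemma shellWeight_le {α γ : ℝ} (hγ : 0 < γ) (hγ1 : γ ≤ 1) (j : ℤ) :
    shellWeight α j ≤ 2 ^ α / γ * ((2 : ℝ) ^ (α - γ)) ^ j := by
  have h := log_one_add_le_rpow (zpow_pos (two_pos (α := ℝ)) (-j)).le hγ hγ1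
  refine (mul_le_mul_of_nonneg_right h (by positivity)).trans (le_of_eq ?_)
  have e : ∀ (i : ℤ) (s : ℝ), ((2 : ℝ) ^ i) ^ s = (2 : ℝ) ^ (i * s) := fun i s => by
    rw [Real.rpow_mul (by norm_num), Real.rpow_intCast]
  rw [e, e, ← Real.rpow_intCast, ← Real.rpow_mul (by norm_num), div_mul_eq_mul_div,
    div_mul_eq_mul_div, ← Real.rpow_add (by norm_num), ← Real.rpow_add (by norm_num)]
  congr 2
  push_cast; ring

lemma summable_shellWeight {α : ℝ} (hα : 0 < α) (hα1 : α < 1) : Summable (shellWeight α) := by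
  refine Summable.of_nat_of_neg ?_ ?_
  · refine Summable.of_nonneg_of_le (fun n => shellWeight_nonneg α n)
      (fun n => shellWeight_le one_pos le_rfl n) ?_
    simp only [zpow_natCast]
    exact (summable_geometric_of_lt_one (by positivity)
      (Real.rpow_lt_one_of_one_lt_of_neg one_lt_two (by linarith))).mul_left _
  · refine Summable.of_nonneg_of_le (fun n => shellWeight_nonneg α _)
      (fun n => shellWeight_le (half_pos hα) (by linarith) _) ?_
    simp only [zpow_neg, zpow_natCast, ← inv_pow, ← Real.rpow_neg (zero_le_two (α := ℝ))]
    exact (summable_geometric_of_lt_one (by positivity)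
      (Real.rpow_lt_one_of_one_lt_of_neg one_lt_two (by linarith))).mul_left _

/-- A modulus of continuity for logarithmic potentials of measures with growth function `G`. -/
def potentialModulus (G : ℝ → ℝ) (d : ℝ) : ℝ :=
  ∑' j : ℤ, Real.log (1 + (2 : ℝ) ^ (-j)) * G (d * 2 ^ (j + 1))

section Growth

variable {α K : ℝ} {G : ℝ → ℝ}

lemma potentialTerm_le (hG : ∀ r, 0 < r → 0 ≤ G r ∧ G r ≤ K * r ^ α) {d : ℝ} (hd : 0 < d) (j : ℤ) :
    0 ≤ Real.log (1 + (2 : ℝ) ^ (-j)) * G (d * 2 ^ (j + 1)) ∧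
    Real.log (1 + (2 : ℝ) ^ (-j)) * G (d * 2 ^ (j + 1)) ≤ K * d ^ α * shellWeight α j := by
  have hp : 0 < d * (2 : ℝ) ^ (j + 1) := by positivity
  refine ⟨mul_nonneg (log_one_add_zpow_nonneg _) (hG _ hp).1,
    (mul_le_mul_of_nonneg_left (hG _ hp).2 (log_one_add_zpow_nonneg _)).trans (le_of_eq ?_)⟩
  rw [Real.mul_rpow hd.le (by positivity), shellWeight]; ring

lemma summable_potentialTerm (hα : 0 < α) (hα1 : α < 1)
    (hG : ∀ r, 0 < r → 0 ≤ G r ∧ G r ≤ K * r ^ α) {d : ℝ} (hd : 0 < d) :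
    Summable fun j : ℤ => Real.log (1 + (2 : ℝ) ^ (-j)) * G (d * 2 ^ (j + 1)) :=
  Summable.of_nonneg_of_le (fun j => (potentialTerm_le hG hd j).1)
    (fun j => (potentialTerm_le hG hd j).2) ((summable_shellWeight hα hα1).mul_left _)

lemma potentialModulus_nonneg (hG : ∀ r, 0 < r → 0 ≤ G r ∧ G r ≤ K * r ^ α) {d : ℝ} (hd : 0 < d) :
    0 ≤ potentialModulus G d :=
  tsum_nonneg fun j => (potentialTerm_le hG hd j).1

lemma potentialModulus_le (hα : 0 < α) (hα1 : α < 1)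
    (hG : ∀ r, 0 < r → 0 ≤ G r ∧ G r ≤ K * r ^ α) {d : ℝ} (hd : 0 < d) :
    potentialModulus G d ≤ K * d ^ α * ∑' j, shellWeight α j := by
  rw [← tsum_mul_left]
  exact (summable_potentialTerm hα hα1 hG hd).tsum_le_tsum (fun j => (potentialTerm_le hG hd j).2)
    ((summable_shellWeight hα hα1).mul_left _)

lemma tendsto_potentialModulus_div (hα : 0 < α) (hα1 : α < 1)
    (hG : ∀ r, 0 < r → 0 ≤ G r ∧ G r ≤ K * r ^ α)
    (hG0 : Tendsto (fun r => G r / r ^ α) (nhdsWithin 0 (Ioi 0)) (nhds 0)) :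
    Tendsto (fun d => potentialModulus G d / d ^ α) (nhdsWithin 0 (Ioi 0)) (nhds 0) := by
  have h := tendsto_tsum_of_dominated_convergence (𝓕 := nhdsWithin (0 : ℝ) (Ioi 0))
    (f := fun d (j : ℤ) => Real.log (1 + (2 : ℝ) ^ (-j)) * G (d * 2 ^ (j + 1)) / d ^ α)
    (g := fun _ => 0) (bound := fun j => K * shellWeight α j)
    ((summable_shellWeight hα hα1).mul_left _) (fun j => ?_) ?_
  · simpa [potentialModulus, tsum_div_const] using h
  · have h2 : Tendsto (fun d : ℝ => d * 2 ^ (j + 1)) (nhdsWithin 0 (Ioi 0)) (nhdsWithin 0 (Ioi 0)) := by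
      refine tendsto_nhdsWithin_iff.2 ⟨?_, ?_⟩
      · have : Tendsto (fun d : ℝ => d * 2 ^ (j + 1)) (nhds 0) (nhds (0 * 2 ^ (j + 1))) :=
          tendsto_id.mul_const _
        rw [zero_mul] at this
        exact this.mono_left nhdsWithin_le_nhds
      · filter_upwards [self_mem_nhdsWithin] with d hd
        exact mem_Ioi.2 (mul_pos hd (by positivity))
    have h3 := (hG0.comp h2).const_mul (shellWeight α j)
    rw [mul_zero] at h3
    refine h3.congr' ?_
    filter_upwards [self_mem_nhdsWithin] with d hd
    have hd : 0 < d := hd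
    have h4 : ((2 : ℝ) ^ (j + 1)) ^ α ≠ 0 := by positivity
    have h5 : d ^ α ≠ 0 := by positivity
    simp only [Function.comp, shellWeight]
    rw [Real.mul_rpow hd.le (by positivity)]
    field_simp
  · filter_upwards [self_mem_nhdsWithin] with d hd j
    have hd : 0 < d := hd
    have h1 := potentialTerm_le hG hd j
    rw [Real.norm_of_nonneg (div_nonneg h1.1 (by positivity)), div_le_iff₀ (by positivity)]
    linarith [h1.2]

lemma exists_shell {d a : ℝ} (hd : 0 < d) (ha : 0 < a) :
    ∃ j : ℤ, Real.log (1 + d / a) ≤ Real.log (1 + 2 ^ (-j)) ∧ a ≤ d * 2 ^ (j + 1) := by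
  obtain ⟨j, hj1, hj2⟩ := exists_mem_Ioc_zpow (div_pos ha hd) (one_lt_two (α := ℝ))
  refine ⟨j, Real.log_le_log (by positivity) ?_, ?_⟩
  · rw [zpow_neg, ← inv_div]
    gcongr
  · rw [div_le_iff₀ hd] at hj2; linarith

lemma lintegral_log_one_add_le {μ : Measure ℂ} (hα : 0 < α) (hα1 : α < 1)
    (hG : ∀ r, 0 < r → 0 ≤ G r ∧ G r ≤ K * r ^ α)
    (hμ : ∀ z r, 0 < r → μ (closedBall z r) ≤ ENNReal.ofReal (G r)) {d : ℝ} (hd : 0 < d) (z : ℂ) :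
    ∫⁻ w, ENNReal.ofReal (Real.log (1 + d / ‖z - w‖)) ∂μ ≤
      ENNReal.ofReal (potentialModulus G d) := by
  let c : ℤ → ℝ := fun j => Real.log (1 + (2 : ℝ) ^ (-j))
  calc ∫⁻ w, ENNReal.ofReal (Real.log (1 + d / ‖z - w‖)) ∂μ
      ≤ ∫⁻ w, ∑' j : ℤ, (closedBall z (d * 2 ^ (j + 1))).indicator
          (fun _ => ENNReal.ofReal (c j)) w ∂μ := by
        refine lintegral_mono fun w => ?_
        rcases eq_or_ne z w with rfl | hzw
        · simp
        obtain ⟨j, hj1, hj2⟩ := exists_shell hd (norm_pos_iff.2 (sub_ne_zero.2 hzw))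
        refine le_trans ?_ (ENNReal.le_tsum j)
        rw [indicator_of_mem]
        · exact ENNReal.ofReal_le_ofReal hj1
        · rwa [mem_closedBall, dist_comm, dist_eq_norm]
    _ = ∑' j : ℤ, ENNReal.ofReal (c j) * μ (closedBall z (d * 2 ^ (j + 1))) := by
        rw [lintegral_tsum fun j =>
          (measurable_const.indicator isClosed_closedBall.measurableSet).aemeasurable]
        exact tsum_congr fun j => lintegral_indicator_const isClosed_closedBall.measurableSet _
    _ ≤ ∑' j : ℤ, ENNReal.ofReal (c j * G (d * 2 ^ (j + 1))) := by
        refine ENNReal.tsum_le_tsum fun j => ?_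
        rw [ENNReal.ofReal_mul (log_one_add_zpow_nonneg _)]
        gcongr
        exact hμ z _ (by positivity)
    _ = ENNReal.ofReal (potentialModulus G d) :=
        (ENNReal.ofReal_tsum_of_nonneg (fun j => (potentialTerm_le hG hd j).1)
          (summable_potentialTerm hα hα1 hG hd)).symm

lemma log_one_add_div_nonneg {d : ℝ} (hd : 0 < d) (x : ℂ) : 0 ≤ Real.log (1 + d / ‖x‖) :=
  Real.log_nonneg (by have := div_nonneg hd.le (norm_nonneg x); linarith)

lemma integrable_log_one_add {μ : Measure ℂ} (hα : 0 < α) (hα1 : α < 1)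
    (hG : ∀ r, 0 < r → 0 ≤ G r ∧ G r ≤ K * r ^ α)
    (hμ : ∀ z r, 0 < r → μ (closedBall z r) ≤ ENNReal.ofReal (G r)) {d : ℝ} (hd : 0 < d) (z : ℂ) :
    Integrable (fun w => Real.log (1 + d / ‖z - w‖)) μ := by
  refine ⟨Measurable.aestronglyMeasurable (by fun_prop), ?_⟩
  rw [hasFiniteIntegral_iff_ofReal (Eventually.of_forall fun w => log_one_add_div_nonneg hd _)]
  exact (lintegral_log_one_add_le hα hα1 hG hμ hd z).trans_lt ENNReal.ofReal_lt_top

lemma integral_log_one_add_le {μ : Measure ℂ} (hα : 0 < α) (hα1 : α < 1)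
    (hG : ∀ r, 0 < r → 0 ≤ G r ∧ G r ≤ K * r ^ α)
    (hμ : ∀ z r, 0 < r → μ (closedBall z r) ≤ ENNReal.ofReal (G r)) {d : ℝ} (hd : 0 < d) (z : ℂ) :
    ∫ w, Real.log (1 + d / ‖z - w‖) ∂μ ≤ potentialModulus G d := by
  rw [integral_eq_lintegral_of_nonneg_ae (Eventually.of_forall fun w => log_one_add_div_nonneg hd _)
    (integrable_log_one_add hα hα1 hG hμ hd z).1]
  exact ENNReal.toReal_le_of_le_ofReal (potentialModulus_nonneg hG hd)
    (lintegral_log_one_add_le hα hα1 hG hμ hd z)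

lemma measure_singleton_of_growth {μ : Measure ℂ} (hα : 0 < α)
    (hG : ∀ r, 0 < r → 0 ≤ G r ∧ G r ≤ K * r ^ α)
    (hμ : ∀ z r, 0 < r → μ (closedBall z r) ≤ ENNReal.ofReal (G r)) (z : ℂ) : μ {z} = 0 := by
  have h1 : Tendsto (fun r : ℝ => ENNReal.ofReal (K * r ^ α)) (nhdsWithin 0 (Ioi 0)) (nhds 0) := by
    have := ((Real.continuousAt_rpow_const 0 α (Or.inr hα.le)).tendsto).const_mul K
    rw [Real.zero_rpow hα.ne', mul_zero] at this
    simpa using ENNReal.tendsto_ofReal (this.mono_left nhdsWithin_le_nhds)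
  refine le_antisymm (ge_of_tendsto h1 ?_) zero_le
  filter_upwards [self_mem_nhdsWithin] with r hr
  have hr : 0 < r := hr
  refine (measure_mono ?_).trans ((hμ z r hr).trans (ENNReal.ofReal_le_ofReal (hG r hr).2))
  simpa using hr.le

end Growth

end

section

open MeasureTheory ComplexConjugate

/-- The Cauchy transform of the complex measure `φ μ`. -/
def cauchyTransform (μ : Measure ℂ) (φ : ℂ → ℂ) (z : ℂ) : ℂ := ∫ w, φ w / (z - w) ∂μ

/-- The logarithmic potential of the complex measure `φ μ`. -/
def logPotential (μ : Measure ℂ) (φ : ℂ → ℂ) (z : ℂ) : ℂ := ∫ w, (Real.log ‖z - w‖ : ℂ) * φ w ∂μ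

/-- The real-linear map `v ↦ p v + q (conj v)`. -/
def wirtingerCLM (p q : ℂ) : ℂ →L[ℝ] ℂ :=
  p • ContinuousLinearMap.id ℝ ℂ + q • (Complex.conjCLE : ℂ →L[ℝ] ℂ)

@[simp] lemma wirtingerCLM_apply (p q v : ℂ) : wirtingerCLM p q v = p * v + q * conj v := by
  simp [wirtingerCLM]

lemma hasFDerivAt_log_norm_mul (c : ℂ) {w z : ℂ} (hz : z ≠ w) :
    HasFDerivAt (fun x : ℂ => (Real.log ‖x - w‖ : ℂ) * c)
      (wirtingerCLM (c / (z - w) / 2) (c / conj (z - w) / 2)) z := by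
  have hu : z - w ≠ 0 := sub_ne_zero.2 hz
  have h1 : HasFDerivAt (fun x : ℂ => ‖x - w‖ ^ 2) (2 • innerSL ℝ (z - w)) z := by
    have := (hasStrictFDerivAt_norm_sq (z - w)).hasFDerivAt.comp z ((hasFDerivAt_id z).sub_const w)
    exact this.congr_fderiv (by ext; simp)
  have h2 := (h1.log (by positivity)).const_mul (1 / 2 : ℝ)
  have h3 := (Complex.ofRealCLM.hasFDerivAt.comp z h2).mul_const c
  have h4 : (fun x : ℂ => (Real.log ‖x - w‖ : ℂ) * c) =
      fun y => (Complex.ofRealCLM ∘ fun y => 1 / 2 * Real.log (‖y - w‖ ^ 2)) y * c := by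
    funext x
    simp only [Function.comp, Complex.ofRealCLM_apply, Real.log_pow]
    push_cast; ring
  rw [h4]
  refine h3.congr_fderiv (ContinuousLinearMap.ext fun v => ?_)
  have h5 : ((inner ℝ (z - w) v : ℝ) : ℂ) = (conj (z - w) * v + (z - w) * conj v) / 2 := by
    rw [Complex.inner, Complex.re_eq_add_conj]
    simp only [map_mul, Complex.conj_conj]; ring
  have h6 : ((‖z - w‖ ^ 2 : ℝ) : ℂ) = (z - w) * conj (z - w) := by
    rw [Complex.mul_conj, Complex.normSq_eq_norm_sq]
  have h7 : conj (z - w) ≠ 0 := (map_ne_zero _).2 hu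
  simp only [wirtingerCLM_apply, smul_apply, ContinuousLinearMap.comp_apply,
    Complex.ofRealCLM_apply, smul_eq_mul, innerSL_apply_apply, nsmul_eq_mul, Nat.cast_ofNat]
  push_cast at h6 ⊢
  rw [h5, h6]
  field_simp

lemma conj_cauchyTransform_conj (μ : Measure ℂ) (φ : ℂ → ℂ) (z : ℂ) : conj (cauchyTransform μ (fun w => conj (φ w)) z) =
    ∫ w, φ w / conj (z - w) ∂μ := by
  rw [cauchyTransform, ← integral_conj]
  simp

lemma exists_ball_ae {μ : Measure ℂ} {A : Set ℂ} (hA : IsClosed A) (hμ : μ Aᶜ = 0) {z : ℂ} (hz : z ∉ A) :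
    ∃ δ > 0, ∀ᵐ w ∂μ, ∀ x ∈ ball z δ, δ ≤ ‖x - w‖ := by
  obtain ⟨ε, hε, hball⟩ := Metric.isOpen_iff.1 hA.isOpen_compl z hz
  refine ⟨ε / 2, half_pos hε, ?_⟩
  have : ∀ᵐ w ∂μ, w ∈ A := hμ
  filter_upwards [this] with w hw x hx
  by_contra! h
  refine absurd hw (hball ?_)
  rw [mem_ball, dist_eq_norm] at hx ⊢
  calc ‖w - z‖ = ‖(x - z) - (x - w)‖ := by congr 1; ring
    _ ≤ ‖x - z‖ + ‖x - w‖ := norm_sub_le _ _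
    _ < ε := by linarith

section Potential

variable {μ : Measure ℂ} [IsFiniteMeasure μ] {φ : ℂ → ℂ} {A : Set ℂ}

lemma integrable_cauchyKernel (hA : IsClosed A) (hμ : μ Aᶜ = 0) (hφ : Measurable φ)
    (hφ1 : ∀ w, ‖φ w‖ ≤ 1) {z : ℂ} (hz : z ∉ A) : Integrable (fun w => φ w / (z - w)) μ := by
  obtain ⟨δ, hδ, hb⟩ := exists_ball_ae hA hμ hz
  refine Integrable.mono' (integrable_const (1 / δ)) (Measurable.aestronglyMeasurable (by fun_prop)) ?_
  filter_upwards [hb] with w hw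
  rw [norm_div]
  exact div_le_div₀ zero_le_one (hφ1 w) hδ (hw z (mem_ball_self hδ))

lemma differentiableOn_cauchyTransform (hA : IsClosed A) (hμ : μ Aᶜ = 0) (hφ : Measurable φ)
    (hφ1 : ∀ w, ‖φ w‖ ≤ 1) : DifferentiableOn ℂ (cauchyTransform μ φ) Aᶜ := by
  intro z hz
  obtain ⟨δ, hδ, hb⟩ := exists_ball_ae hA hμ hz
  refine (hasDerivAt_integral_of_dominated_loc_of_deriv_le (ball_mem_nhds z hδ)
    (F := fun x w => φ w / (x - w)) (F' := fun x w => -φ w / (x - w) ^ 2)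
    (bound := fun _ => 1 / δ ^ 2) (Eventually.of_forall fun x =>
      Measurable.aestronglyMeasurable (by fun_prop))
    (integrable_cauchyKernel hA hμ hφ hφ1 hz) (Measurable.aestronglyMeasurable (by fun_prop)) ?_
    (integrable_const _)
    ?_).2.differentiableAt.differentiableWithinAt
  · filter_upwards [hb] with w hw x hx
    rw [norm_div, norm_neg, norm_pow]
    exact div_le_div₀ zero_le_one (hφ1 w) (by positivity) (by gcongr; exact hw x hx)
  · filter_upwards [hb] with w hw x hx
    have h0 : x - w ≠ 0 := norm_pos_iff.1 (hδ.trans_le (hw x hx))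
    have := (((hasDerivAt_id x).sub_const w).inv h0).const_mul (φ w)
    refine this.congr_deriv ?_
    simp only [id]; ring

lemma hasFDerivAt_logPotential (hA : IsClosed A) (hμ : μ Aᶜ = 0) (hφ : Measurable φ)
    (hφ1 : ∀ w, ‖φ w‖ ≤ 1) {z : ℂ} (hz : z ∉ A)
    (hint : Integrable (fun w => (Real.log ‖z - w‖ : ℂ) * φ w) μ) :
    HasFDerivAt (logPotential μ φ) (wirtingerCLM (cauchyTransform μ φ z / 2)
      (conj (cauchyTransform μ (fun w => conj (φ w)) z) / 2)) z := by
  obtain ⟨δ, hδ, hb⟩ := exists_ball_ae hA hμ hz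
  have hmeas : AEStronglyMeasurable
      (fun w => wirtingerCLM (φ w / (z - w) / 2) (φ w / conj (z - w) / 2)) μ := by
    refine AEStronglyMeasurable.add (AEStronglyMeasurable.smul_const ?_ _)
      (AEStronglyMeasurable.smul_const ?_ _)
    · exact Measurable.aestronglyMeasurable (by fun_prop)
    · refine Measurable.aestronglyMeasurable ?_
      exact (hφ.div (Complex.continuous_conj.measurable.comp (by fun_prop))).div_const 2
  have hnorm : ∀ p q : ℂ, ‖wirtingerCLM p q‖ ≤ ‖p‖ + ‖q‖ := fun p q =>
    ContinuousLinearMap.opNorm_le_bound _ (by positivity) fun v => by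
      rw [wirtingerCLM_apply, add_mul]
      refine (norm_add_le _ _).trans (by simp)
  have h := hasFDerivAt_integral_of_dominated_of_fderiv_le (𝕜 := ℝ) (μ := μ) (ball_mem_nhds z hδ)
    (F := fun x w => (Real.log ‖x - w‖ : ℂ) * φ w)
    (F' := fun x w => wirtingerCLM (φ w / (x - w) / 2) (φ w / conj (x - w) / 2))
    (bound := fun _ => 1 / δ) (Eventually.of_forall fun x =>
      Measurable.aestronglyMeasurable (by fun_prop)) hint hmeas ?_ (integrable_const _) ?_
  · refine h.congr_fderiv ?_
    have hi := integrable_cauchyKernel hA hμ hφ hφ1 hz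
    have hi2 : Integrable (fun w => φ w / conj (z - w)) μ := by
      have := integrable_cauchyKernel hA hμ (φ := fun w => conj (φ w))
        (Complex.continuous_conj.measurable.comp hφ) (by simpa using hφ1) hz
      simpa using (Complex.conjCLE : ℂ →L[ℝ] ℂ).integrable_comp this
    rw [conj_cauchyTransform_conj, cauchyTransform]
    unfold wirtingerCLM
    rw [integral_add ((hi.div_const 2).smul_const _) ((hi2.div_const 2).smul_const _),
      integral_smul_const, integral_smul_const, integral_div, integral_div]
  · filter_upwards [hb] with w hw x hx
    refine (hnorm _ _).trans ?_
    have h1 : ‖φ w‖ / ‖x - w‖ ≤ 1 / δ := div_le_div₀ zero_le_one (hφ1 w) hδ (hw x hx)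
    simp only [norm_div, RCLike.norm_conj, Complex.norm_ofNat]
    linarith
  · filter_upwards [hb] with w hw x hx
    exact hasFDerivAt_log_norm_mul _ (sub_ne_zero.1 (norm_pos_iff.1 (hδ.trans_le (hw x hx))))

lemma harmonicOnC_logPotential (hA : IsClosed A) (hμ : μ Aᶜ = 0) (hφ : Measurable φ)
    (hφ1 : ∀ w, ‖φ w‖ ≤ 1)
    (hint : ∀ z, Integrable (fun w => (Real.log ‖z - w‖ : ℂ) * φ w) μ) {V : Set ℂ}
    (hV : IsOpen V) (hVA : Disjoint V A) : HarmonicOnC (logPotential μ φ) V := by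
  have hVA' : V ⊆ Aᶜ := hVA.subset_compl_right
  let p := cauchyTransform μ φ
  let q := cauchyTransform μ (fun w => conj (φ w))
  have hp : DifferentiableOn ℂ p V := (differentiableOn_cauchyTransform hA hμ hφ hφ1).mono hVA'
  have hq : DifferentiableOn ℂ q V := (differentiableOn_cauchyTransform hA hμ
    (Complex.continuous_conj.measurable.comp hφ) (by simpa using hφ1)).mono hVA'
  have hd : ∀ z ∈ V, HasFDerivAt (logPotential μ φ) (wirtingerCLM (p z / 2) (conj (q z) / 2)) z :=
    fun z hz => hasFDerivAt_logPotential hA hμ hφ hφ1 (hVA' hz) (hint z)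
  have hpc : ContDiffOn ℝ 1 p V := (hp.contDiffOn hV).restrict_scalars ℝ
  have hqc : ContDiffOn ℝ 1 q V := (hq.contDiffOn hV).restrict_scalars ℝ
  refine ⟨?_, fun z hz => ?_⟩
  · rw [show (2 : WithTop ℕ∞) = 1 + 1 from rfl, contDiffOn_succ_iff_fderiv_of_isOpen hV]
    refine ⟨fun z hz => (hd z hz).differentiableAt.differentiableWithinAt, by simp, ?_⟩
    refine ContDiffOn.congr (f := fun z => wirtingerCLM (p z / 2) (conj (q z) / 2)) ?_
      fun z hz => (hd z hz).fderiv
    unfold wirtingerCLM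
    exact ((hpc.div_const 2).smul contDiffOn_const).add
      (((Complex.conjCLE.contDiff.comp_contDiffOn hqc).div_const 2).smul contDiffOn_const)
  · have hV' : V ∈ nhds z := hV.mem_nhds hz
    have hp' := (hp.differentiableAt hV').hasDerivAt.hasFDerivAt.restrictScalars ℝ
    have hq' := (hq.differentiableAt hV').hasDerivAt.hasFDerivAt.restrictScalars ℝ
    have hqc' := (Complex.conjCLE : ℂ →L[ℝ] ℂ).hasFDerivAt.comp z hq'
    have e : ∀ v : ℂ, HasFDerivAt (fun w => fderiv ℝ (logPotential μ φ) w v) _ z := fun v =>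
      ((hp'.mul_const (v / 2)).add (hqc'.mul_const (conj v / 2))).congr_of_eventuallyEq (by
        filter_upwards [hV'] with w hw
        rw [(hd w hw).fderiv, wirtingerCLM_apply]
        simp only [Function.comp, ContinuousLinearEquiv.coe_coe, Complex.conjCLE_apply, Pi.add_apply]
        ring)
    rw [(e 1).fderiv, (e Complex.I).fderiv]
    simp only [add_apply, smul_apply,
      ContinuousLinearMap.comp_apply, ContinuousLinearMap.coe_restrictScalars',
      ContinuousLinearMap.toSpanSingleton_apply, ContinuousLinearEquiv.coe_coe, Complex.conjCLE_apply,
      smul_eq_mul, map_mul, map_one, Complex.conj_I]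
    linear_combination (deriv p z / 2 + conj (deriv q z) / 2) * Complex.I_mul_I

end Potential

end

section

open MeasureTheory ComplexConjugate

section HolderBounds

variable {α K R : ℝ} {G : ℝ → ℝ} {μ : Measure ℂ} [IsFiniteMeasure μ] {φ : ℂ → ℂ} {b : ℂ}

lemma abs_log_le {a : ℝ} (ha : 0 < a) : |Real.log a| ≤ Real.log (1 + 1 / a) + a := by
  have h1 : 0 < 1 / a := by positivity
  have h2 := Real.log_le_log h1 (by linarith : 1 / a ≤ 1 + 1 / a)
  have h3 := Real.log_nonneg (by linarith : 1 ≤ 1 + 1 / a)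
  rw [one_div, Real.log_inv] at h2
  rw [one_div] at h3
  have h4 := Real.log_le_sub_one_of_pos ha
  rw [one_div]
  exact abs_le.2 ⟨by linarith, by linarith⟩

lemma ae_ne_of_growth {μ : Measure ℂ} (hα : 0 < α) (hG : ∀ r, 0 < r → 0 ≤ G r ∧ G r ≤ K * r ^ α)
    (hμ : ∀ z r, 0 < r → μ (closedBall z r) ≤ ENNReal.ofReal (G r)) (z : ℂ) :
    ∀ᵐ w ∂μ, 0 < ‖z - w‖ := by
  have : ∀ᵐ w ∂μ, w ∈ ({z} : Set ℂ)ᶜ :=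
    compl_mem_ae_iff.2 (measure_singleton_of_growth hα hG hμ z)
  filter_upwards [this] with w hw
  exact norm_pos_iff.2 (sub_ne_zero.2 (Ne.symm hw))

lemma norm_logPotential_integrand_le {μ : Measure ℂ} (hα : 0 < α) (hG : ∀ r, 0 < r → 0 ≤ G r ∧ G r ≤ K * r ^ α)
    (hμ : ∀ z r, 0 < r → μ (closedBall z r) ≤ ENNReal.ofReal (G r))
    (hb : μ (closedBall b (1 / 2))ᶜ = 0) (hφ1 : ∀ w, ‖φ w‖ ≤ 1) (z : ℂ) :
    ∀ᵐ w ∂μ, ‖(Real.log ‖z - w‖ : ℂ) * φ w‖ ≤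
      Real.log (1 + 1 / ‖z - w‖) + (‖z - b‖ + 1 / 2) := by
  have hb' : ∀ᵐ w ∂μ, w ∈ closedBall b (1 / 2) := hb
  filter_upwards [hb', ae_ne_of_growth hα hG hμ z] with w hw hzw
  rw [norm_mul, Complex.norm_real, Real.norm_eq_abs]
  refine (mul_le_of_le_one_right (abs_nonneg _) (hφ1 w)).trans ((abs_log_le hzw).trans ?_)
  rw [mem_closedBall', dist_eq_norm] at hw
  have : ‖z - w‖ ≤ ‖z - b‖ + ‖b - w‖ := norm_sub_le_norm_sub_add_norm_sub z b w
  linarith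

lemma integrable_logPotential (hα : 0 < α) (hα1 : α < 1)
    (hG : ∀ r, 0 < r → 0 ≤ G r ∧ G r ≤ K * r ^ α)
    (hμ : ∀ z r, 0 < r → μ (closedBall z r) ≤ ENNReal.ofReal (G r))
    (hb : μ (closedBall b (1 / 2))ᶜ = 0) (hφ : Measurable φ) (hφ1 : ∀ w, ‖φ w‖ ≤ 1) (z : ℂ) :
    Integrable (fun w => (Real.log ‖z - w‖ : ℂ) * φ w) μ :=
  Integrable.mono' ((integrable_log_one_add hα hα1 hG hμ one_pos z).add (integrable_const _))
    (Measurable.aestronglyMeasurable (by fun_prop))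
    (norm_logPotential_integrand_le hα hG hμ hb hφ1 z)

lemma norm_logPotential_le (hα : 0 < α) (hα1 : α < 1)
    (hG : ∀ r, 0 < r → 0 ≤ G r ∧ G r ≤ K * r ^ α)
    (hμ : ∀ z r, 0 < r → μ (closedBall z r) ≤ ENNReal.ofReal (G r))
    (hb : μ (closedBall b (1 / 2))ᶜ = 0) (hφ1 : ∀ w, ‖φ w‖ ≤ 1) (z : ℂ) :
    ‖logPotential μ φ z‖ ≤ potentialModulus G 1 + μ.real univ * (‖z - b‖ + 1 / 2) := by
  have hi := integrable_log_one_add hα hα1 hG hμ one_pos z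
  refine (norm_integral_le_of_norm_le (hi.add (integrable_const _))
    (norm_logPotential_integrand_le hα hG hμ hb hφ1 z)).trans ?_
  simp only [Pi.add_apply]
  rw [integral_add hi (integrable_const _), integral_const, smul_eq_mul]
  gcongr
  exact integral_log_one_add_le hα hα1 hG hμ one_pos z

lemma norm_logPotential_sub_le (hα : 0 < α) (hα1 : α < 1)
    (hG : ∀ r, 0 < r → 0 ≤ G r ∧ G r ≤ K * r ^ α)
    (hμ : ∀ z r, 0 < r → μ (closedBall z r) ≤ ENNReal.ofReal (G r))
    (hb : μ (closedBall b (1 / 2))ᶜ = 0) (hφ : Measurable φ) (hφ1 : ∀ w, ‖φ w‖ ≤ 1) {z z' : ℂ}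
    (hz : z ≠ z') :
    ‖logPotential μ φ z - logPotential μ φ z'‖ ≤ 2 * potentialModulus G ‖z - z'‖ := by
  have hd : 0 < ‖z - z'‖ := norm_pos_iff.2 (sub_ne_zero.2 hz)
  rw [logPotential, logPotential, ← integral_sub (integrable_logPotential hα hα1 hG hμ hb hφ hφ1 z)
    (integrable_logPotential hα hα1 hG hμ hb hφ hφ1 z')]
  have hi := integrable_log_one_add hα hα1 hG hμ hd z
  have hi' := integrable_log_one_add hα hα1 hG hμ hd z'
  refine (norm_integral_le_of_norm_le (hi.add hi') ?_).trans ?_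
  · filter_upwards [ae_ne_of_growth hα hG hμ z, ae_ne_of_growth hα hG hμ z'] with w hw hw'
    rw [← sub_mul, ← Complex.ofReal_sub, norm_mul, Complex.norm_real, Real.norm_eq_abs]
    refine (mul_le_of_le_one_right (abs_nonneg _) (hφ1 w)).trans (abs_log_sub_log_le hw hw' ?_)
    refine (abs_norm_sub_norm_le _ _).trans (le_of_eq ?_)
    congr 1; ring
  · simp only [Pi.add_apply]
    rw [integral_add hi hi', two_mul]
    exact add_le_add (integral_log_one_add_le hα hα1 hG hμ hd z)
      (integral_log_one_add_le hα hα1 hG hμ hd z')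

lemma measureReal_univ_le_of_growth {μ : Measure ℂ}
    (hG : ∀ r, 0 < r → 0 ≤ G r ∧ G r ≤ K * r ^ α)
    (hμ : ∀ z r, 0 < r → μ (closedBall z r) ≤ ENNReal.ofReal (G r))
    (hb : μ (closedBall b (1 / 2))ᶜ = 0) : μ.real univ ≤ K := by
  have h0 : μ (closedBall b 1)ᶜ = 0 :=
    measure_mono_null (compl_subset_compl.2 (closedBall_subset_closedBall (by norm_num))) hb
  have h1 : μ univ ≤ ENNReal.ofReal (G 1) := by
    rw [← measure_add_measure_compl (isClosed_closedBall (x := b) (ε := 1)).measurableSet, h0,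
      add_zero]
    exact hμ b 1 one_pos
  have h2 := (hG 1 one_pos).2
  rw [Real.one_rpow, mul_one] at h2
  exact (ENNReal.toReal_le_of_le_ofReal (hG 1 one_pos).1 h1).trans h2

lemma littleHolderOn_logPotential (hα : 0 < α) (hα1 : α < 1)
    (hG : ∀ r, 0 < r → 0 ≤ G r ∧ G r ≤ K * r ^ α)
    (hG0 : Tendsto (fun r => G r / r ^ α) (nhdsWithin 0 (Ioi 0)) (nhds 0))
    (hμ : ∀ z r, 0 < r → μ (closedBall z r) ≤ ENNReal.ofReal (G r))
    (hb : μ (closedBall b (1 / 2))ᶜ = 0) (hφ : Measurable φ) (hφ1 : ∀ w, ‖φ w‖ ≤ 1) (E : Set ℂ) :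
    LittleHolderOn α E (logPotential μ φ) := by
  have hsub := fun z z' => norm_logPotential_sub_le hα hα1 hG hμ hb hφ hφ1 (z := z) (z' := z')
  refine ⟨⟨2 * (K * ∑' j, shellWeight α j), fun x _ y _ => ?_⟩, ?_⟩
  · rcases eq_or_ne x y with rfl | hxy
    · simp [Real.zero_rpow hα.ne']
    · have := potentialModulus_le hα hα1 hG (norm_pos_iff.2 (sub_ne_zero.2 hxy))
      linarith [hsub x y hxy]
  · refine tendsto_order.2 ⟨fun c hc => ?_, fun c hc => ?_⟩
    · refine Eventually.of_forall fun δ => hc.trans_le (Real.sSup_nonneg ?_)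
      rintro q ⟨x, -, y, -, -, -, rfl⟩
      positivity
    · obtain ⟨δ₀, hδ₀, hδ⟩ := mem_nhdsGT_iff_exists_Ioo_subset.1
        ((tendsto_potentialModulus_div hα hα1 hG hG0).eventually (gt_mem_nhds (by linarith : 0 < c / 4)))
      filter_upwards [Ioo_mem_nhdsGT (mem_Ioi.1 hδ₀)] with δ hδ1
      refine lt_of_le_of_lt (Real.sSup_le ?_ (by linarith : 0 ≤ c / 2)) (by linarith)
      rintro q ⟨x, -, y, -, hxy, hd, rfl⟩
      have hd0 : 0 < ‖x - y‖ := norm_pos_iff.2 (sub_ne_zero.2 hxy)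
      have h1 : potentialModulus G ‖x - y‖ / ‖x - y‖ ^ α < c / 4 := hδ ⟨hd0, hd.trans_lt hδ1.2⟩
      have h2 : ‖logPotential μ φ x - logPotential μ φ y‖ / ‖x - y‖ ^ α ≤
          2 * (potentialModulus G ‖x - y‖ / ‖x - y‖ ^ α) := by
        rw [← mul_div_assoc]
        gcongr
        exact hsub x y hxy
      linarith

lemma HNorm_logPotential_le (hα : 0 < α) (hα1 : α < 1) (hK : 0 ≤ K) (hR : 0 ≤ R)
    (hG : ∀ r, 0 < r → 0 ≤ G r ∧ G r ≤ K * r ^ α)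
    (hμ : ∀ z r, 0 < r → μ (closedBall z r) ≤ ENNReal.ofReal (G r))
    (hb : μ (closedBall b (1 / 2))ᶜ = 0) (hφ : Measurable φ) (hφ1 : ∀ w, ‖φ w‖ ≤ 1) {U : Set ℂ}
    (hU : closure U ⊆ closedBall b R) :
    HNorm α U (logPotential μ φ) ≤ K * (3 * ∑' j, shellWeight α j + R + 1 / 2) := by
  have hS : 0 ≤ ∑' j, shellWeight α j := tsum_nonneg (shellWeight_nonneg α)
  have h1 : HNorm α U (logPotential μ φ) ≤
      K * (∑' j, shellWeight α j + R + 1 / 2) + 2 * (K * ∑' j, shellWeight α j) := by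
    refine add_le_add (Real.sSup_le ?_ (by positivity)) (Real.sSup_le ?_ (by positivity))
    · rintro _ ⟨x, hx, rfl⟩
      have h2 := potentialModulus_le hα hα1 hG one_pos
      rw [Real.one_rpow, mul_one] at h2
      have h3 : ‖x - b‖ ≤ R := by simpa [dist_eq_norm] using hU hx
      have h4 := measureReal_univ_le_of_growth hG hμ hb
      have h5 : μ.real univ * (‖x - b‖ + 1 / 2) ≤ K * (R + 1 / 2) := by gcongr
      have := norm_logPotential_le hα hα1 hG hμ hb hφ1 x
      simp only
      linarith
    · rintro q ⟨x, -, y, -, hxy, rfl⟩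
      have hd0 : 0 < ‖x - y‖ := norm_pos_iff.2 (sub_ne_zero.2 hxy)
      rw [div_le_iff₀ (by positivity)]
      have := potentialModulus_le hα hα1 hG hd0
      linarith [norm_logPotential_sub_le hα hα1 hG hμ hb hφ hφ1 hxy]
  linarith

end HolderBounds

/-- Lower bound for the derivative of the potential with the optimal phase. -/
lemma dzDeriv_logPotential {μ : Measure ℂ} [IsFiniteMeasure μ] {φ : ℂ → ℂ} {A : Set ℂ}
    (hA : IsClosed A) (hμ : μ Aᶜ = 0) (hφ : Measurable φ) (hφ1 : ∀ w, ‖φ w‖ ≤ 1) {b : ℂ} (hb : b ∉ A)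
    (hint : Integrable (fun w => (Real.log ‖b - w‖ : ℂ) * φ w) μ) :
    dzDeriv (logPotential μ φ) b = cauchyTransform μ φ b / 2 := by
  rw [dzDeriv, (hasFDerivAt_logPotential hA hμ hφ hφ1 hb hint).fderiv]
  simp only [wirtingerCLM_apply, map_one, Complex.conj_I]
  linear_combination (- cauchyTransform μ φ b / 4 +
    conj (cauchyTransform μ (fun w => conj (φ w)) b) / 4) * Complex.I_mul_I

end

section

open MeasureTheory ComplexConjugate

lemma sum_pow_succ_le {q A : ℝ} (hq : 0 < q) (hq1 : q < 1) (hA : 0 ≤ A) (S : Finset ℕ)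
    (hS : ∀ n ∈ S, q ^ (n + 1) ≤ A) : ∑ n ∈ S, q ^ (n + 1) ≤ A / (1 - q) := by
  rcases S.eq_empty_or_nonempty with rfl | hne
  · simpa using div_nonneg hA (by linarith)
  have hsub : S ⊆ Finset.Ico (S.min' hne) (S.max' hne + 1) := fun n hn =>
    Finset.mem_Ico.2 ⟨S.min'_le n hn, Nat.lt_succ_of_le (S.le_max' n hn)⟩
  refine (Finset.sum_le_sum_of_subset_of_nonneg hsub fun _ _ _ => by positivity).trans ?_
  simp only [pow_succ]
  rw [← Finset.sum_mul]
  refine (mul_le_mul_of_nonneg_right (geom_sum_Ico_le_of_lt_one hq.le hq1) hq.le).trans ?_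
  rw [div_mul_eq_mul_div, ← pow_succ]
  exact div_le_div_of_nonneg_right (hS _ (S.min'_mem hne)) (by linarith)

lemma mem_Ann_iff {b z : ℂ} {n : ℕ} :
    z ∈ Ann b n ↔ (1 / 2 : ℝ) ^ (n + 1) ≤ ‖z - b‖ ∧ ‖z - b‖ ≤ (1 / 2 : ℝ) ^ n := by
  have e1 : (2 : ℝ) ^ (-(n : ℝ) - 1) = (1 / 2 : ℝ) ^ (n + 1) := by
    rw [show -(n : ℝ) - 1 = -((n + 1 : ℕ) : ℝ) by push_cast; ring, Real.rpow_neg zero_le_two,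
      Real.rpow_natCast, one_div, inv_pow]
  have e2 : (2 : ℝ) ^ (-(n : ℝ)) = (1 / 2 : ℝ) ^ n := by
    rw [Real.rpow_neg zero_le_two, Real.rpow_natCast, one_div, inv_pow]
  rw [← e1, ← e2]; rfl

lemma isClosed_Ann (b : ℂ) (n : ℕ) : IsClosed (Ann b n) :=
  (isClosed_le (f := fun _ => (2 : ℝ) ^ (-(n : ℝ) - 1)) (g := fun z : ℂ => ‖z - b‖)
    continuous_const (by fun_prop)).inter
    (isClosed_le (f := fun z : ℂ => ‖z - b‖) (g := fun _ => (2 : ℝ) ^ (-(n : ℝ)))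
      (by fun_prop) continuous_const)

lemma Ann_subset_closedBall (b : ℂ) (n : ℕ) : Ann b n ⊆ closedBall b ((1 / 2) ^ n) := fun z hz => by
  rw [mem_closedBall, dist_eq_norm]; exact (mem_Ann_iff.1 hz).2

/-- Only three annuli that are large compared with `r` meet a given disc of radius `r`. -/
lemma card_Ann_meets_le {b z : ℂ} {r : ℝ} (S : Finset ℕ)
    (hS : ∀ n ∈ S, 4 * r < (1 / 2) ^ n ∧ (closedBall z r ∩ Ann b n).Nonempty) : S.card ≤ 3 := by
  rcases S.eq_empty_or_nonempty with rfl | hne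
  · simp
  have hX : ∀ n ∈ S, (1 / 2 : ℝ) ^ n < 4 * ‖z - b‖ ∧ 4 * ‖z - b‖ < 5 * (1 / 2) ^ n := by
    intro n hn
    obtain ⟨h4, w, hw, hwA⟩ := hS n hn
    rw [mem_closedBall, dist_eq_norm] at hw
    obtain ⟨h1, h2⟩ := mem_Ann_iff.1 hwA
    have h5 : ‖w - b‖ ≤ ‖w - z‖ + ‖z - b‖ := norm_sub_le_norm_sub_add_norm_sub w z b
    have h6 : ‖z - b‖ ≤ ‖z - w‖ + ‖w - b‖ := norm_sub_le_norm_sub_add_norm_sub z w b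
    rw [norm_sub_rev z w] at h6
    rw [pow_succ] at h1
    constructor <;> linarith
  have hsub : S ⊆ Finset.Icc (S.min' hne) (S.min' hne + 2) := fun n hn => by
    refine Finset.mem_Icc.2 ⟨S.min'_le n hn, ?_⟩
    by_contra! hlt
    have h1 := (hX _ (S.min'_mem hne)).1.trans (hX n hn).2
    have h2 : (1 / 2 : ℝ) ^ n ≤ (1 / 2) ^ (S.min' hne + 3) :=
      pow_le_pow_of_le_one (by norm_num) (by norm_num) hlt
    rw [pow_add] at h2
    have h3 : (0 : ℝ) < (1 / 2) ^ S.min' hne := by positivity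
    norm_num at h2
    linarith
  refine (Finset.card_le_card hsub).trans ?_
  rw [Nat.card_Icc]; omega

/-- The growth constant of the sum of the Frostman measures of the annuli. -/
def growthConst (α : ℝ) : ℝ := 4 ^ α / (1 - (1 / 2) ^ α) + 108 * 8 ^ α

lemma growthConst_pos {α : ℝ} (hα : 0 < α) : 0 < growthConst α := by
  have : (1 / 2 : ℝ) ^ α < 1 := Real.rpow_lt_one (by norm_num) (by norm_num) hα
  have : 0 < 1 - (1 / 2 : ℝ) ^ α := by linarith
  unfold growthConst; positivity

lemma sum_frostman_growth {α : ℝ} (hα : 0 < α) {h : ℝ → ℝ} (hh : IsGauge α h) {b : ℂ}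
    {μ : ℕ → Measure ℂ} {E : ℕ → Set ℂ} (hE : ∀ n, E n ⊆ Ann b (n + 1))
    (h1 : ∀ n, μ n univ = MhContent h (E n)) (h2 : ∀ n, μ n (E n)ᶜ = 0)
    (h3 : ∀ n x r, 0 < r → μ n (closedBall x r) ≤ 36 * ENNReal.ofReal (h (8 * r)))
    (N : ℕ) (z : ℂ) {r : ℝ} (hr : 0 < r) :
    ∑ n ∈ Finset.range N, μ n (closedBall z r) ≤ ENNReal.ofReal (growthConst α * r ^ α) := by
  classical
  have hq : (0 : ℝ) < (1 / 2) ^ α := by positivity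
  have hq1 : (1 / 2 : ℝ) ^ α < 1 := Real.rpow_lt_one (by norm_num) (by norm_num) hα
  have hpow : ∀ n : ℕ, ((1 / 2 : ℝ) ^ n) ^ α = ((1 / 2 : ℝ) ^ α) ^ n := fun n => by
    rw [← Real.rpow_natCast, ← Real.rpow_mul (by norm_num), mul_comm, Real.rpow_mul (by norm_num),
      Real.rpow_natCast]
  let S := Finset.range N
  let P : ℕ → Prop := fun n => (1 / 2 : ℝ) ^ (n + 1) ≤ 4 * r
  have hsmall : ∑ n ∈ S with P n, μ n (closedBall z r) ≤
      ENNReal.ofReal (4 ^ α / (1 - (1 / 2) ^ α) * r ^ α) := by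
    calc ∑ n ∈ S with P n, μ n (closedBall z r)
        ≤ ∑ n ∈ S with P n, ENNReal.ofReal (((1 / 2 : ℝ) ^ α) ^ (n + 1)) := by
          refine Finset.sum_le_sum fun n _ => (measure_mono (subset_univ _)).trans ?_
          rw [h1, ← hpow]
          exact (MhContent_le_of_subset_closedBall hα hh (by positivity)
            ((hE n).trans (Ann_subset_closedBall b _))).trans
            (ENNReal.ofReal_le_ofReal (hh.2.1 _ (by positivity)).2)
      _ = ENNReal.ofReal (∑ n ∈ S with P n, ((1 / 2 : ℝ) ^ α) ^ (n + 1)) :=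
          (ENNReal.ofReal_sum_of_nonneg fun _ _ => by positivity).symm
      _ ≤ _ := by
          refine ENNReal.ofReal_le_ofReal ?_
          rw [div_mul_eq_mul_div, ← Real.mul_rpow (by norm_num) hr.le]
          refine sum_pow_succ_le hq hq1 (by positivity) _ fun n hn => ?_
          rw [← hpow]
          exact Real.rpow_le_rpow (by positivity) (Finset.mem_filter.1 hn).2 hα.le
  have hlarge : ∑ n ∈ S with ¬ P n, μ n (closedBall z r) ≤ ENNReal.ofReal (108 * 8 ^ α * r ^ α) := by
    let Q : ℕ → Prop := fun n => (closedBall z r ∩ Ann b (n + 1)).Nonempty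
    have hz : ∑ n ∈ (S.filter fun n => ¬ P n) with ¬ Q n, μ n (closedBall z r) = 0 := by
      refine Finset.sum_eq_zero fun n hn => measure_mono_null ?_ (h2 n)
      intro w hw hwE
      exact (Finset.mem_filter.1 hn).2 ⟨w, hw, hE n hwE⟩
    rw [← Finset.sum_filter_add_sum_filter_not _ Q, hz, add_zero]
    have hcard : ((S.filter fun n => ¬ P n).filter Q).card ≤ 3 := by
      rw [← Finset.card_map ⟨Nat.succ, Nat.succ_injective⟩]
      refine card_Ann_meets_le (b := b) (z := z) (r := r) _ fun m hm => ?_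
      obtain ⟨n, hn, rfl⟩ := Finset.mem_map.1 hm
      rw [Finset.mem_filter, Finset.mem_filter] at hn
      exact ⟨not_le.1 hn.1.2, hn.2⟩
    refine (Finset.sum_le_card_nsmul _ _ (36 * ENNReal.ofReal (h (8 * r)))
      fun n _ => h3 n z r hr).trans ?_
    rw [nsmul_eq_mul]
    calc ((((S.filter fun n => ¬ P n).filter Q).card : ℕ) : ℝ≥0∞) * (36 * ENNReal.ofReal (h (8 * r)))
        ≤ 3 * (36 * ENNReal.ofReal ((8 * r) ^ α)) := by
          gcongr
          · exact_mod_cast hcard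
          · exact (hh.2.1 _ (by positivity)).2
      _ = ENNReal.ofReal (108 * 8 ^ α * r ^ α) := by
          rw [mul_assoc 108, ← Real.mul_rpow (by norm_num) hr.le,
            ENNReal.ofReal_mul (by norm_num), ← mul_assoc]
          congr 1
          rw [ENNReal.ofReal_ofNat]; norm_num
  rw [← Finset.sum_filter_add_sum_filter_not _ P, growthConst, add_mul, ENNReal.ofReal_add]
  · exact add_le_add hsmall hlarge
  · have : 0 < 1 - (1 / 2 : ℝ) ^ α := by linarith
    positivity
  · positivity

end

section

open MeasureTheory ComplexConjugate

/-- The optimal phase: `φ(w) / (b - w) = 1 / ‖b - w‖`. -/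
def phaseAt (b w : ℂ) : ℂ := (b - w) / ‖b - w‖

lemma measurable_phaseAt (b : ℂ) : Measurable (phaseAt b) := by
  unfold phaseAt; fun_prop

lemma norm_phaseAt_le (b w : ℂ) : ‖phaseAt b w‖ ≤ 1 := by
  rw [phaseAt, norm_div, Complex.norm_real, norm_norm]
  exact div_self_le_one _

lemma cauchyTransform_phaseAt (μ : Measure ℂ) (b : ℂ) :
    cauchyTransform μ (phaseAt b) b = ((∫ w, ‖b - w‖⁻¹ ∂μ : ℝ) : ℂ) := by
  rw [cauchyTransform, ← integral_complex_ofReal]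
  refine integral_congr_ae (Eventually.of_forall fun w => ?_)
  simp only [phaseAt]
  rcases eq_or_ne b w with rfl | h
  · simp
  · have : b - w ≠ 0 := sub_ne_zero.2 h
    push_cast
    field_simp

lemma sum_content_le_lintegral {h : ℝ → ℝ} {b : ℂ} {μ : ℕ → Measure ℂ} {E : ℕ → Set ℂ}
    (hE : ∀ n, E n ⊆ Ann b (n + 1)) (h1 : ∀ n, μ n univ = MhContent h (E n))
    (h2 : ∀ n, μ n (E n)ᶜ = 0) (N : ℕ) :
    ∑ n ∈ Finset.range N, (2 : ℝ≥0∞) ^ (n + 1) * MhContent h (E n) ≤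
      ∫⁻ w, ENNReal.ofReal ‖b - w‖⁻¹ ∂(∑ n ∈ Finset.range N, μ n) := by
  rw [lintegral_finsetSum_measure]
  refine Finset.sum_le_sum fun n _ => ?_
  rw [← h1, ← lintegral_const]
  refine lintegral_mono_ae ?_
  have : ∀ᵐ w ∂μ n, w ∈ E n := h2 n
  filter_upwards [this] with w hw
  obtain ⟨h3, h4⟩ := mem_Ann_iff.1 (hE n hw)
  rw [norm_sub_rev] at h3 h4
  have h5 : (2 : ℝ) ^ (n + 1) ≤ ‖b - w‖⁻¹ := by
    rw [le_inv_comm₀ (by positivity) (lt_of_lt_of_le (by positivity) h3), ← inv_pow]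
    simpa using h4
  calc (2 : ℝ≥0∞) ^ (n + 1) = ENNReal.ofReal ((2 : ℝ) ^ (n + 1)) := by
        rw [ENNReal.ofReal_pow zero_le_two]; simp
    _ ≤ _ := ENNReal.ofReal_le_ofReal h5

/-- The bounded point derivation gives a uniform bound on the partial sums for a single gauge. -/
lemma sum_content_le_of_derivation {α : ℝ} (hα : 0 < α) (hα1 : α < 1) {U : Set ℂ} (hU : IsOpen U)
    {b : ℂ} {R : ℝ} (hR : 0 ≤ R) (hUR : closure U ⊆ closedBall b R) {κ : ℝ} (hκ : 0 < κ)
    (hder : ∀ f h : ℂ → ℂ, ∀ r : ℝ, 0 < r → MemHalpha α U f → HarmonicOnC h (U ∪ ball b r) →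
      (∀ z ∈ closure U, h z = f z) → ‖dzDeriv h b‖ ≤ κ * HNorm α U f)
    {h : ℝ → ℝ} (hh : IsGauge α h) (N : ℕ) :
    ∑ n ∈ Finset.range N, (2 : ℝ≥0∞) ^ (n + 1) * MhContent h (Ann b (n + 1) \ U) ≤
      ENNReal.ofReal
        (2 * κ * (growthConst α * (3 * ∑' j, shellWeight α j + R + 1 / 2))) := by
  let E : ℕ → Set ℂ := fun n => Ann b (n + 1) \ U
  have hEA : ∀ n, E n ⊆ Ann b (n + 1) := fun n => sdiff_subset
  have hEc : ∀ n, IsClosed (E n) := fun n => (isClosed_Ann b _).sdiff hU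
  have hEb : ∀ n, E n ⊆ closedBall b (1 / 2) := fun n => (hEA n).trans
    ((Ann_subset_closedBall b _).trans (closedBall_subset_closedBall
      (by simpa using pow_le_of_le_one (by norm_num : (0 : ℝ) ≤ 1 / 2) (by norm_num) n.succ_ne_zero)))
  choose μ h1 h2 h3 using fun n => exists_frostman_measure hα hh (hEc n) (hEb n)
  let ν : Measure ℂ := ∑ n ∈ Finset.range N, μ n
  have hνapp : ∀ s, ν s = ∑ n ∈ Finset.range N, μ n s := fun s => by
    simp [ν, Measure.finsetSum_apply]
  have hfin : IsFiniteMeasure ν := ⟨by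
    rw [hνapp]
    refine ENNReal.sum_lt_top.2 fun n _ => ?_
    rw [h1]
    exact (MhContent_le_of_subset_closedBall hα hh (by norm_num) (hEb n)).trans_lt
      ENNReal.ofReal_lt_top⟩
  let A : Set ℂ := ⋃ n ∈ Finset.range N, E n
  have hA : IsClosed A := (Finset.range N).finite_toSet.isClosed_biUnion fun n _ => hEc n
  have hEA' : ∀ n ∈ Finset.range N, E n ⊆ A := fun n hn => subset_biUnion_of_mem (u := E) hn
  have hνA : ν Aᶜ = 0 := by
    rw [hνapp]
    exact Finset.sum_eq_zero fun n hn =>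
      measure_mono_null (compl_subset_compl.2 (hEA' n hn)) (h2 n)
  have hνb : ν (closedBall b (1 / 2))ᶜ = 0 :=
    measure_mono_null (compl_subset_compl.2 (iUnion₂_subset fun n _ => hEb n)) hνA
  let K := growthConst α
  let G : ℝ → ℝ := fun r => min (K * r ^ α) (N * (36 * h (8 * r)))
  have hG : ∀ r, 0 < r → 0 ≤ G r ∧ G r ≤ K * r ^ α := fun r hr => by
    have := (hh.2.1 (8 * r) (by linarith)).1
    have := growthConst_pos hα
    exact ⟨le_min (by positivity) (by positivity), min_le_left _ _⟩
  have hνG : ∀ z r, 0 < r → ν (closedBall z r) ≤ ENNReal.ofReal (G r) := fun z r hr => by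
    have h0 := (hh.2.1 (8 * r) (by linarith)).1
    rw [hνapp, ENNReal.ofReal_min]
    refine le_min (sum_frostman_growth hα hh hEA h1 h2 h3 N z hr) ?_
    refine (Finset.sum_le_card_nsmul _ _ _ fun n _ => h3 n z r hr).trans (le_of_eq ?_)
    rw [ENNReal.ofReal_mul (by positivity), ENNReal.ofReal_mul (by norm_num), nsmul_eq_mul]
    simp
  have hG0 : Tendsto (fun r => G r / r ^ α) (nhdsWithin 0 (Ioi 0)) (nhds 0) := by
    have h8 : Tendsto (fun r : ℝ => 8 * r) (nhdsWithin 0 (Ioi 0)) (nhdsWithin 0 (Ioi 0)) := by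
      refine tendsto_nhdsWithin_iff.2 ⟨?_, ?_⟩
      · have : Tendsto (fun r : ℝ => 8 * r) (nhds 0) (nhds (8 * 0)) := tendsto_id.const_mul _
        rw [mul_zero] at this
        exact this.mono_left nhdsWithin_le_nhds
      · filter_upwards [self_mem_nhdsWithin] with r hr
        exact mem_Ioi.2 (mul_pos (by norm_num) hr)
    have hlim := (hh.2.2.comp h8).const_mul ((N : ℝ) * 36 * (8 : ℝ) ^ α)
    rw [mul_zero] at hlim
    refine tendsto_of_tendsto_of_tendsto_of_le_of_le' tendsto_const_nhds hlim ?_ ?_ <;>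
      filter_upwards [self_mem_nhdsWithin] with r hr
    · exact div_nonneg (hG r hr).1 (Real.rpow_nonneg (le_of_lt hr) _)
    · have hr : 0 < r := hr
      rw [div_le_iff₀ (by positivity)]
      refine (min_le_right _ _).trans (le_of_eq ?_)
      simp only [Function.comp]
      rw [Real.mul_rpow (by norm_num) hr.le]
      field_simp
  have hφ := measurable_phaseAt b
  have hφ1 := norm_phaseAt_le b
  have hint := integrable_logPotential hα hα1 hG hνG hνb hφ hφ1
  have hbA : b ∉ A := by
    simp only [A, mem_iUnion, not_exists]
    intro n _ hbn
    have := (mem_Ann_iff.1 (hEA n hbn)).1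
    rw [sub_self, norm_zero] at this
    exact absurd this (not_le.2 (by positivity))
  have hUA : Disjoint U A := by
    refine disjoint_left.2 fun z hz hzA => ?_
    simp only [A, mem_iUnion] at hzA
    obtain ⟨n, _, hn⟩ := hzA
    exact hn.2 hz
  obtain ⟨r, hr, hrA⟩ := Metric.isOpen_iff.1 hA.isOpen_compl b hbA
  have hrA' : Disjoint (U ∪ ball b r) A :=
    hUA.union_left (disjoint_left.2 fun z hz hzA => hrA hz hzA)
  have key := hder (logPotential ν (phaseAt b)) (logPotential ν (phaseAt b)) r hr
    ⟨harmonicOnC_logPotential hA hνA hφ hφ1 hint hU hUA,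
      littleHolderOn_logPotential hα hα1 hG hG0 hνG hνb hφ hφ1 _⟩
    (harmonicOnC_logPotential hA hνA hφ hφ1 hint (hU.union isOpen_ball) hrA') (fun _ _ => rfl)
  have hnorm := HNorm_logPotential_le hα hα1 (growthConst_pos hα).le hR hG hνG hνb hφ hφ1 hUR
  rw [dzDeriv_logPotential hA hνA hφ hφ1 hbA (hint b), cauchyTransform_phaseAt, norm_div,
    Complex.norm_real, Complex.norm_ofNat] at key
  have hle := (Real.le_norm_self (∫ w, ‖b - w‖⁻¹ ∂ν))
  have hbound : ∫ w, ‖b - w‖⁻¹ ∂ν ≤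
      2 * κ * (growthConst α * (3 * ∑' j, shellWeight α j + R + 1 / 2)) := by
    have := mul_le_mul_of_nonneg_left hnorm hκ.le
    linarith
  have hinv : Integrable (fun w => ‖b - w‖⁻¹) ν := by
    have := (integrable_cauchyKernel hA hνA (φ := fun _ => 1) measurable_const (by simp) hbA).norm
    simpa using this
  refine (sum_content_le_lintegral hEA h1 h2 N).trans ?_
  rw [← ofReal_integral_eq_lintegral_ofReal hinv (Eventually.of_forall fun w => by positivity)]
  exact ENNReal.ofReal_le_ofReal hbound

/-- Necessity: a bounded point derivation forces convergence of the series of contents. -/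
theorem tsum_lowerContent_lt_top_of_derivation {α : ℝ} (hα : 0 < α) (hα1 : α < 1) {U : Set ℂ}
    (hU : IsOpen U) (hUb : Bornology.IsBounded U) {b : ℂ} {κ : ℝ} (hκ : 0 < κ)
    (hder : ∀ f h : ℂ → ℂ, ∀ r : ℝ, 0 < r → MemHalpha α U f → HarmonicOnC h (U ∪ ball b r) →
      (∀ z ∈ closure U, h z = f z) → ‖dzDeriv h b‖ ≤ κ * HNorm α U f) :
    ∑' n : ℕ, (2 : ℝ≥0∞) ^ (n + 1) * lowerContent α (Ann b (n + 1) \ U) < ⊤ := by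
  obtain ⟨R, hR⟩ := hUb.closure.subset_closedBall b
  have hR' : closure U ⊆ closedBall b |R| := hR.trans (closedBall_subset_closedBall (le_abs_self R))
  refine lt_of_le_of_lt (ENNReal.tsum_le_of_sum_range_le fun N => ?_) (ENNReal.ofReal_lt_top (r :=
    2 * κ * (growthConst α * (3 * ∑' j, shellWeight α j + |R| + 1 / 2))))
  simp only [lowerContent_eq_iSup, ENNReal.mul_iSup]
  rw [ENNReal.finsetSum_iSup]
  · exact iSup_le fun h => sum_content_le_of_derivation hα hα1 hU (abs_nonneg R) hR' hκ hder h.2 N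
  · intro h k
    refine ⟨⟨_, h.2.sup k.2⟩, fun n => ⟨?_, ?_⟩⟩ <;> gcongr <;>
      refine MhContent_mono_gauge (fun r _ => ?_) _
    · exact le_max_left _ _
    · exact le_max_right _ _

end

/-- McShane extension for a subadditive modulus of continuity. -/
lemma exists_extension_real {X : Set ℂ} (hX : X.Nonempty) {ω : ℝ → ℝ} (hmono : MonotoneOn ω (Ici 0))
    (hsub : ∀ r s, 0 ≤ r → 0 ≤ s → ω (r + s) ≤ ω r + ω s) (h0 : ω 0 = 0) {g : ℂ → ℝ}
    (hg : ∀ x ∈ X, ∀ y ∈ X, g x - g y ≤ ω ‖x - y‖) :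
    ∃ G : ℂ → ℝ, (∀ x ∈ X, G x = g x) ∧ ∀ z z', |G z - G z'| ≤ ω ‖z - z'‖ := by
  obtain ⟨y₀, hy₀⟩ := hX
  have : Nonempty X := ⟨⟨y₀, hy₀⟩⟩
  have htri : ∀ x y z : ℂ, ω ‖x - z‖ ≤ ω ‖x - y‖ + ω ‖y - z‖ := fun x y z =>
    (hmono (mem_Ici.2 (norm_nonneg _)) (mem_Ici.2 (by positivity))
      (norm_sub_le_norm_sub_add_norm_sub x y z)).trans (hsub _ _ (norm_nonneg _) (norm_nonneg _))
  have hlow : ∀ (z : ℂ), ∀ x ∈ X, ∀ y : X, g x - ω ‖x - z‖ ≤ g (y : ℂ) + ω ‖z - (y : ℂ)‖ :=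
    fun z x hx y => by linarith [hg x hx (y : ℂ) y.2, htri x z (y : ℂ)]
  have hbdd : ∀ z, BddBelow (range fun y : X => g (y : ℂ) + ω ‖z - (y : ℂ)‖) := fun z =>
    ⟨g y₀ - ω ‖y₀ - z‖, by rintro _ ⟨y, rfl⟩; exact hlow z y₀ hy₀ y⟩
  refine ⟨fun z => ⨅ y : X, g (y : ℂ) + ω ‖z - (y : ℂ)‖, fun x hx => le_antisymm ?_ ?_, fun z z' => ?_⟩
  · refine (ciInf_le (hbdd x) ⟨x, hx⟩).trans ?_
    simp [h0]
  · refine le_ciInf fun y => ?_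
    have := hlow x x hx y
    rwa [sub_self, norm_zero, h0, sub_zero] at this
  · have key : ∀ z z' : ℂ, (⨅ y : X, g (y : ℂ) + ω ‖z - (y : ℂ)‖) ≤ (⨅ y : X, g (y : ℂ) + ω ‖z' - (y : ℂ)‖) + ω ‖z - z'‖ := by
      intro z z'
      rw [← sub_le_iff_le_add]
      refine le_ciInf fun y => ?_
      have := ciInf_le (hbdd z) y
      linarith [htri z z' (y : ℂ)]
    have h1 := key z z'
    have h2 := key z' z
    rw [norm_sub_rev] at h2
    exact abs_le.2 ⟨by linarith, by linarith⟩

/-- A subadditive modulus of continuity of `f` on `X`. -/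
def modulusOn (X : Set ℂ) (f : ℂ → ℂ) (r : ℝ) : ℝ :=
  sSup {q | ∃ x ∈ X, ∃ y ∈ X, q = ‖f x - f y‖ * min 1 (r / ‖x - y‖)}

section Modulus

variable {X : Set ℂ} {f : ℂ → ℂ} {α A : ℝ}

lemma modulusOn_term_le (hα : 0 < α) (hα1 : α < 1) {x y : ℂ} {c : ℝ} (hc : 0 ≤ c)
    (hf : ‖f x - f y‖ ≤ c * ‖x - y‖ ^ α) {r : ℝ} (hr : 0 ≤ r) :
    ‖f x - f y‖ * min 1 (r / ‖x - y‖) ≤ c * r ^ α := by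
  rcases eq_or_ne x y with rfl | hxy
  · simp only [sub_self, norm_zero, zero_mul]; positivity
  have hd : 0 < ‖x - y‖ := norm_pos_iff.2 (sub_ne_zero.2 hxy)
  have h0 : 0 ≤ min 1 (r / ‖x - y‖) := le_min zero_le_one (by positivity)
  refine (mul_le_mul_of_nonneg_right hf h0).trans ?_
  rw [mul_assoc]
  refine mul_le_mul_of_nonneg_left ?_ hc
  rcases le_total ‖x - y‖ r with h | h
  · calc ‖x - y‖ ^ α * min 1 (r / ‖x - y‖) ≤ ‖x - y‖ ^ α * 1 := by gcongr; exact min_le_left _ _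
      _ ≤ r ^ α := by rw [mul_one]; gcongr
  · rcases hr.eq_or_lt with rfl | hr
    · simp [Real.zero_rpow hα.ne']
    calc ‖x - y‖ ^ α * min 1 (r / ‖x - y‖) ≤ ‖x - y‖ ^ α * (r / ‖x - y‖) := by
          gcongr; exact min_le_right _ _
      _ ≤ ‖x - y‖ ^ α * (r / ‖x - y‖) ^ α := by
          gcongr
          calc r / ‖x - y‖ = (r / ‖x - y‖) ^ (1 : ℝ) := (Real.rpow_one _).symm
            _ ≤ _ := Real.rpow_le_rpow_of_exponent_ge (by positivity)
              ((div_le_one hd).2 h) hα1.le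
      _ = r ^ α := by rw [← Real.mul_rpow hd.le (by positivity), mul_div_cancel₀ _ hd.ne']

lemma modulusOn_le_of (hX : X.Nonempty) {r c : ℝ}
    (h : ∀ x ∈ X, ∀ y ∈ X, ‖f x - f y‖ * min 1 (r / ‖x - y‖) ≤ c) : modulusOn X f r ≤ c := by
  obtain ⟨b, hb⟩ := hX
  refine csSup_le ⟨_, b, hb, b, hb, rfl⟩ ?_
  rintro _ ⟨x, hx, y, hy, rfl⟩
  exact h x hx y hy

variable (hα : 0 < α) (hα1 : α < 1) (hA : 0 ≤ A) (hX : X.Nonempty)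
  (hf : ∀ x ∈ X, ∀ y ∈ X, ‖f x - f y‖ ≤ A * ‖x - y‖ ^ α)

include hα hα1 hA hf

lemma bddAbove_modulusOn {r : ℝ} (hr : 0 ≤ r) :
    BddAbove {q | ∃ x ∈ X, ∃ y ∈ X, q = ‖f x - f y‖ * min 1 (r / ‖x - y‖)} :=
  ⟨A * r ^ α, by
    rintro _ ⟨x, hx, y, hy, rfl⟩
    exact modulusOn_term_le hα hα1 hA (hf x hx y hy) hr⟩

lemma le_modulusOn {r : ℝ} (hr : 0 ≤ r) {x y : ℂ} (hx : x ∈ X) (hy : y ∈ X) :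
    ‖f x - f y‖ * min 1 (r / ‖x - y‖) ≤ modulusOn X f r :=
  le_csSup (bddAbove_modulusOn hα hα1 hA hf hr) ⟨x, hx, y, hy, rfl⟩

lemma norm_sub_le_modulusOn {x y : ℂ} (hx : x ∈ X) (hy : y ∈ X) :
    ‖f x - f y‖ ≤ modulusOn X f ‖x - y‖ := by
  have := le_modulusOn hα hα1 hA hf (norm_nonneg (x - y)) hx hy
  rcases eq_or_ne x y with rfl | hxy
  · simpa using this
  · rwa [div_self (norm_ne_zero_iff.2 (sub_ne_zero.2 hxy)), min_self, mul_one] at this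

include hX

lemma modulusOn_nonneg {r : ℝ} (hr : 0 ≤ r) : 0 ≤ modulusOn X f r := by
  obtain ⟨b, hb⟩ := hX
  have := le_modulusOn hα hα1 hA hf hr hb hb
  simpa using this

lemma modulusOn_mono : MonotoneOn (modulusOn X f) (Ici 0) := fun r hr s hs hrs =>
  modulusOn_le_of hX fun x hx y hy =>
    le_trans (by gcongr) (le_modulusOn hα hα1 hA hf hs hx hy)

lemma modulusOn_add_le (r s : ℝ) (hr : 0 ≤ r) (hs : 0 ≤ s) :
    modulusOn X f (r + s) ≤ modulusOn X f r + modulusOn X f s :=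
  modulusOn_le_of hX fun x hx y hy => by
    refine le_trans ?_ (add_le_add (le_modulusOn hα hα1 hA hf hr hx hy)
      (le_modulusOn hα hα1 hA hf hs hx hy))
    rw [← mul_add, add_div]
    have h1 : 0 ≤ r / ‖x - y‖ := by positivity
    have h2 : 0 ≤ s / ‖x - y‖ := by positivity
    gcongr
    rcases min_cases 1 (r / ‖x - y‖) with h | h <;> rcases min_cases 1 (s / ‖x - y‖) with h' | h' <;>
      rcases min_cases 1 (r / ‖x - y‖ + s / ‖x - y‖) with h'' | h'' <;> linarith

lemma modulusOn_le {r : ℝ} (hr : 0 ≤ r) : modulusOn X f r ≤ A * r ^ α :=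
  modulusOn_le_of hX fun x hx y hy => modulusOn_term_le hα hα1 hA (hf x hx y hy) hr

lemma modulusOn_zero : modulusOn X f 0 = 0 :=
  le_antisymm ((modulusOn_le hα hα1 hA hX hf le_rfl).trans (by simp [Real.zero_rpow hα.ne']))
    (modulusOn_nonneg hα hα1 hA hX hf le_rfl)

lemma tendsto_modulusOn_div (hlittle : ∀ ε > 0, ∃ δ > 0, ∀ x ∈ X, ∀ y ∈ X, ‖x - y‖ ≤ δ →
      ‖f x - f y‖ ≤ ε * ‖x - y‖ ^ α) :
    Tendsto (fun r => modulusOn X f r / r ^ α) (nhdsWithin 0 (Ioi 0)) (nhds 0) := by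
  refine tendsto_order.2 ⟨fun c hc => ?_, fun c hc => ?_⟩
  · filter_upwards [self_mem_nhdsWithin] with r hr
    exact hc.trans_le (div_nonneg (modulusOn_nonneg hα hα1 hA hX hf (le_of_lt hr))
      (Real.rpow_nonneg (le_of_lt hr) _))
  · obtain ⟨δ, hδ, hδ'⟩ := hlittle (c / 2) (half_pos hc)
    have h1 : Tendsto (fun r : ℝ => A * δ ^ (α - 1) * r ^ (1 - α)) (nhdsWithin 0 (Ioi 0)) (nhds 0) := by
      have := ((Real.continuousAt_rpow_const 0 (1 - α)
        (Or.inr (by linarith))).tendsto).const_mul (A * δ ^ (α - 1))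
      rw [Real.zero_rpow (by linarith), mul_zero] at this
      exact this.mono_left nhdsWithin_le_nhds
    filter_upwards [self_mem_nhdsWithin, h1.eventually (gt_mem_nhds (half_pos hc))] with r hr hr2
    have hr : 0 < r := hr
    suffices modulusOn X f r ≤ c / 2 * r ^ α by
      rw [div_lt_iff₀ (by positivity)]
      have : 0 < c / 2 * r ^ α := by positivity
      linarith
    refine modulusOn_le_of hX fun x hx y hy => ?_
    rcases le_or_gt ‖x - y‖ δ with hd | hd
    · exact modulusOn_term_le hα hα1 (by linarith) (hδ' x hx y hy hd) hr.le
    · have hd0 : 0 < ‖x - y‖ := hδ.trans hd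
      calc ‖f x - f y‖ * min 1 (r / ‖x - y‖) ≤ A * ‖x - y‖ ^ α * (r / ‖x - y‖) := by
            gcongr
            · exact hf x hx y hy
            · exact min_le_right _ _
        _ = A * ‖x - y‖ ^ (α - 1) * r := by
            rw [Real.rpow_sub_one hd0.ne']; ring
        _ ≤ A * δ ^ (α - 1) * r := by
            gcongr ?_ * ?_ * ?_
            exact Real.rpow_le_rpow_of_nonpos hδ hd.le (by linarith)
        _ = A * δ ^ (α - 1) * r ^ (1 - α) * r ^ α := by
            rw [mul_assoc _ (r ^ (1 - α)), ← Real.rpow_add hr]; simp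
        _ ≤ c / 2 * r ^ α := by gcongr

/-- Extension of a little Hölder function to the whole plane, with a doubling modulus that is a
multiple of an admissible gauge. -/
lemma exists_extension_modulus (hlittle : ∀ ε > 0, ∃ δ > 0, ∀ x ∈ X, ∀ y ∈ X, ‖x - y‖ ≤ δ →
      ‖f x - f y‖ ≤ ε * ‖x - y‖ ^ α) (hA0 : 0 < A) :
    ∃ (F : ℂ → ℂ) (h : ℝ → ℝ), (∀ x ∈ X, F x = f x) ∧ IsGauge α h ∧ (∀ r, 0 ≤ r → 0 ≤ h r) ∧
      (∀ r, 0 ≤ r → h (2 * r) ≤ 2 * h r) ∧ h 0 = 0 ∧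
      ∀ z z', ‖F z - F z'‖ ≤ 2 * A * h ‖z - z'‖ := by
  have hmono := modulusOn_mono hα hα1 hA hX hf
  have hsub := modulusOn_add_le hα hα1 hA hX hf
  have h0 := modulusOn_zero hα hα1 hA hX hf
  obtain ⟨G₁, hG₁, hG₁'⟩ := exists_extension_real hX hmono hsub h0 (g := fun x => (f x).re)
    fun x hx y hy => (le_abs_self _).trans ((Complex.abs_re_le_norm (f x - f y)).trans
      (norm_sub_le_modulusOn hα hα1 hA hf hx hy))
  obtain ⟨G₂, hG₂, hG₂'⟩ := exists_extension_real hX hmono hsub h0 (g := fun x => (f x).im)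
    fun x hx y hy => (le_abs_self _).trans ((Complex.abs_im_le_norm (f x - f y)).trans
      (norm_sub_le_modulusOn hα hα1 hA hf hx hy))
  refine ⟨fun z => ⟨G₁ z, G₂ z⟩, fun r => modulusOn X f r / A, fun x hx => ?_, ⟨?_, ?_, ?_⟩, ?_, ?_,
    by simp only [h0, zero_div], fun z z' => ?_⟩
  · exact Complex.ext (hG₁ x hx) (hG₂ x hx)
  · exact fun r hr s hs hrs => div_le_div_of_nonneg_right (hmono hr hs hrs) hA
  · refine fun r hr => ⟨div_nonneg (modulusOn_nonneg hα hα1 hA hX hf hr.le) hA, ?_⟩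
    rw [div_le_iff₀ hA0, mul_comm]
    exact modulusOn_le hα hα1 hA hX hf hr.le
  · have := (tendsto_modulusOn_div hα hα1 hA hX hf hlittle).div_const A
    rw [zero_div] at this
    exact this.congr fun r => div_right_comm _ _ _
  · exact fun r hr => div_nonneg (modulusOn_nonneg hα hα1 hA hX hf hr) hA
  · intro r hr
    rw [← mul_div_assoc, two_mul, two_mul]
    exact div_le_div_of_nonneg_right (hsub r r hr hr) hA
  · refine (Complex.norm_le_abs_re_add_abs_im _).trans ((add_le_add (hG₁' z z') (hG₂' z z')).trans
      (le_of_eq ?_))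
    field_simp
    ring

end Modulus

section

open MeasureTheory

/-- The directional derivative of `φ` in the direction `v`. -/
def dirDeriv (v : ℂ) (φ : ℂ → ℂ) (z : ℂ) : ℂ := fderiv ℝ φ z v

/-- The Laplacian in the plane. -/
def planeLap (φ : ℂ → ℂ) (z : ℂ) : ℂ :=
  dirDeriv 1 (dirDeriv 1 φ) z + dirDeriv Complex.I (dirDeriv Complex.I φ) z

/-- The Laplacian of `u / (w - b)` away from `b`, expanded by the product rule. -/
def kelvinLap (b : ℂ) (u : ℂ → ℂ) (w : ℂ) : ℂ :=
  (w - b)⁻¹ * planeLap u w -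
    2 * (w - b)⁻¹ ^ 2 * (dirDeriv 1 u w + Complex.I * dirDeriv Complex.I u w)

lemma ContDiffAt.dirDeriv {φ : ℂ → ℂ} {z : ℂ} {n m : WithTop ℕ∞} (h : ContDiffAt ℝ n φ z)
    (hm : m + 1 ≤ n) (v : ℂ) : ContDiffAt ℝ m (dirDeriv v φ) z :=
  (h.fderiv_right hm).clm_apply contDiffAt_const

lemma ContDiff.dirDeriv {φ : ℂ → ℂ} {n m : WithTop ℕ∞} (h : ContDiff ℝ n φ)
    (hm : m + 1 ≤ n) (v : ℂ) : ContDiff ℝ m (dirDeriv v φ) :=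
  (h.fderiv_right hm).clm_apply contDiff_const

lemma tsupport_dirDeriv_subset (v : ℂ) (φ : ℂ → ℂ) : tsupport (dirDeriv v φ) ⊆ tsupport φ :=
  tsupport_fderiv_apply_subset ℝ v

lemma dirDeriv_congr {φ χ : ℂ → ℂ} {z : ℂ} (h : φ =ᶠ[nhds z] χ) (v : ℂ) :
    dirDeriv v φ =ᶠ[nhds z] dirDeriv v χ := by
  filter_upwards [h.fderiv (𝕜 := ℝ)] with w hw
  simp only [dirDeriv, hw]

lemma planeLap_congr {φ χ : ℂ → ℂ} {z : ℂ} (h : φ =ᶠ[nhds z] χ) : planeLap φ z = planeLap χ z := by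
  rw [planeLap, planeLap, (dirDeriv_congr (dirDeriv_congr h 1) 1).eq_of_nhds,
    (dirDeriv_congr (dirDeriv_congr h Complex.I) Complex.I).eq_of_nhds]

lemma kelvinLap_congr {φ χ : ℂ → ℂ} {z : ℂ} (h : φ =ᶠ[nhds z] χ) (b : ℂ) :
    kelvinLap b φ z = kelvinLap b χ z := by
  rw [kelvinLap, kelvinLap, planeLap_congr h, (dirDeriv_congr h 1).eq_of_nhds,
    (dirDeriv_congr h Complex.I).eq_of_nhds]

lemma dirDeriv_const (v c : ℂ) : dirDeriv v (fun _ => c) = fun _ => 0 := by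
  ext z; simp [dirDeriv]

lemma kelvinLap_const (b c w : ℂ) : kelvinLap b (fun _ => c) w = 0 := by
  simp [kelvinLap, planeLap, dirDeriv_const]

lemma dirDeriv_sum {ι : Type*} (s : Finset ι) (a : ι → ℂ) (u : ι → ℂ → ℂ) (v : ℂ)
    (hu : ∀ i ∈ s, ContDiff ℝ 1 (u i)) :
    dirDeriv v (fun w => ∑ i ∈ s, a i * u i w) = fun w => ∑ i ∈ s, a i * dirDeriv v (u i) w := by
  ext z
  have hd : ∀ i ∈ s, DifferentiableAt ℝ (u i) z := fun i hi =>
    (hu i hi).differentiable one_ne_zero z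
  simp only [dirDeriv]
  rw [fderiv_fun_sum fun i hi => (hd i hi).const_mul (a i), FunLike.coe_sum, Finset.sum_apply]
  refine Finset.sum_congr rfl fun i hi => ?_
  rw [fderiv_const_mul (hd i hi), smul_apply, smul_eq_mul]

lemma kelvinLap_sum {ι : Type*} (s : Finset ι) (a : ι → ℂ) (u : ι → ℂ → ℂ) (b w : ℂ)
    (hu : ∀ i ∈ s, ContDiff ℝ 2 (u i)) :
    kelvinLap b (fun w => ∑ i ∈ s, a i * u i w) w = ∑ i ∈ s, a i * kelvinLap b (u i) w := by
  have h1 : ∀ i ∈ s, ContDiff ℝ 1 (u i) := fun i hi => (hu i hi).of_le one_le_two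
  have h2 : ∀ v, ∀ i ∈ s, ContDiff ℝ 1 (dirDeriv v (u i)) := fun v i hi =>
    (hu i hi).dirDeriv (by norm_num) v
  rw [kelvinLap, planeLap, dirDeriv_sum s a u 1 h1, dirDeriv_sum s a u Complex.I h1,
    dirDeriv_sum s a _ 1 (h2 1), dirDeriv_sum s a _ Complex.I (h2 Complex.I)]
  simp only [kelvinLap, planeLap, Finset.mul_sum, ← Finset.sum_add_distrib,
    ← Finset.sum_sub_distrib]
  exact Finset.sum_congr rfl fun i _ => by ring

lemma dirDeriv_mul {φ χ : ℂ → ℂ} {z : ℂ} (hφ : DifferentiableAt ℝ φ z)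
    (hχ : DifferentiableAt ℝ χ z) (v : ℂ) :
    dirDeriv v (fun w => φ w * χ w) z = dirDeriv v φ z * χ z + φ z * dirDeriv v χ z := by
  simp only [dirDeriv]
  rw [fderiv_fun_mul hφ hχ]
  simp
  ring

lemma dirDeriv_inv_sub {b z : ℂ} (hz : z ≠ b) (v : ℂ) :
    dirDeriv v (fun w => (w - b)⁻¹) z = -(z - b)⁻¹ ^ 2 * v := by
  have h : HasDerivAt (fun w => (w - b)⁻¹) (-(1 : ℂ) / (z - b) ^ 2) z :=
    ((hasDerivAt_id z).sub_const b).fun_inv (sub_ne_zero.2 hz)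
  rw [dirDeriv, (h.hasFDerivAt.restrictScalars ℝ).fderiv]
  simp
  ring

lemma contDiffAt_inv_sub {b z : ℂ} (hz : z ≠ b) {n : WithTop ℕ∞} :
    ContDiffAt ℝ n (fun w : ℂ => (w - b)⁻¹) z :=
  (contDiffAt_id.sub contDiffAt_const).inv (sub_ne_zero.2 hz)

lemma dirDeriv_dirDeriv_mul_inv_sub {b z : ℂ} {u : ℂ → ℂ} (hu : ContDiffAt ℝ 2 u z) (hz : z ≠ b)
    (v : ℂ) :
    dirDeriv v (dirDeriv v fun w => u w * (w - b)⁻¹) z =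
      dirDeriv v (dirDeriv v u) z * (z - b)⁻¹ - 2 * (z - b)⁻¹ ^ 2 * (v * dirDeriv v u z) +
        2 * u z * (z - b)⁻¹ ^ 3 * v ^ 2 := by
  have hg := contDiffAt_inv_sub hz (n := 2)
  have h1 : (dirDeriv v fun w => u w * (w - b)⁻¹) =ᶠ[nhds z] fun w =>
      dirDeriv v u w * (w - b)⁻¹ + u w * (-v * ((w - b)⁻¹ * (w - b)⁻¹)) := by
    filter_upwards [hu.eventually (by simp), isOpen_ne.mem_nhds hz] with w hw hwb
    rw [dirDeriv_mul (hw.differentiableAt two_ne_zero)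
      ((contDiffAt_inv_sub hwb (n := 2)).differentiableAt two_ne_zero), dirDeriv_inv_sub hwb]
    ring
  have hu1 := (hu.dirDeriv (m := 1) (by norm_num) v).differentiableAt one_ne_zero
  have hu0 := hu.differentiableAt two_ne_zero
  have hg0 := hg.differentiableAt two_ne_zero
  have hgg := (hg0.fun_mul hg0).const_mul (-v)
  rw [(dirDeriv_congr h1 v).eq_of_nhds]
  have e1 : dirDeriv v (fun w => dirDeriv v u w * (w - b)⁻¹ +
      u w * (-v * ((w - b)⁻¹ * (w - b)⁻¹))) z = dirDeriv v (fun w => dirDeriv v u w * (w - b)⁻¹) z +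
      dirDeriv v (fun w => u w * (-v * ((w - b)⁻¹ * (w - b)⁻¹))) z := by
    have := fderiv_fun_add (hu1.mul hg0) (hu0.mul hgg)
    exact DFunLike.congr_fun this v
  have e2 : dirDeriv v (fun w => -v * ((w - b)⁻¹ * (w - b)⁻¹)) z = -v *
      dirDeriv v (fun w => (w - b)⁻¹ * (w - b)⁻¹) z := by
    have := fderiv_const_mul (hg0.mul hg0) (-v)
    exact DFunLike.congr_fun this v
  rw [e1, dirDeriv_mul hu1 hg0, dirDeriv_mul hu0 hgg, e2, dirDeriv_mul hg0 hg0,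
    dirDeriv_inv_sub hz]
  ring

lemma planeLap_mul_inv_sub {b z : ℂ} {u : ℂ → ℂ} (hu : ContDiffAt ℝ 2 u z) (hz : z ≠ b) :
    planeLap (fun w => u w * (w - b)⁻¹) z = kelvinLap b u z := by
  rw [planeLap, dirDeriv_dirDeriv_mul_inv_sub hu hz, dirDeriv_dirDeriv_mul_inv_sub hu hz, kelvinLap,
    planeLap]
  simp only [Complex.I_sq]
  ring

lemma continuous_mul_of_tsupport_subset {V : Set ℂ} (hV : IsOpen V) {p q : ℂ → ℂ}
    (hp : ContinuousOn p V) (hq : Continuous q) (hqV : tsupport q ⊆ V) :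
    Continuous fun z => p z * q z := by
  refine continuous_iff_continuousAt.2 fun z => ?_
  by_cases hz : z ∈ tsupport q
  · exact (hp.continuousAt (hV.mem_nhds (hqV hz))).mul hq.continuousAt
  · refine continuousAt_const.congr (f := fun _ => 0) ?_
    filter_upwards [(notMem_tsupport_iff_eventuallyEq.1 hz)] with w hw
    simp [hw]

lemma integrable_mul_of_tsupport_subset {V : Set ℂ} (hV : IsOpen V) {p q : ℂ → ℂ}
    (hp : ContinuousOn p V) (hq : Continuous q) (hqV : tsupport q ⊆ V) (hc : HasCompactSupport q) :
    Integrable fun z => p z * q z :=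
  (continuous_mul_of_tsupport_subset hV hp hq hqV).integrable_of_hasCompactSupport hc.mul_left

lemma ContDiffOn.dirDeriv {V : Set ℂ} (hV : IsOpen V) {φ : ℂ → ℂ} {n m : WithTop ℕ∞}
    (h : ContDiffOn ℝ n φ V) (hm : m + 1 ≤ n) (v : ℂ) : ContDiffOn ℝ m (dirDeriv v φ) V :=
  fun _ hz => ((h.contDiffAt (hV.mem_nhds hz)).dirDeriv hm v).contDiffWithinAt

/-- Integration by parts on an open set containing the support of one factor. -/
lemma integral_mul_dirDeriv {V : Set ℂ} (hV : IsOpen V) {p q : ℂ → ℂ} (hp : ContDiffOn ℝ 1 p V)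
    (hq : ContDiff ℝ 1 q) (hqV : tsupport q ⊆ V) (hc : HasCompactSupport q) (v : ℂ) :
    ∫ z, p z * dirDeriv v q z = -∫ z, dirDeriv v p z * q z :=
  integral_mul_fderiv_eq_neg_fderiv_mul_of_integrable (v := v)
    (integrable_mul_of_tsupport_subset hV (ContDiffOn.dirDeriv hV hp (m := 0) (by norm_num) v).continuousOn
      hq.continuous hqV hc)
    (integrable_mul_of_tsupport_subset hV hp.continuousOn
      (hq.dirDeriv (m := 0) (by norm_num) v).continuous ((tsupport_dirDeriv_subset v q).trans hqV)
      (hc.fderiv_apply ℝ v))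
    (integrable_mul_of_tsupport_subset hV hp.continuousOn hq.continuous hqV hc)
    (fun x hx => (hp.contDiffAt (hV.mem_nhds (hqV hx))).differentiableAt one_ne_zero)
    (fun x _ => hq.differentiable one_ne_zero x)

lemma integral_mul_dirDeriv_dirDeriv {V : Set ℂ} (hV : IsOpen V) {p q : ℂ → ℂ}
    (hp : ContDiffOn ℝ 2 p V) (hq : ContDiff ℝ 2 q) (hqV : tsupport q ⊆ V)
    (hc : HasCompactSupport q) (v : ℂ) :
    ∫ z, p z * dirDeriv v (dirDeriv v q) z = ∫ z, dirDeriv v (dirDeriv v p) z * q z := by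
  rw [integral_mul_dirDeriv hV (hp.of_le one_le_two) (hq.dirDeriv (m := 1) (by norm_num) v)
    ((tsupport_dirDeriv_subset v q).trans hqV) (hc.fderiv_apply ℝ v) v,
    integral_mul_dirDeriv hV (ContDiffOn.dirDeriv hV hp (m := 1) (by norm_num) v)
      (hq.of_le one_le_two) hqV hc v, neg_neg]

/-- A harmonic function is orthogonal to Laplacians of test functions. -/
lemma integral_mul_planeLap_eq_zero {V : Set ℂ} (hV : IsOpen V) {p q : ℂ → ℂ}
    (hp : HarmonicOnC p V) (hq : ContDiff ℝ 2 q) (hqV : tsupport q ⊆ V)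
    (hc : HasCompactSupport q) : ∫ z, p z * planeLap q z = 0 := by
  have hq1 : ∀ v, ContDiff ℝ 1 (dirDeriv v q) := fun v => hq.dirDeriv (by norm_num) v
  have hp1 : ∀ v, ContDiffOn ℝ 1 (dirDeriv v p) V := fun v =>
    ContDiffOn.dirDeriv hV hp.1 (by norm_num) v
  have i1 : ∀ v, Integrable fun z => p z * dirDeriv v (dirDeriv v q) z := fun v =>
    integrable_mul_of_tsupport_subset hV hp.1.continuousOn
      ((hq1 v).dirDeriv (m := 0) (by norm_num) v).continuous
      ((tsupport_dirDeriv_subset v _).trans ((tsupport_dirDeriv_subset v q).trans hqV))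
      ((hc.fderiv_apply ℝ v).fderiv_apply ℝ v)
  have i2 : ∀ v, Integrable fun z => dirDeriv v (dirDeriv v p) z * q z := fun v =>
    integrable_mul_of_tsupport_subset hV
      (ContDiffOn.dirDeriv hV (hp1 v) (m := 0) (by norm_num) v).continuousOn hq.continuous hqV hc
  simp only [planeLap, mul_add]
  rw [integral_add (i1 1) (i1 Complex.I), integral_mul_dirDeriv_dirDeriv hV hp.1 hq hqV hc,
    integral_mul_dirDeriv_dirDeriv hV hp.1 hq hqV hc, ← integral_add (i2 1) (i2 Complex.I)]
  refine integral_eq_zero_of_ae (Eventually.of_forall fun z => ?_)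
  simp only [Pi.zero_apply, ← add_mul]
  by_cases hz : z ∈ V
  · rw [show dirDeriv 1 (dirDeriv 1 p) z + dirDeriv Complex.I (dirDeriv Complex.I p) z = 0 from
      hp.2 z hz, zero_mul]
  · rw [image_eq_zero_of_notMem_tsupport fun h => hz (hqV h), mul_zero]

lemma harmonicOnC_const (c : ℂ) : HarmonicOnC (fun _ => c) univ :=
  ⟨contDiffOn_const, fun z _ => by simp⟩

/-- Test functions that are constant near `b`. -/
def IsTest (b : ℂ) (u : ℂ → ℂ) : Prop :=
  ContDiff ℝ 2 u ∧ HasCompactSupport u ∧ ∃ c : ℂ, u =ᶠ[nhds b] fun _ => c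

lemma tsupport_kelvinLap_subset (b : ℂ) (u : ℂ → ℂ) : tsupport (kelvinLap b u) ⊆ tsupport u := by
  refine fun z hz => by_contra fun h => notMem_tsupport_iff_eventuallyEq.2 ?_ hz
  have := (notMem_tsupport_iff_eventuallyEq.1 h).eventuallyEq_nhds
  filter_upwards [this] with w hw
  rw [kelvinLap_congr hw, show (0 : ℂ → ℂ) = fun _ => 0 from rfl, kelvinLap_const]

lemma kelvinLap_eventually_zero {b : ℂ} {u : ℂ → ℂ} {c : ℂ} (h : u =ᶠ[nhds b] fun _ => c) :
    kelvinLap b u =ᶠ[nhds b] fun _ => 0 := by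
  filter_upwards [h.eventuallyEq_nhds] with w hw
  rw [kelvinLap_congr hw, kelvinLap_const]

lemma IsTest.continuous_kelvinLap {b : ℂ} {u : ℂ → ℂ} (hu : IsTest b u) :
    Continuous (kelvinLap b u) := by
  obtain ⟨h2, -, c, hc⟩ := hu
  refine continuous_iff_continuousAt.2 fun z => ?_
  rcases eq_or_ne z b with rfl | hz
  · exact continuousAt_const.congr (kelvinLap_eventually_zero hc).symm
  · have hi : ContinuousAt (fun w : ℂ => (w - b)⁻¹) z :=
      (continuousAt_id.sub continuousAt_const).inv₀ (sub_ne_zero.2 hz)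
    have h1 : ∀ v, ContDiff ℝ 1 (dirDeriv v u) := fun v => h2.dirDeriv (by norm_num) v
    have hd : ∀ v, ContinuousAt (dirDeriv v u) z := fun v => (h1 v).continuous.continuousAt
    have hdd : ∀ v, ContinuousAt (dirDeriv v (dirDeriv v u)) z := fun v =>
      ((h1 v).dirDeriv (m := 0) (by norm_num) v).continuous.continuousAt
    exact (hi.mul ((hdd _).add (hdd _))).sub ((continuousAt_const.mul (hi.pow 2)).mul
      ((hd _).add (continuousAt_const.mul (hd _))))

lemma IsTest.hasCompactSupport_kelvinLap {b : ℂ} {u : ℂ → ℂ} (hu : IsTest b u) :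
    HasCompactSupport (kelvinLap b u) :=
  hu.2.1.of_isClosed_subset (isClosed_tsupport _) (tsupport_kelvinLap_subset b u)

lemma IsTest.integrable {b : ℂ} {u : ℂ → ℂ} (hu : IsTest b u) {F : ℂ → ℂ} (hF : Continuous F) :
    Integrable fun z => F z * kelvinLap b u z :=
  integrable_mul_of_tsupport_subset isOpen_univ hF.continuousOn hu.continuous_kelvinLap
    (subset_univ _) hu.hasCompactSupport_kelvinLap

lemma integral_mul_kelvinLap_eq_zero {V : Set ℂ} (hV : IsOpen V) {b : ℂ} {p u : ℂ → ℂ}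
    (hp : HarmonicOnC p V) (hu : ContDiff ℝ 2 u) (huV : tsupport u ⊆ V)
    (hc : HasCompactSupport u) (hb : u =ᶠ[nhds b] fun _ => 0) :
    ∫ z, p z * kelvinLap b u z = 0 := by
  have hb' : (fun w => u w * (w - b)⁻¹) =ᶠ[nhds b] fun _ => 0 := by
    filter_upwards [hb] with w hw
    rw [hw, zero_mul]
  have hsub : tsupport (fun w => u w * (w - b)⁻¹) ⊆ tsupport u := tsupport_mul_subset_left
  rw [← integral_mul_planeLap_eq_zero hV hp (q := fun w => u w * (w - b)⁻¹) ?_ (hsub.trans huV)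
    hc.mul_right]
  · refine integral_congr_ae (Eventually.of_forall fun z => ?_)
    simp only
    rcases eq_or_ne z b with rfl | hz
    · rw [(kelvinLap_eventually_zero hb).eq_of_nhds, planeLap_congr hb']
      simp [planeLap, dirDeriv_const]
    · rw [planeLap_mul_inv_sub hu.contDiffAt hz]
  · refine contDiff_iff_contDiffAt.2 fun z => ?_
    rcases eq_or_ne z b with rfl | hz
    · exact contDiffAt_const.congr_of_eventuallyEq hb'
    · exact hu.contDiffAt.mul (contDiffAt_inv_sub hz)

end

section

open MeasureTheory

/-- Truncated powers. -/
def posPow (n : ℕ) (x : ℝ) : ℝ := max x 0 ^ n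

lemma continuous_posPow (n : ℕ) : Continuous (posPow n) := (continuous_id.max continuous_const).pow n

lemma posPow_of_nonneg {n : ℕ} {x : ℝ} (hx : 0 ≤ x) : posPow n x = x ^ n := by
  rw [posPow, max_eq_left hx]

lemma posPow_of_nonpos {n : ℕ} (hn : n ≠ 0) {x : ℝ} (hx : x ≤ 0) : posPow n x = 0 := by
  rw [posPow, max_eq_right hx, zero_pow hn]

lemma posPow_two_mul (n : ℕ) (x : ℝ) : posPow n (2 * x) = 2 ^ n * posPow n x := by
  rcases le_total 0 x with h | h
  · rw [posPow_of_nonneg h, posPow_of_nonneg (by positivity), mul_pow]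
  · rcases eq_or_ne n 0 with rfl | hn
    · simp [posPow]
    · rw [posPow_of_nonpos hn h, posPow_of_nonpos hn (by linarith), mul_zero]

lemma hasDerivAt_posPow (n : ℕ) (x : ℝ) :
    HasDerivAt (posPow (n + 2)) ((n + 2 : ℕ) * posPow (n + 1) x) x := by
  rcases lt_trichotomy x 0 with h | rfl | h
  · rw [posPow_of_nonpos n.succ_ne_zero h.le, mul_zero]
    refine (hasDerivAt_const x (0 : ℝ)).congr_of_eventuallyEq ?_
    filter_upwards [gt_mem_nhds h] with y hy
    exact posPow_of_nonpos (by omega) hy.le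
  · rw [posPow_of_nonpos n.succ_ne_zero le_rfl, mul_zero]
    rw [hasDerivAt_iff_isLittleO_nhds_zero]
    have h1 : (fun h : ℝ => posPow (n + 2) h) =O[nhds 0] fun h => h ^ 2 := by
      refine Asymptotics.IsBigO.of_bound 1 ?_
      filter_upwards [gt_mem_nhds one_pos] with y hy
      rcases le_total 0 y with h | h
      · rw [posPow_of_nonneg h, one_mul, Real.norm_of_nonneg (by positivity),
          Real.norm_of_nonneg (by positivity)]
        exact pow_le_pow_of_le_one h hy.le (by omega)
      · rw [posPow_of_nonpos (by omega) h, norm_zero]; positivity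
    have h2 : (fun h : ℝ => h ^ 2) =o[nhds 0] fun h => h := by
      simpa using Asymptotics.isLittleO_pow_id (𝕜 := ℝ) (n := 2) one_lt_two
    simpa [posPow] using h1.trans_isLittleO h2
  · rw [posPow_of_nonneg h.le]
    have := hasDerivAt_pow (n + 2) x
    refine (this.congr_of_eventuallyEq ?_).congr_deriv (by simp)
    filter_upwards [lt_mem_nhds h] with y hy
    exact posPow_of_nonneg hy.le

/-- The fourth centred difference of `φ`. -/
def fourthDiff (φ : ℝ → ℝ) (x : ℝ) : ℝ :=
  φ (x + 2) - 4 * φ (x + 1) + 6 * φ x - 4 * φ (x - 1) + φ (x - 2)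

lemma HasDerivAt.fourthDiff {φ φ' : ℝ → ℝ} (h : ∀ x, HasDerivAt φ (φ' x) x) (x : ℝ) :
    HasDerivAt (fourthDiff φ) (fourthDiff φ' x) x := by
  have e := ((((h (x + 2)).comp_add_const x 2).sub (((h (x + 1)).comp_add_const x 1).const_mul 4)).add
    ((h x).const_mul 6)).sub (((h (x - 1)).comp_sub_const x 1).const_mul 4) |>.add
      ((h (x - 2)).comp_sub_const x 2)
  exact e

lemma continuous_fourthDiff {φ : ℝ → ℝ} (h : Continuous φ) : Continuous (fourthDiff φ) := by
  unfold fourthDiff; fun_prop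

/-- The cubic B-spline. -/
def spline (x : ℝ) : ℝ := fourthDiff (posPow 3) x / 6

/-- The derivative of `spline`. -/
def splineD (x : ℝ) : ℝ := fourthDiff (posPow 2) x / 2

/-- The second derivative of `spline`. -/
def splineDD (x : ℝ) : ℝ := fourthDiff (posPow 1) x

lemma hasDerivAt_spline (x : ℝ) : HasDerivAt spline (splineD x) x := by
  have h : ∀ x, HasDerivAt (posPow 3) (3 * posPow 2 x) x := fun x => by
    simpa using hasDerivAt_posPow 1 x
  refine ((HasDerivAt.fourthDiff h x).div_const 6).congr_deriv ?_
  simp only [fourthDiff, splineD]; ring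

lemma hasDerivAt_splineD (x : ℝ) : HasDerivAt splineD (splineDD x) x := by
  have h : ∀ x, HasDerivAt (posPow 2) (2 * posPow 1 x) x := fun x => by
    simpa using hasDerivAt_posPow 0 x
  refine ((HasDerivAt.fourthDiff h x).div_const 2).congr_deriv ?_
  simp only [fourthDiff, splineDD]; ring

lemma fourthDiff_posPow_eq_zero {n : ℕ} (hn : n ≠ 0) (hn3 : n ≤ 3) {x : ℝ} (hx : 2 ≤ |x|) :
    fourthDiff (posPow n) x = 0 := by
  rcases le_abs.1 hx with h | h
  · simp only [fourthDiff]
    rw [posPow_of_nonneg (by linarith), posPow_of_nonneg (by linarith), posPow_of_nonneg (by linarith),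
      posPow_of_nonneg (by linarith), posPow_of_nonneg (by linarith)]
    interval_cases n
    · exact absurd rfl hn
    all_goals ring
  · simp only [fourthDiff]
    rw [posPow_of_nonpos hn (by linarith), posPow_of_nonpos hn (by linarith),
      posPow_of_nonpos hn (by linarith), posPow_of_nonpos hn (by linarith),
      posPow_of_nonpos hn (by linarith)]
    ring

lemma spline_eq_zero {x : ℝ} (hx : 2 ≤ |x|) : spline x = 0 := by
  rw [spline, fourthDiff_posPow_eq_zero (by norm_num) (by norm_num) hx, zero_div]

lemma exists_spline_bound : ∃ B : ℝ, 1 ≤ B ∧ ∀ x, |spline x| ≤ B ∧ |splineD x| ≤ B ∧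
    |splineDD x| ≤ B := by
  have key : ∀ n, n ≠ 0 → n ≤ 3 → ∃ B, ∀ x, |fourthDiff (posPow n) x| ≤ B := by
    intro n hn hn3
    obtain ⟨B, hB⟩ := (isCompact_Icc (a := (-2 : ℝ)) (b := 2)).exists_bound_of_continuousOn
      (continuous_fourthDiff (continuous_posPow n)).continuousOn
    refine ⟨B, fun x => ?_⟩
    by_cases hx : 2 ≤ |x|
    · rw [fourthDiff_posPow_eq_zero hn hn3 hx, abs_zero]
      exact (norm_nonneg _).trans (hB 0 (by norm_num))
    · exact hB x ⟨by linarith [neg_abs_le x], by linarith [le_abs_self x]⟩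
  obtain ⟨B₁, h₁⟩ := key 1 one_ne_zero (by norm_num)
  obtain ⟨B₂, h₂⟩ := key 2 two_ne_zero (by norm_num)
  obtain ⟨B₃, h₃⟩ := key 3 three_ne_zero le_rfl
  have n1 := (abs_nonneg _).trans (h₁ 0)
  have n2 := (abs_nonneg _).trans (h₂ 0)
  have n3 := (abs_nonneg _).trans (h₃ 0)
  refine ⟨1 + B₁ + B₂ + B₃, by linarith, fun x => ⟨?_, ?_, ?_⟩⟩
  · rw [spline, abs_div, abs_of_pos (by norm_num : (0 : ℝ) < 6)]; linarith [h₃ x]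
  · rw [splineD, abs_div, abs_of_pos (by norm_num : (0 : ℝ) < 2)]; linarith [h₂ x]
  · rw [splineDD]; linarith [h₁ x]

lemma sum_Icc_neg_two (φ : ℤ → ℝ) :
    ∑ p ∈ Finset.Icc (-2 : ℤ) 2, φ p = φ (-2) + φ (-1) + φ 0 + φ 1 + φ 2 := by
  have : Finset.Icc (-2 : ℤ) 2 = {-2, -1, 0, 1, 2} := by decide
  rw [this]
  simp
  ring

lemma sum_spline_eq_one {x : ℝ} (hx : |x| ≤ 1) : ∑ p ∈ Finset.Icc (-2 : ℤ) 2, spline (x - p) = 1 := by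
  obtain ⟨h1, h2⟩ := abs_le.1 hx
  have z1 : posPow 3 (-1 + x) = 0 := posPow_of_nonpos three_ne_zero (by linarith)
  have z2 : posPow 3 (-2 + x) = 0 := posPow_of_nonpos three_ne_zero (by linarith)
  have z3 : posPow 3 (-3 + x) = 0 := posPow_of_nonpos three_ne_zero (by linarith)
  have z4 : posPow 3 (-4 + x) = 0 := posPow_of_nonpos three_ne_zero (by linarith)
  have y1 : posPow 3 (1 + x) = (1 + x) ^ 3 := posPow_of_nonneg (by linarith)
  have y2 : posPow 3 (2 + x) = (2 + x) ^ 3 := posPow_of_nonneg (by linarith)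
  have y3 : posPow 3 (3 + x) = (3 + x) ^ 3 := posPow_of_nonneg (by linarith)
  have y4 : posPow 3 (4 + x) = (4 + x) ^ 3 := posPow_of_nonneg (by linarith)
  rw [sum_Icc_neg_two]
  simp only [spline, fourthDiff]
  push_cast
  ring_nf
  rw [z1, z2, z3, z4, y1, y2, y3, y4]
  ring

/-- The refinement mask of the cubic B-spline. -/
def mask (m : ℤ) : ℝ :=
  if m = 0 then 6 / 8 else if m = 1 ∨ m = -1 then 4 / 8 else if m = 2 ∨ m = -2 then 1 / 8 else 0

lemma mask_nonneg (m : ℤ) : 0 ≤ mask m := by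
  unfold mask; split_ifs <;> norm_num

lemma spline_refine (x : ℝ) :
    spline x = ∑ m ∈ Finset.Icc (-2 : ℤ) 2, mask m * spline (2 * x - m) := by
  have e : ∀ y z : ℝ, z = 2 * y → posPow 3 y = posPow 3 z / 8 := fun y z h => by
    rw [h, posPow_two_mul]; ring
  rw [sum_Icc_neg_two]
  simp only [spline, fourthDiff, mask]
  rw [e (x + 2) (4 + 2 * x) (by ring), e (x + 1) (2 + 2 * x) (by ring), e x (2 * x) rfl,
    e (x - 1) (-2 + 2 * x) (by ring), e (x - 2) (-4 + 2 * x) (by ring)]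
  norm_num
  ring_nf

end

/-- The tensor product spline with index `p` at scale `2⁻ᵏ`, centred at `b`. -/
def tileVal (b : ℂ) (k : ℕ) (p : ℤ × ℤ) (z : ℂ) : ℝ :=
  spline (2 ^ k * (z - b).re - p.1) * spline (2 ^ k * (z - b).im - p.2)

/-- The square carrying `tileVal b k p`. -/
def tile (b : ℂ) (k : ℕ) (p : ℤ × ℤ) : Set ℂ :=
  {z | |2 ^ k * (z - b).re - p.1| ≤ 2 ∧ |2 ^ k * (z - b).im - p.2| ≤ 2}

lemma isClosed_tile (b : ℂ) (k : ℕ) (p : ℤ × ℤ) : IsClosed (tile b k p) := by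
  rw [tile, ofPred_and]
  exact (isClosed_le (by fun_prop) continuous_const).inter
    (isClosed_le (by fun_prop) continuous_const)

lemma tileVal_eq_zero {b : ℂ} {k : ℕ} {p : ℤ × ℤ} {z : ℂ} (hz : z ∉ tile b k p) :
    tileVal b k p z = 0 := by
  rw [tileVal]
  by_cases h : |2 ^ k * (z - b).re - p.1| ≤ 2
  · rw [spline_eq_zero (le_of_lt (not_le.1 fun h' => hz ⟨h, h'⟩)), mul_zero]
  · rw [spline_eq_zero (le_of_lt (not_le.1 h)), zero_mul]

lemma norm_sub_le_of_mem_tile {b : ℂ} {k : ℕ} {p : ℤ × ℤ} {z w : ℂ} (hz : z ∈ tile b k p)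
    (hw : w ∈ tile b k p) : ‖z - w‖ ≤ 8 * (1 / 2) ^ k := by
  have key : ∀ x y t : ℝ, |2 ^ k * x - t| ≤ 2 → |2 ^ k * y - t| ≤ 2 → |x - y| ≤ 4 * (1 / 2) ^ k := by
    intro x y t hx hy
    rw [one_div, inv_pow, ← div_eq_mul_inv, le_div_iff₀ (by positivity)]
    rw [abs_le] at hx hy
    rw [← abs_of_pos (show (0 : ℝ) < 2 ^ k by positivity), ← abs_mul, abs_le]
    constructor <;> linarith
  have h1 := key _ _ _ hz.1 hw.1
  have h2 := key _ _ _ hz.2 hw.2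
  have h3 := Complex.norm_le_abs_re_add_abs_im (z - w)
  rw [show (z - w).re = (z - b).re - (w - b).re by simp,
    show (z - w).im = (z - b).im - (w - b).im by simp] at h3
  linarith

/-- Sum over the square block of indices `{-2, …, 2}²`. -/
def idxBlock : Finset (ℤ × ℤ) := Finset.Icc (-2) 2 ×ˢ Finset.Icc (-2) 2

lemma mask_eq_zero {m : ℤ} (hm : m ∉ Finset.Icc (-2 : ℤ) 2) : mask m = 0 := by
  rw [Finset.mem_Icc, not_and_or] at hm
  unfold mask
  rw [if_neg (by omega), if_neg (by omega), if_neg (by omega)]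

lemma tileVal_refine (b : ℂ) (k : ℕ) (p : ℤ × ℤ) (z : ℂ) :
    tileVal b k p z = ∑ m ∈ idxBlock,
      mask m.1 * mask m.2 * tileVal b (k + 1) (2 * p.1 + m.1, 2 * p.2 + m.2) z := by
  rw [tileVal, spline_refine, spline_refine (2 ^ k * (z - b).im - p.2), Finset.sum_mul_sum, idxBlock,
    Finset.sum_product]
  refine Finset.sum_congr rfl fun m _ => Finset.sum_congr rfl fun n _ => ?_
  simp only [tileVal, pow_succ]
  push_cast
  rw [show 2 * (2 ^ k * (z - b).re - (p.1 : ℝ)) - m = 2 ^ k * 2 * (z - b).re - (2 * p.1 + m) by ring,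
    show 2 * (2 ^ k * (z - b).im - (p.2 : ℝ)) - n = 2 ^ k * 2 * (z - b).im - (2 * p.2 + n) by ring]
  ring

lemma tile_refine_subset {b : ℂ} {k : ℕ} {p m : ℤ × ℤ} (hm : m ∈ idxBlock) :
    tile b (k + 1) (2 * p.1 + m.1, 2 * p.2 + m.2) ⊆ tile b k p := by
  have key : ∀ (x : ℝ) (p m : ℤ), m ∈ Finset.Icc (-2 : ℤ) 2 → |2 ^ (k + 1) * x - (2 * p + m : ℤ)| ≤ 2 →
      |2 ^ k * x - p| ≤ 2 := by
    intro x p m hm h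
    rw [Finset.mem_Icc] at hm
    have h1 : (-2 : ℝ) ≤ m := by exact_mod_cast hm.1
    have h2 : (m : ℝ) ≤ 2 := by exact_mod_cast hm.2
    push_cast at h
    rw [abs_le, pow_succ] at h
    rw [abs_le]
    constructor <;> linarith
  rw [idxBlock, Finset.mem_product] at hm
  exact fun z hz => ⟨key _ _ _ hm.1 hz.1, key _ _ _ hm.2 hz.2⟩

/-- A bump function that equals one near `b`. -/
def baseBump (b z : ℂ) : ℝ := ∑ p ∈ idxBlock, tileVal b 7 p z

lemma baseBump_eq_one {b z : ℂ} (hz : ‖z - b‖ ≤ (1 / 2) ^ 7) : baseBump b z = 1 := by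
  have key : ∀ x : ℝ, |x| ≤ ‖z - b‖ → |2 ^ 7 * x| ≤ 1 := fun x hx => by
    rw [abs_mul, abs_of_pos (by positivity)]
    norm_num at hz ⊢
    linarith
  rw [baseBump, idxBlock, Finset.sum_product]
  simp only [tileVal]
  rw [← Finset.sum_mul_sum, sum_spline_eq_one (key _ (Complex.abs_re_le_norm _)),
    sum_spline_eq_one (key _ (Complex.abs_im_le_norm _)), one_mul]

lemma tile_subset_closedBall {b : ℂ} {p : ℤ × ℤ} (hp : p ∈ idxBlock) :
    tile b 7 p ⊆ closedBall b (1 / 16) := by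
  have key : ∀ (x : ℝ) (p : ℤ), p ∈ Finset.Icc (-2 : ℤ) 2 → |2 ^ 7 * x - p| ≤ 2 → |x| ≤ 1 / 32 := by
    intro x p hm h
    rw [Finset.mem_Icc] at hm
    have h1 : (-2 : ℝ) ≤ p := by exact_mod_cast hm.1
    have h2 : (p : ℝ) ≤ 2 := by exact_mod_cast hm.2
    rw [abs_le] at h ⊢
    constructor <;> linarith
  rw [idxBlock, Finset.mem_product] at hp
  intro z hz
  rw [mem_closedBall, dist_eq_norm]
  linarith [Complex.norm_le_abs_re_add_abs_im (z - b), key _ _ hp.1 hz.1, key _ _ hp.2 hz.2]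

lemma sum_mask_le (q : ℤ) (t : Finset ℤ) : ∑ p ∈ t, mask (q - 2 * p) ≤ 1 := by
  have h1 : ∑ p ∈ t, mask (q - 2 * p) ≤ ∑ p ∈ ({q / 2 - 1, q / 2, q / 2 + 1} : Finset ℤ),
      mask (q - 2 * p) := by
    rw [← Finset.sum_filter_ne_zero]
    refine Finset.sum_le_sum_of_subset_of_nonneg (fun p hp => ?_) fun p _ _ => mask_nonneg _
    have h := (Finset.mem_filter.1 hp).2
    have h' : q - 2 * p ∈ Finset.Icc (-2 : ℤ) 2 := by_contra fun h' => h (mask_eq_zero h')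
    rw [Finset.mem_Icc] at h'
    simp only [Finset.mem_insert, Finset.mem_singleton]
    omega
  refine h1.trans ?_
  rw [Finset.sum_insert (by simp; omega), Finset.sum_insert (by simp), Finset.sum_singleton]
  rcases Int.emod_two_eq_zero_or_one q with h | h
  · rw [show q - 2 * (q / 2 - 1) = 2 by omega, show q - 2 * (q / 2) = 0 by omega,
      show q - 2 * (q / 2 + 1) = -2 by omega]
    norm_num [mask]
  · rw [show q - 2 * (q / 2 - 1) = 3 by omega, show q - 2 * (q / 2) = 1 by omega,
      show q - 2 * (q / 2 + 1) = -1 by omega]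
    norm_num [mask]

lemma sum_mask_mul_le (q : ℤ × ℤ) (s : Finset (ℤ × ℤ)) :
    ∑ p ∈ s, mask (q.1 - 2 * p.1) * mask (q.2 - 2 * p.2) ≤ 1 := by
  refine (Finset.sum_le_sum_of_subset_of_nonneg
    (Finset.subset_product (s := s)) fun p _ _ => mul_nonneg (mask_nonneg _) (mask_nonneg _)).trans ?_
  rw [Finset.sum_product]
  simp only
  rw [← Finset.sum_mul_sum]
  exact mul_le_one₀ (sum_mask_le _ _) (Finset.sum_nonneg fun _ _ => mask_nonneg _) (sum_mask_le _ _)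

/-- One refinement step for a finite combination of splines. -/
lemma sum_tileVal_refine (b : ℂ) (k : ℕ) (s : Finset (ℤ × ℤ)) (w : ℤ × ℤ → ℝ) (z : ℂ) :
    ∑ p ∈ s, w p * tileVal b k p z =
      ∑ q ∈ (s ×ˢ idxBlock).image fun x => (2 * x.1.1 + x.2.1, 2 * x.1.2 + x.2.2),
        (∑ p ∈ s, w p * (mask (q.1 - 2 * p.1) * mask (q.2 - 2 * p.2))) * tileVal b (k + 1) q z := by
  simp only [Finset.sum_mul]
  rw [Finset.sum_comm]
  refine Finset.sum_congr rfl fun p hp => ?_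
  rw [tileVal_refine, Finset.mul_sum]
  symm
  refine (Finset.sum_subset
    (s₁ := idxBlock.image fun m : ℤ × ℤ => (2 * p.1 + m.1, 2 * p.2 + m.2)) ?_ ?_).symm.trans ?_
  rotate_left 2
  · rw [Finset.sum_image]
    · refine Finset.sum_congr rfl fun m _ => ?_
      simp only [add_sub_cancel_left]
      ring
    · rintro ⟨m₁, m₂⟩ _ ⟨n₁, n₂⟩ _ h
      simpa using h
  · intro q hq
    obtain ⟨m, hm, rfl⟩ := Finset.mem_image.1 hq
    exact Finset.mem_image.2 ⟨(p, m), Finset.mem_product.2 ⟨hp, hm⟩, rfl⟩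
  · intro q _ hq
    have : mask (q.1 - 2 * p.1) * mask (q.2 - 2 * p.2) = 0 := by
      by_contra h
      refine hq (Finset.mem_image.2 ⟨(q.1 - 2 * p.1, q.2 - 2 * p.2), ?_, by simp⟩)
      rw [idxBlock, Finset.mem_product]
      exact ⟨by_contra fun h' => h (by rw [mask_eq_zero h', zero_mul]),
        by_contra fun h' => h (by rw [mask_eq_zero h', mul_zero])⟩
    rw [this, mul_zero, zero_mul]

/-- Stopping-time decomposition of the base bump: splines are refined until they meet the stopping
condition or reach level `K`. -/
lemma exists_stopping_decomposition (b : ℂ) (Stop : ℕ → ℤ × ℤ → Prop) {K : ℕ} (hK : 7 ≤ K) :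
    ∃ (D : Finset (ℕ × (ℤ × ℤ))) (a : ℕ × (ℤ × ℤ) → ℝ) (s : Finset (ℤ × ℤ)) (w : ℤ × ℤ → ℝ),
      (∀ x, 0 ≤ a x ∧ a x ≤ 1) ∧ (∀ p, 0 ≤ w p ∧ w p ≤ 1) ∧
      (∀ x ∈ D, 7 ≤ x.1 ∧ x.1 < K ∧ Stop x.1 x.2) ∧
      (∀ p ∈ s, ∀ e ∈ tile b K p, e ∈ closedBall b (1 / 16) ∧
        ∀ k, 7 ≤ k → k < K → ∃ p', ¬Stop k p' ∧ e ∈ tile b k p') ∧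
      ∀ z, baseBump b z = ∑ x ∈ D, a x * tileVal b x.1 x.2 z + ∑ p ∈ s, w p * tileVal b K p z := by
  classical
  induction K, hK using Nat.le_induction with
  | base =>
    refine ⟨∅, fun _ => 0, idxBlock, fun _ => 1, by simp, by simp, by simp, fun p hp e he =>
      ⟨tile_subset_closedBall hp he, fun k h1 h2 => absurd h1 (by omega)⟩, fun z => ?_⟩
    simp [baseBump]
  | succ K hK ih =>
    obtain ⟨D, a, s, w, ha, hw, hD, hs, hsum⟩ := ih
    set s₁ := s.filter fun p => Stop K p with hs₁
    set s₂ := s.filter fun p => ¬Stop K p with hs₂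
    refine ⟨D ∪ s₁.image fun p => (K, p), fun x => if x.1 = K then w x.2 else a x,
      (s₂ ×ˢ idxBlock).image fun x => (2 * x.1.1 + x.2.1, 2 * x.1.2 + x.2.2),
      fun q => ∑ p ∈ s₂, w p * (mask (q.1 - 2 * p.1) * mask (q.2 - 2 * p.2)), fun x => ?_,
      fun q => ⟨?_, ?_⟩, fun x hx => ?_, fun q hq e he => ?_, fun z => ?_⟩
    · dsimp only
      split_ifs
      · exact hw _
      · exact ha _
    · exact Finset.sum_nonneg fun p _ =>
        mul_nonneg (hw p).1 (mul_nonneg (mask_nonneg _) (mask_nonneg _))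
    · refine (Finset.sum_le_sum fun p _ => ?_).trans (sum_mask_mul_le q s₂)
      exact mul_le_of_le_one_left (mul_nonneg (mask_nonneg _) (mask_nonneg _)) (hw p).2
    · rcases Finset.mem_union.1 hx with hx | hx
      · obtain ⟨h1, h2, h3⟩ := hD x hx
        exact ⟨h1, by omega, h3⟩
      · obtain ⟨p, hp, rfl⟩ := Finset.mem_image.1 hx
        exact ⟨hK, by simp, (Finset.mem_filter.1 hp).2⟩
    · obtain ⟨⟨p, m⟩, hpm, rfl⟩ := Finset.mem_image.1 hq
      obtain ⟨hp, hm⟩ := Finset.mem_product.1 hpm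
      obtain ⟨hps, hns⟩ := Finset.mem_filter.1 hp
      have he' := tile_refine_subset hm he
      obtain ⟨h1, h2⟩ := hs p hps e he'
      refine ⟨h1, fun k hk hkK => ?_⟩
      rcases (Nat.lt_succ_iff_lt_or_eq.1 hkK) with h | rfl
      · exact h2 k hk h
      · exact ⟨p, hns, he'⟩
    · rw [hsum z, ← sum_tileVal_refine, Finset.sum_union, Finset.sum_image (by simp),
        add_assoc]
      · congr 1
        · refine Finset.sum_congr rfl fun x hx => ?_
          simp only [if_neg (hD x hx).2.1.ne]
        · simp only [if_true]
          exact (Finset.sum_filter_add_sum_filter_not s _ _).symm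
      · rw [Finset.disjoint_right]
        intro x hx hxD
        obtain ⟨p, _, rfl⟩ := Finset.mem_image.1 hx
        exact absurd (hD _ hxD).2.1 (lt_irrefl _)

section

open MeasureTheory

lemma contDiff_spline : ContDiff ℝ 2 spline := by
  have h1 : deriv spline = splineD := funext fun x => (hasDerivAt_spline x).deriv
  have h2 : deriv splineD = splineDD := funext fun x => (hasDerivAt_splineD x).deriv
  have h3 : ContDiff ℝ 1 splineD := contDiff_one_iff_deriv.2
    ⟨fun x => (hasDerivAt_splineD x).differentiableAt, by
      rw [h2]; exact continuous_fourthDiff (continuous_posPow 1)⟩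
  rw [show (2 : WithTop ℕ∞) = 1 + 1 by norm_num, contDiff_succ_iff_deriv, h1]
  exact ⟨fun x => (hasDerivAt_spline x).differentiableAt, by simp, h3⟩

/-- Directional derivatives of functions with separated variables. -/
lemma dirDeriv_separated {p q p' q' : ℝ → ℝ} (hp : ∀ x, HasDerivAt p (p' x) x)
    (hq : ∀ x, HasDerivAt q (q' x) x) (v : ℂ) :
    dirDeriv v (fun w => ((p w.re * q w.im : ℝ) : ℂ)) = fun w =>
      ((v.re * (p' w.re * q w.im) + v.im * (p w.re * q' w.im) : ℝ) : ℂ) := by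
  ext w
  have h1 : HasFDerivAt (fun w : ℂ => p w.re) (p' w.re • Complex.reCLM) w :=
    (hp w.re).comp_hasFDerivAt w Complex.reCLM.hasFDerivAt
  have h2 : HasFDerivAt (fun w : ℂ => q w.im) (q' w.im • Complex.imCLM) w :=
    (hq w.im).comp_hasFDerivAt w Complex.imCLM.hasFDerivAt
  have h3 := Complex.ofRealCLM.hasFDerivAt.comp w (h1.mul h2)
  have h4 : HasFDerivAt (fun w : ℂ => ((p w.re * q w.im : ℝ) : ℂ)) _ w := h3
  rw [dirDeriv, h4.fderiv]
  simp
  ring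

/-- The complex valued version of `tileVal`. -/
def tileFun (b : ℂ) (k : ℕ) (p : ℤ × ℤ) (z : ℂ) : ℂ := tileVal b k p z

lemma contDiff_tileFun (b : ℂ) (k : ℕ) (p : ℤ × ℤ) : ContDiff ℝ 2 (tileFun b k p) := by
  have hre : ContDiff ℝ 2 fun z : ℂ => 2 ^ k * (z - b).re - (p.1 : ℝ) :=
    (contDiff_const.mul (Complex.reCLM.contDiff.comp (contDiff_id.sub contDiff_const))).sub
      contDiff_const
  have him : ContDiff ℝ 2 fun z : ℂ => 2 ^ k * (z - b).im - (p.2 : ℝ) :=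
    (contDiff_const.mul (Complex.imCLM.contDiff.comp (contDiff_id.sub contDiff_const))).sub
      contDiff_const
  exact Complex.ofRealCLM.contDiff.comp ((contDiff_spline.comp hre).mul (contDiff_spline.comp him))

lemma tsupport_tileFun_subset (b : ℂ) (k : ℕ) (p : ℤ × ℤ) : tsupport (tileFun b k p) ⊆ tile b k p :=
  closure_minimal (fun z hz => by_contra fun h => hz (by rw [tileFun, tileVal_eq_zero h, Complex.ofReal_zero]))
    (isClosed_tile b k p)

lemma isBounded_tile (b : ℂ) (k : ℕ) (p : ℤ × ℤ) : Bornology.IsBounded (tile b k p) :=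
  Metric.isBounded_iff.2 ⟨_, fun _ hz _ hw => (dist_eq_norm _ _).trans_le
    (norm_sub_le_of_mem_tile hz hw)⟩

lemma hasCompactSupport_tileFun (b : ℂ) (k : ℕ) (p : ℤ × ℤ) : HasCompactSupport (tileFun b k p) :=
  (isCompact_of_isClosed_isBounded (isClosed_tile b k p)
    (isBounded_tile b k p)).of_isClosed_subset (isClosed_tsupport _) (tsupport_tileFun_subset b k p)

lemma hasDerivAt_comp_affine {φ φ' : ℝ → ℝ} (h : ∀ x, HasDerivAt φ (φ' x) x) (s c d x : ℝ) :
    HasDerivAt (fun x => φ (s * (x - c) - d)) (s * φ' (s * (x - c) - d)) x := by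
  have : HasDerivAt (fun x => φ (s * (x - c) - d)) (φ' (s * (x - c) - d) * (s * 1)) x :=
    (h (s * (x - c) - d)).comp x (((hasDerivAt_id x).sub_const c).const_mul s |>.sub_const d)
  exact this.congr_deriv (by ring)

lemma norm_dirDeriv_tileFun_le {B : ℝ} (hB : ∀ x, |spline x| ≤ B ∧ |splineD x| ≤ B ∧ |splineDD x| ≤ B)
    (b : ℂ) (k : ℕ) (p : ℤ × ℤ) (z : ℂ) :
    ‖dirDeriv 1 (tileFun b k p) z‖ ≤ 2 ^ k * B ^ 2 ∧
    ‖dirDeriv Complex.I (tileFun b k p) z‖ ≤ 2 ^ k * B ^ 2 ∧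
    ‖planeLap (tileFun b k p) z‖ ≤ 2 * 4 ^ k * B ^ 2 := by
  have hB0 : 0 ≤ B := (abs_nonneg _).trans (hB 0).1
  set s : ℝ := 2 ^ k with hs
  have hs0 : 0 < s := by positivity
  set p₀ : ℝ → ℝ := fun x => spline (s * (x - b.re) - p.1) with hp₀
  set q₀ : ℝ → ℝ := fun x => spline (s * (x - b.im) - p.2) with hq₀
  set p₁ : ℝ → ℝ := fun x => s * splineD (s * (x - b.re) - p.1) with hp₁
  set q₁ : ℝ → ℝ := fun x => s * splineD (s * (x - b.im) - p.2) with hq₁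
  set p₂ : ℝ → ℝ := fun x => s * (s * splineDD (s * (x - b.re) - p.1)) with hp₂
  set q₂ : ℝ → ℝ := fun x => s * (s * splineDD (s * (x - b.im) - p.2)) with hq₂
  have e : tileFun b k p = fun w => ((p₀ w.re * q₀ w.im : ℝ) : ℂ) := by
    ext w; simp [tileFun, tileVal, hp₀, hq₀, hs]
  have dp₀ : ∀ x, HasDerivAt p₀ (p₁ x) x := fun x => hasDerivAt_comp_affine hasDerivAt_spline _ _ _ x
  have dq₀ : ∀ x, HasDerivAt q₀ (q₁ x) x := fun x => hasDerivAt_comp_affine hasDerivAt_spline _ _ _ x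
  have dp₁ : ∀ x, HasDerivAt p₁ (p₂ x) x := fun x =>
    (hasDerivAt_comp_affine hasDerivAt_splineD _ _ _ x).const_mul s
  have dq₁ : ∀ x, HasDerivAt q₁ (q₂ x) x := fun x =>
    (hasDerivAt_comp_affine hasDerivAt_splineD _ _ _ x).const_mul s
  have e1 : dirDeriv 1 (tileFun b k p) = fun w => ((p₁ w.re * q₀ w.im : ℝ) : ℂ) := by
    rw [e, dirDeriv_separated dp₀ dq₀]; simp
  have e2 : dirDeriv Complex.I (tileFun b k p) = fun w => ((p₀ w.re * q₁ w.im : ℝ) : ℂ) := by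
    rw [e, dirDeriv_separated dp₀ dq₀]; simp
  have e3 : planeLap (tileFun b k p) z = ((p₂ z.re * q₀ z.im + p₀ z.re * q₂ z.im : ℝ) : ℂ) := by
    rw [planeLap, e1, e2, dirDeriv_separated dp₁ dq₀, dirDeriv_separated dp₀ dq₁]; simp
  have bd : ∀ x y : ℝ, |x| ≤ B → |y| ≤ B → |x| * |y| ≤ B ^ 2 := fun x y hx hy => by
    rw [sq]; gcongr
  have a4 : (4 : ℝ) ^ k = s * s := by rw [hs, ← mul_pow]; norm_num
  refine ⟨?_, ?_, ?_⟩
  · rw [e1, Complex.norm_real, Real.norm_eq_abs, hp₁, hq₀]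
    simp only [abs_mul, abs_of_pos hs0, mul_assoc]
    exact mul_le_mul_of_nonneg_left (bd _ _ (hB _).2.1 (hB _).1) hs0.le
  · rw [e2, Complex.norm_real, Real.norm_eq_abs, hp₀, hq₁]
    simp only [abs_mul, abs_of_pos hs0]
    rw [mul_left_comm]
    exact mul_le_mul_of_nonneg_left (bd _ _ (hB _).1 (hB _).2.1) hs0.le
  · rw [e3, Complex.norm_real, Real.norm_eq_abs, a4, hp₀, hq₀, hp₂, hq₂]
    refine (abs_add_le _ _).trans ?_
    simp only [abs_mul, abs_of_pos hs0]
    have t1 := mul_le_mul_of_nonneg_left (bd _ _ (hB (s * (z.re - b.re) - p.1)).2.2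
      (hB (s * (z.im - b.im) - p.2)).1) (mul_nonneg hs0.le hs0.le)
    have t2 := mul_le_mul_of_nonneg_left (bd _ _ (hB (s * (z.re - b.re) - p.1)).1
      (hB (s * (z.im - b.im) - p.2)).2.2) (mul_nonneg hs0.le hs0.le)
    linarith

/-- The bound for a single spline located at distance comparable to `2⁻ⁿ` from `b`. -/
lemma norm_integral_kelvinLap_tileFun_le {B : ℝ}
    (hB : ∀ x, |spline x| ≤ B ∧ |splineD x| ≤ B ∧ |splineDD x| ≤ B)
    {b : ℂ} {k n : ℕ} {p : ℤ × ℤ} (hk : n + 7 ≤ k) {e : ℂ} (he : e ∈ tile b k p)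
    (hd : (1 / 2) ^ (n + 3) < ‖e - b‖) {F : ℂ → ℂ} {A : ℝ} (hA : 0 ≤ A) {h : ℝ → ℝ}
    (hFc : Continuous F) (hF : ∀ z z', ‖F z - F z'‖ ≤ 2 * A * h ‖z - z'‖)
    (hmono : MonotoneOn h (Ici 0)) (h0 : ∀ r, 0 ≤ r → 0 ≤ h r)
    (hdbl : ∀ r, 0 ≤ r → h (2 * r) ≤ 2 * h r) :
    IsTest b (tileFun b k p) ∧ tileFun b k p =ᶠ[nhds b] (fun _ => 0) ∧
    ‖∫ z, F z * kelvinLap b (tileFun b k p) z‖ ≤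
      2 ^ 17 * Real.pi * B ^ 2 * A * (2 ^ n * h ((1 / 2) ^ k)) := by
  have hfar : ∀ z ∈ tile b k p, (1 / 2) ^ (n + 4) ≤ ‖z - b‖ := fun z hz => by
    have h1 := norm_sub_le_of_mem_tile he hz
    have h2 : ((1 : ℝ) / 2) ^ k ≤ (1 / 2) ^ (n + 7) :=
      pow_le_pow_of_le_one (by norm_num) (by norm_num) hk
    have h3 := norm_sub_le_norm_sub_add_norm_sub e z b
    have e1 : ((1 : ℝ) / 2) ^ (n + 7) = (1 / 2) ^ n / 128 := by rw [pow_add]; norm_num; ring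
    have e2 : ((1 : ℝ) / 2) ^ (n + 3) = (1 / 2) ^ n / 8 := by rw [pow_add]; norm_num; ring
    have e3 : ((1 : ℝ) / 2) ^ (n + 4) = (1 / 2) ^ n / 16 := by rw [pow_add]; norm_num; ring
    rw [e1] at h2
    rw [e2] at hd
    rw [e3]
    linarith
  have hbt : b ∉ tile b k p := fun hb => by
    have h1 := hfar b hb
    rw [sub_self, norm_zero] at h1
    exact absurd h1 (not_le.2 (by positivity))
  have hzero : tileFun b k p =ᶠ[nhds b] (fun _ => 0) :=
    notMem_tsupport_iff_eventuallyEq.1 fun hb => hbt (tsupport_tileFun_subset b k p hb)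
  have htest : IsTest b (tileFun b k p) :=
    ⟨contDiff_tileFun b k p, hasCompactSupport_tileFun b k p, 0, hzero⟩
  refine ⟨htest, hzero, ?_⟩
  have hconst : ∫ z, F e * kelvinLap b (tileFun b k p) z = 0 :=
    integral_mul_kelvinLap_eq_zero isOpen_univ (harmonicOnC_const (F e)) (contDiff_tileFun b k p)
      (subset_univ _) (hasCompactSupport_tileFun b k p) hzero
  have hdiff : ∫ z, F z * kelvinLap b (tileFun b k p) z =
      ∫ z in closedBall e (8 * (1 / 2) ^ k), (F z - F e) * kelvinLap b (tileFun b k p) z := by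
    rw [← sub_zero (∫ z, F z * kelvinLap b (tileFun b k p) z), ← hconst,
      ← integral_sub (htest.integrable hFc) (htest.integrable continuous_const)]
    simp only [← sub_mul]
    refine (setIntegral_eq_integral_of_forall_compl_eq_zero fun z hz => ?_).symm
    have : z ∉ tile b k p := fun hz' => hz (by
      rw [mem_closedBall, dist_eq_norm]; exact norm_sub_le_of_mem_tile hz' he)
    rw [image_eq_zero_of_notMem_tsupport fun hz' => this (tsupport_tileFun_subset b k p
      (tsupport_kelvinLap_subset b _ hz')), mul_zero]
  have hpow : (2 : ℝ) ^ (n + 4) ≤ 2 ^ k := pow_le_pow_right₀ (by norm_num) (by omega)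
  have a4 : (4 : ℝ) ^ k = 2 ^ k * 2 ^ k := by rw [← mul_pow]; norm_num
  have hLap : ∀ z, ‖kelvinLap b (tileFun b k p) z‖ ≤ 6 * 2 ^ (n + 4) * 4 ^ k * B ^ 2 := by
    intro z
    by_cases hz : z ∈ tile b k p
    · obtain ⟨d1, d2, d3⟩ := norm_dirDeriv_tileFun_le hB b k p z
      have hinv : ‖(z - b)⁻¹‖ ≤ 2 ^ (n + 4) := by
        rw [norm_inv]
        have := inv_anti₀ (by positivity) (hfar z hz)
        rwa [one_div, inv_pow, inv_inv] at this
      have hg : ‖dirDeriv 1 (tileFun b k p) z + Complex.I * dirDeriv Complex.I (tileFun b k p) z‖ ≤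
          2 * (2 ^ k * B ^ 2) := by
        refine (norm_add_le _ _).trans ?_
        rw [norm_mul, Complex.norm_I, one_mul]
        linarith
      rw [kelvinLap]
      refine (norm_sub_le _ _).trans ?_
      rw [norm_mul, norm_mul, norm_mul, norm_pow, Complex.norm_two]
      calc ‖(z - b)⁻¹‖ * ‖planeLap (tileFun b k p) z‖ + 2 * ‖(z - b)⁻¹‖ ^ 2 *
            ‖dirDeriv 1 (tileFun b k p) z + Complex.I * dirDeriv Complex.I (tileFun b k p) z‖
          ≤ 2 ^ (n + 4) * (2 * 4 ^ k * B ^ 2) + 2 * (2 ^ (n + 4)) ^ 2 * (2 * (2 ^ k * B ^ 2)) := by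
            gcongr
        _ ≤ 2 ^ (n + 4) * (2 * 4 ^ k * B ^ 2) + 2 * (2 ^ (n + 4) * 2 ^ k) * (2 * (2 ^ k * B ^ 2)) := by
            rw [sq (2 ^ (n + 4) : ℝ)]; gcongr
        _ = _ := by rw [a4]; ring
    · rw [image_eq_zero_of_notMem_tsupport fun hz' => hz (tsupport_tileFun_subset b k p
        (tsupport_kelvinLap_subset b _ hz')), norm_zero]
      positivity
  have hh : h (8 * (1 / 2) ^ k) ≤ 8 * h ((1 / 2) ^ k) := by
    have h1 := hdbl ((1 / 2) ^ k) (by positivity)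
    have h2 := hdbl (2 * (1 / 2) ^ k) (by positivity)
    have h3 := hdbl (2 * (2 * (1 / 2) ^ k)) (by positivity)
    rw [show (8 : ℝ) * (1 / 2) ^ k = 2 * (2 * (2 * (1 / 2) ^ k)) by ring]
    linarith
  have hbound : ∀ z ∈ closedBall e (8 * (1 / 2) ^ k),
      ‖(F z - F e) * kelvinLap b (tileFun b k p) z‖ ≤
        2 * A * (8 * h ((1 / 2) ^ k)) * (6 * 2 ^ (n + 4) * 4 ^ k * B ^ 2) := by
    intro z hz
    rw [mem_closedBall, dist_eq_norm] at hz
    rw [norm_mul]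
    have := h0 ((1 / 2) ^ k) (by positivity)
    gcongr
    · refine (hF z e).trans ?_
      gcongr
      exact (hmono (mem_Ici.2 (norm_nonneg _)) (mem_Ici.2 (by positivity)) hz).trans hh
    · exact hLap z
  rw [hdiff]
  refine (norm_setIntegral_le_of_norm_le_const measure_closedBall_lt_top hbound).trans ?_
  have hvol : volume.real (closedBall e (8 * (1 / 2) ^ k)) = Real.pi * (8 * (1 / 2) ^ k) ^ 2 := by
    rw [Measure.real, Complex.volume_closedBall, ENNReal.toReal_mul, ENNReal.toReal_pow,
      ENNReal.toReal_ofReal (by positivity)]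
    simp [mul_comm]
  have e1 : ((1 : ℝ) / 2) ^ k * 2 ^ k = 1 := by rw [← mul_pow]; norm_num
  rw [hvol, a4]
  have hnn : 0 ≤ B ^ 2 * A * (2 ^ n * h ((1 / 2) ^ k)) * Real.pi := by
    have := h0 ((1 / 2) ^ k) (by positivity)
    positivity
  calc _ = 2 * 8 * 6 * 16 * 64 * (B ^ 2 * A * (2 ^ n * h ((1 / 2) ^ k)) * Real.pi) *
        ((1 / 2) ^ k * 2 ^ k) ^ 2 := by ring
    _ ≤ 2 ^ 17 * (B ^ 2 * A * (2 ^ n * h ((1 / 2) ^ k)) * Real.pi) := by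
        rw [e1]; linarith
    _ = _ := by ring

end

section

open MeasureTheory ComplexConjugate

/-- A smooth decreasing step: one on `(-∞, 1]`, zero on `[2, ∞)`. -/
def smoothStep (t : ℝ) : ℝ := Real.smoothTransition (2 - t)

lemma contDiff_smoothStep : ContDiff ℝ 3 smoothStep :=
  (Real.smoothTransition.contDiff (n := 3)).comp (contDiff_const.sub contDiff_id)

lemma contDiff_deriv_smoothStep : ContDiff ℝ 2 (deriv smoothStep) := by
  have := contDiff_smoothStep
  rw [show (3 : WithTop ℕ∞) = 2 + 1 by norm_num, contDiff_succ_iff_deriv] at this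
  exact this.2.2

lemma hasDerivAt_smoothStep (t : ℝ) : HasDerivAt smoothStep (deriv smoothStep t) t :=
  (contDiff_smoothStep.differentiable three_ne_zero t).hasDerivAt

lemma hasDerivAt_deriv_smoothStep (t : ℝ) :
    HasDerivAt (deriv smoothStep) (deriv (deriv smoothStep) t) t :=
  (contDiff_deriv_smoothStep.differentiable two_ne_zero t).hasDerivAt

lemma antitone_smoothStep : Antitone smoothStep := fun _ _ h =>
  Real.smoothTransition.monotone (by linarith)

lemma deriv_smoothStep_nonpos (t : ℝ) : deriv smoothStep t ≤ 0 := antitone_smoothStep.deriv_nonpos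

lemma smoothStep_eq_zero {t : ℝ} (ht : 2 ≤ t) : smoothStep t = 0 :=
  Real.smoothTransition.zero_of_nonpos (by linarith)

lemma smoothStep_eq_one {t : ℝ} (ht : t ≤ 1) : smoothStep t = 1 :=
  Real.smoothTransition.one_of_one_le (by linarith)

lemma deriv_smoothStep_eq_zero {t : ℝ} (ht : 2 < t) : deriv smoothStep t = 0 := by
  have : smoothStep =ᶠ[nhds t] fun _ => 0 := by
    filter_upwards [lt_mem_nhds ht] with s hs
    exact smoothStep_eq_zero hs.le
  rw [this.deriv_eq, deriv_const]

/-- The radial variable in the disc of radius `ρ` about `b`. -/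
def radial (b : ℂ) (ρ : ℝ) (w : ℂ) : ℝ := ((w - b).re ^ 2 + (w - b).im ^ 2) / ρ ^ 2

lemma radial_eq (b : ℂ) (ρ : ℝ) (w : ℂ) : radial b ρ w = ‖w - b‖ ^ 2 / ρ ^ 2 := by
  rw [radial, Complex.sq_norm, Complex.normSq_apply, sq, sq]

lemma contDiff_radial (b : ℂ) (ρ : ℝ) {n : WithTop ℕ∞} : ContDiff ℝ n (radial b ρ) := by
  have hre : ContDiff ℝ n fun z : ℂ => (z - b).re :=
    Complex.reCLM.contDiff.comp (contDiff_id.sub contDiff_const)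
  have him : ContDiff ℝ n fun z : ℂ => (z - b).im :=
    Complex.imCLM.contDiff.comp (contDiff_id.sub contDiff_const)
  exact ((hre.pow 2).add (him.pow 2)).div_const _

lemma hasFDerivAt_radial (b : ℂ) (ρ : ℝ) (w : ℂ) : HasFDerivAt (radial b ρ)
    ((2 * (w - b).re / ρ ^ 2) • Complex.reCLM + (2 * (w - b).im / ρ ^ 2) • Complex.imCLM) w := by
  have hre : HasFDerivAt (fun z : ℂ => (z - b).re) Complex.reCLM w :=
    Complex.reCLM.hasFDerivAt.comp w ((hasFDerivAt_id w).sub_const b)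
  have him : HasFDerivAt (fun z : ℂ => (z - b).im) Complex.imCLM w :=
    Complex.imCLM.hasFDerivAt.comp w ((hasFDerivAt_id w).sub_const b)
  have h := ((hre.pow 2).add (him.pow 2)).const_mul (ρ ^ 2)⁻¹
  refine HasFDerivAt.congr_fderiv (f := radial b ρ) (h.congr_of_eventuallyEq
    (Eventually.of_forall fun z => ?_)) ?_
  · simp [radial, div_eq_inv_mul]
  · ext v
    simp
    ring

lemma dirDeriv_comp_radial {σ σ' : ℝ → ℝ} (h : ∀ t, HasDerivAt σ (σ' t) t) (b : ℂ) (ρ : ℝ) (v : ℂ) :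
    dirDeriv v (fun w => ((σ (radial b ρ w) : ℝ) : ℂ)) = fun w =>
      ((σ' (radial b ρ w) * (2 * ((w - b).re * v.re + (w - b).im * v.im) / ρ ^ 2) : ℝ) : ℂ) := by
  ext w
  have h1 : HasFDerivAt (fun w => ((σ (radial b ρ w) : ℝ) : ℂ)) _ w :=
    Complex.ofRealCLM.hasFDerivAt.comp w ((h _).comp_hasFDerivAt w (hasFDerivAt_radial b ρ w))
  rw [dirDeriv, h1.fderiv]
  simp
  ring

/-- Radial cutoff functions. -/
def discCutoff (b : ℂ) (ρ : ℝ) (w : ℂ) : ℂ := (smoothStep (radial b ρ w) : ℝ)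

/-- The radial mollifier attached to `discCutoff`. -/
def discKernel (b : ℂ) (ρ : ℝ) (w : ℂ) : ℝ := -deriv smoothStep (radial b ρ w) / ρ ^ 2

lemma kelvinLap_discCutoff (b : ℂ) {ρ : ℝ} (hρ : 0 < ρ) (w : ℂ) :
    kelvinLap b (discCutoff b ρ) w = -2 * (dirDeriv 1 (fun z => (discKernel b ρ z : ℂ)) w -
      Complex.I * dirDeriv Complex.I (fun z => (discKernel b ρ z : ℂ)) w) := by
  have e1 : ∀ v, dirDeriv v (discCutoff b ρ) = _ := fun v =>
    dirDeriv_comp_radial hasDerivAt_smoothStep b ρ v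
  have e2 : ∀ v, dirDeriv v (fun z => (discKernel b ρ z : ℂ)) = _ := fun v =>
    dirDeriv_comp_radial (σ := fun t => -deriv smoothStep t / ρ ^ 2)
      (fun t => (hasDerivAt_deriv_smoothStep t).neg.div_const (ρ ^ 2)) b ρ v
  have e3 : ∀ v, dirDeriv v (dirDeriv v (discCutoff b ρ)) w =
      ((deriv (deriv smoothStep) (radial b ρ w) *
        (2 * ((w - b).re * v.re + (w - b).im * v.im) / ρ ^ 2) ^ 2 +
        deriv smoothStep (radial b ρ w) * (2 * (v.re ^ 2 + v.im ^ 2) / ρ ^ 2) : ℝ) : ℂ) := by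
    intro v
    have hre : HasFDerivAt (fun z : ℂ => (z - b).re) Complex.reCLM w :=
      Complex.reCLM.hasFDerivAt.comp w ((hasFDerivAt_id w).sub_const b)
    have him : HasFDerivAt (fun z : ℂ => (z - b).im) Complex.imCLM w :=
      Complex.imCLM.hasFDerivAt.comp w ((hasFDerivAt_id w).sub_const b)
    have hl := (((hre.mul_const v.re).add (him.mul_const v.im)).const_mul 2).mul_const (ρ ^ 2)⁻¹
    have hs := (hasDerivAt_deriv_smoothStep _).comp_hasFDerivAt w (hasFDerivAt_radial b ρ w)
    have h1 : HasFDerivAt (fun w => ((deriv smoothStep (radial b ρ w) *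
      (2 * ((w - b).re * v.re + (w - b).im * v.im) / ρ ^ 2) : ℝ) : ℂ)) _ w :=
      Complex.ofRealCLM.hasFDerivAt.comp w (hs.mul hl)
    rw [e1, dirDeriv, h1.fderiv]
    simp
    ring
  rw [kelvinLap, planeLap, e3, e3, e1, e1, e2, e2]
  rcases eq_or_ne w b with rfl | hw
  · simp
  have hz : w - b ≠ 0 := sub_ne_zero.2 hw
  have hx : w - b = ((w - b).re : ℂ) + ((w - b).im : ℂ) * Complex.I := (Complex.re_add_im _).symm
  have hρ' : (ρ : ℂ) ≠ 0 := by exact_mod_cast hρ.ne'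
  rw [inv_mul_eq_div, ← one_div]
  have hI := Complex.I_sq
  have hI3 : Complex.I ^ 3 = -Complex.I := by rw [pow_succ, hI]; ring
  simp only [Complex.one_re, Complex.one_im, Complex.I_re, Complex.I_im]
  push_cast
  clear e1 e2 e3
  generalize ((deriv smoothStep (radial b ρ w) : ℝ) : ℂ) = s₁
  generalize ((deriv (deriv smoothStep) (radial b ρ w) : ℝ) : ℂ) = s₂
  generalize ((w - b).re : ℂ) = x at *
  generalize ((w - b).im : ℂ) = y at *
  rw [hx] at hz ⊢
  field_simp
  ring_nf
  simp only [hI, hI3]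
  ring

lemma radial_gt {b : ℂ} {ρ : ℝ} (hρ : 0 < ρ) {w : ℂ} (hw : w ∉ closedBall b (2 * ρ)) :
    2 < radial b ρ w := by
  rw [mem_closedBall, dist_eq_norm, not_le] at hw
  rw [radial_eq, lt_div_iff₀ (by positivity)]
  nlinarith

lemma tsupport_discCutoff_subset (b : ℂ) {ρ : ℝ} (hρ : 0 < ρ) :
    tsupport (discCutoff b ρ) ⊆ closedBall b (2 * ρ) :=
  closure_minimal (fun w hw => by_contra fun h => hw (by
    rw [discCutoff, smoothStep_eq_zero (radial_gt hρ h).le, Complex.ofReal_zero])) isClosed_closedBall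

lemma tsupport_discKernel_subset (b : ℂ) {ρ : ℝ} (hρ : 0 < ρ) :
    tsupport (fun z => (discKernel b ρ z : ℂ)) ⊆ closedBall b (2 * ρ) :=
  closure_minimal (fun w hw => by_contra fun h => hw (by
    simp [discKernel, deriv_smoothStep_eq_zero (radial_gt hρ h)])) isClosed_closedBall

lemma contDiff_discKernel (b : ℂ) (ρ : ℝ) : ContDiff ℝ 2 fun z => (discKernel b ρ z : ℂ) :=
  Complex.ofRealCLM.contDiff.comp
    (((contDiff_deriv_smoothStep.comp (contDiff_radial b ρ)).neg).div_const _)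

lemma isTest_discCutoff (b : ℂ) {ρ : ℝ} (hρ : 0 < ρ) :
    IsTest b (discCutoff b ρ) ∧ discCutoff b ρ =ᶠ[nhds b] fun _ => 1 := by
  have h1 : discCutoff b ρ =ᶠ[nhds b] fun _ => 1 := by
    filter_upwards [ball_mem_nhds b hρ] with w hw
    rw [mem_ball, dist_eq_norm] at hw
    rw [discCutoff, smoothStep_eq_one, Complex.ofReal_one]
    rw [radial_eq, div_le_one (by positivity)]
    gcongr
  refine ⟨⟨?_, ?_, 1, h1⟩, h1⟩
  · exact Complex.ofRealCLM.contDiff.comp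
      ((contDiff_smoothStep.of_le (by norm_num)).comp (contDiff_radial b ρ))
  · exact (isCompact_closedBall b (2 * ρ)).of_isClosed_subset (isClosed_tsupport _)
      (tsupport_discCutoff_subset b hρ)

lemma hasCompactSupport_discKernel (b : ℂ) {ρ : ℝ} (hρ : 0 < ρ) :
    HasCompactSupport fun z => (discKernel b ρ z : ℂ) :=
  (isCompact_closedBall b (2 * ρ)).of_isClosed_subset (isClosed_tsupport _)
    (tsupport_discKernel_subset b hρ)

lemma discKernel_nonneg (b : ℂ) (ρ : ℝ) (w : ℂ) : 0 ≤ discKernel b ρ w :=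
  div_nonneg (neg_nonneg.2 (deriv_smoothStep_nonpos _)) (sq_nonneg _)

lemma integral_discKernel (b : ℂ) {ρ : ℝ} (hρ : 0 < ρ) :
    ∫ w, discKernel b ρ w = ∫ w, discKernel 0 1 w := by
  have e : ∀ w, discKernel b ρ w = (ρ ^ 2)⁻¹ * discKernel 0 1 (ρ⁻¹ • (w - b)) := fun w => by
    simp only [discKernel, radial_eq, sub_zero, norm_smul, norm_inv, Real.norm_of_nonneg hρ.le]
    rw [one_pow, div_one, div_one, mul_pow, inv_pow, ← div_eq_inv_mul, ← div_eq_inv_mul]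
  simp only [e]
  rw [integral_const_mul, integral_sub_right_eq_self (fun w => discKernel 0 1 (ρ⁻¹ • w)) b,
    Measure.integral_comp_inv_smul_of_nonneg volume (discKernel 0 1) hρ.le,
    Complex.finrank_real_complex, smul_eq_mul, inv_mul_cancel_left₀ (by positivity)]

lemma continuous_discKernel (b : ℂ) (ρ : ℝ) : Continuous (discKernel b ρ) :=
  ((contDiff_deriv_smoothStep.continuous.comp (contDiff_radial b ρ (n := 0)).continuous).neg).div_const _

lemma hasCompactSupport_discKernel_real (b : ℂ) {ρ : ℝ} (hρ : 0 < ρ) :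
    HasCompactSupport (discKernel b ρ) :=
  HasCompactSupport.intro (isCompact_closedBall b (2 * ρ)) fun w hw => by
    simp [discKernel, deriv_smoothStep_eq_zero (radial_gt hρ hw)]

lemma integral_discKernel_pos : 0 < ∫ w, discKernel 0 1 w := by
  obtain ⟨t, ht, hd⟩ := exists_deriv_eq_slope smoothStep (one_lt_two)
    contDiff_smoothStep.continuous.continuousOn
    (contDiff_smoothStep.differentiable three_ne_zero).differentiableOn
  rw [smoothStep_eq_zero le_rfl, smoothStep_eq_one le_rfl] at hd
  refine (continuous_discKernel 0 1).integral_pos_of_hasCompactSupport_nonneg_nonzero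
    (hasCompactSupport_discKernel_real 0 one_pos) (discKernel_nonneg 0 1) (x := (√t : ℂ)) ?_
  have : radial 0 1 (√t : ℂ) = t := by
    rw [radial_eq, sub_zero, Complex.norm_real, Real.norm_of_nonneg (Real.sqrt_nonneg t),
      Real.sq_sqrt (by linarith [ht.1]), one_pow, div_one]
  rw [discKernel, this, hd]
  norm_num

lemma integral_mul_kelvinLap_discCutoff {b : ℂ} {ρ r : ℝ} (hρ : 0 < ρ) (hr : 2 * ρ < r) {h : ℂ → ℂ}
    (hh : ContDiffOn ℝ 2 h (ball b r)) :
    ∫ z, h z * kelvinLap b (discCutoff b ρ) z = 4 * ∫ z, dzDeriv h z * discKernel b ρ z := by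
  have hsub : tsupport (fun z => (discKernel b ρ z : ℂ)) ⊆ ball b r :=
    (tsupport_discKernel_subset b hρ).trans (closedBall_subset_ball hr)
  have hk := contDiff_discKernel b ρ
  have hc := hasCompactSupport_discKernel b hρ
  have i1 : ∀ v, Integrable fun z => h z * dirDeriv v (fun z => (discKernel b ρ z : ℂ)) z := fun v =>
    integrable_mul_of_tsupport_subset isOpen_ball hh.continuousOn
      (hk.dirDeriv (m := 0) (by norm_num) v).continuous ((tsupport_dirDeriv_subset v _).trans hsub)
      (hc.fderiv_apply ℝ v)
  have i2 : ∀ v, Integrable fun z => dirDeriv v h z * (discKernel b ρ z : ℂ) := fun v =>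
    integrable_mul_of_tsupport_subset isOpen_ball
      (ContDiffOn.dirDeriv isOpen_ball hh (m := 0) (by norm_num) v).continuousOn hk.continuous hsub hc
  have p1 : ∀ v, _ := fun v => integral_mul_dirDeriv isOpen_ball (hh.of_le one_le_two)
    (hk.of_le one_le_two) hsub hc v
  have e1 : ∀ z, h z * kelvinLap b (discCutoff b ρ) z =
      -2 * (h z * dirDeriv 1 (fun z => (discKernel b ρ z : ℂ)) z) +
        2 * Complex.I * (h z * dirDeriv Complex.I (fun z => (discKernel b ρ z : ℂ)) z) := fun z => by
    rw [kelvinLap_discCutoff b hρ]; ring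
  have e2 : ∀ z, dzDeriv h z * discKernel b ρ z =
      1 / 2 * (dirDeriv 1 h z * (discKernel b ρ z : ℂ)) +
        -(Complex.I / 2) * (dirDeriv Complex.I h z * (discKernel b ρ z : ℂ)) := fun z => by
    rw [dzDeriv, dirDeriv, dirDeriv]; ring
  simp only [e1, e2]
  rw [integral_add ((i1 1).const_mul _) ((i1 Complex.I).const_mul _),
    integral_add ((i2 1).const_mul _) ((i2 Complex.I).const_mul _), integral_const_mul,
    integral_const_mul, integral_const_mul, integral_const_mul, p1, p1]
  ring

lemma continuousOn_dzDeriv {V : Set ℂ} (hV : IsOpen V) {h : ℂ → ℂ} (hh : ContDiffOn ℝ 2 h V) :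
    ContinuousOn (dzDeriv h) V := by
  have h1 : ∀ v, ContinuousOn (dirDeriv v h) V := fun v =>
    (ContDiffOn.dirDeriv hV hh (m := 0) (by norm_num) v).continuousOn
  exact ((h1 1).sub (continuousOn_const.mul (h1 Complex.I))).div_const 2

/-- The functional represents a multiple of `∂h/∂z (b)` in the limit of small cutoffs. -/
lemma exists_cutoff_approx {b : ℂ} {r ε : ℝ} (hr : 0 < r) (hε : 0 < ε) {h : ℂ → ℂ}
    (hh : ContDiffOn ℝ 2 h (ball b r)) :
    ∃ u, IsTest b u ∧ u =ᶠ[nhds b] (fun _ => 1) ∧ tsupport u ⊆ ball b r ∧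
      ‖(∫ z, h z * kelvinLap b u z) - 4 * (∫ w, discKernel 0 1 w : ℝ) * dzDeriv h b‖ ≤
        4 * (∫ w, discKernel 0 1 w) * ε := by
  have hcont := (continuousOn_dzDeriv isOpen_ball hh).continuousAt (ball_mem_nhds b hr)
  obtain ⟨δ, hδ, hδ'⟩ := Metric.continuousAt_iff.1 hcont ε hε
  set ρ := min δ r / 3 with hρdef
  have hmin : 0 < min δ r := lt_min hδ hr
  have hρ : 0 < ρ := by positivity
  have hρr : 2 * ρ < r := by have := min_le_right δ r; linarith
  have hρδ : 2 * ρ < δ := by have := min_le_left δ r; linarith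
  refine ⟨discCutoff b ρ, (isTest_discCutoff b hρ).1, (isTest_discCutoff b hρ).2,
    (tsupport_discCutoff_subset b hρ).trans (closedBall_subset_ball hρr), ?_⟩
  have hsub : tsupport (fun z => (discKernel b ρ z : ℂ)) ⊆ ball b r :=
    (tsupport_discKernel_subset b hρ).trans (closedBall_subset_ball hρr)
  have hk := contDiff_discKernel b ρ
  have hc := hasCompactSupport_discKernel b hρ
  have i0 : Integrable (discKernel b ρ) :=
    (continuous_discKernel b ρ).integrable_of_hasCompactSupport (hasCompactSupport_discKernel_real b hρ)
  have e1 : (∫ w, discKernel 0 1 w : ℝ) * dzDeriv h b = ∫ w, dzDeriv h b * discKernel b ρ w := by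
    rw [integral_const_mul, ← integral_discKernel b hρ, mul_comm]
    congr 1
    exact integral_ofReal.symm
  have i3 : Integrable fun w => dzDeriv h b * (discKernel b ρ w : ℂ) :=
    (hk.continuous.integrable_of_hasCompactSupport hc).const_mul _
  rw [integral_mul_kelvinLap_discCutoff hρ hρr hh, mul_assoc, e1, ← mul_sub, ← integral_sub
    (integrable_mul_of_tsupport_subset isOpen_ball (continuousOn_dzDeriv isOpen_ball hh)
      hk.continuous hsub hc) i3, norm_mul, mul_assoc]
  refine mul_le_mul (by norm_num) ?_ (norm_nonneg _) (by norm_num)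
  rw [← integral_discKernel b hρ, ← integral_mul_const]
  refine norm_integral_le_of_norm_le (i0.mul_const ε) (Eventually.of_forall fun z => ?_)
  rw [← sub_mul, norm_mul, Complex.norm_real, Real.norm_of_nonneg (discKernel_nonneg b ρ z), mul_comm]
  by_cases hz : z ∈ closedBall b (2 * ρ)
  · refine mul_le_mul_of_nonneg_left ?_ (discKernel_nonneg b ρ z)
    rw [← dist_eq_norm]
    exact (hδ' ((mem_closedBall.1 hz).trans_lt hρδ)).le
  · simp [discKernel, deriv_smoothStep_eq_zero (radial_gt hρ hz)]

end

lemma HolderOfOrderOn.norm_sub_le_of_hNorm_lt {α : ℝ} {U : Set ℂ} {f : ℂ → ℂ} {M : ℝ}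
    (hf : HolderOfOrderOn α (closure U) f) (hM : HNorm α U f < M) {x y : ℂ} (hx : x ∈ closure U)
    (hy : y ∈ closure U) : ‖f x - f y‖ ≤ M * ‖x - y‖ ^ α := by
  obtain ⟨C, hC⟩ := hf
  have h0 : 0 ≤ sSup ((fun x => ‖f x‖) '' closure U) :=
    Real.sSup_nonneg (by rintro _ ⟨x, -, rfl⟩; exact norm_nonneg _)
  have h1 : 0 ≤ sSup {q | ∃ x ∈ closure U, ∃ y ∈ closure U, x ≠ y ∧ q = ‖f x - f y‖ / ‖x - y‖ ^ α} :=
    Real.sSup_nonneg (by rintro _ ⟨x, -, y, -, -, rfl⟩; positivity)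
  have hM' := hM
  rw [HNorm] at hM'
  rcases eq_or_ne x y with rfl | hxy
  · rw [sub_self, norm_zero]
    have : 0 ≤ M := by linarith
    positivity
  have hd : 0 < ‖x - y‖ ^ α := Real.rpow_pos_of_pos (norm_sub_pos_iff.2 hxy) α
  rw [← div_le_iff₀ hd]
  refine le_trans ?_ ((le_add_of_nonneg_left h0).trans hM.le)
  refine le_csSup ⟨C, ?_⟩ ⟨x, hx, y, hy, hxy, rfl⟩
  rintro _ ⟨x, hx, y, hy, hxy, rfl⟩
  rw [div_le_iff₀ (Real.rpow_pos_of_pos (norm_sub_pos_iff.2 hxy) α)]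
  exact hC x hx y hy

lemma HolderOfOrderOn.norm_le_of_hNorm_lt {α : ℝ} (hα : 0 < α) {U : Set ℂ}
    (hU : Bornology.IsBounded U) {f : ℂ → ℂ} {M : ℝ}
    (hf : HolderOfOrderOn α (closure U) f) (hM : HNorm α U f < M) {x : ℂ} (hx : x ∈ closure U) :
    ‖f x‖ ≤ M := by
  obtain ⟨C, hC⟩ := hf
  have h1 : 0 ≤ sSup {q | ∃ x ∈ closure U, ∃ y ∈ closure U, x ≠ y ∧ q = ‖f x - f y‖ / ‖x - y‖ ^ α} :=
    Real.sSup_nonneg (by rintro _ ⟨x, -, y, -, -, rfl⟩; positivity)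
  rw [HNorm] at hM
  obtain ⟨R, hR⟩ := Metric.isBounded_iff.1 hU.closure
  refine le_trans ?_ ((le_add_of_nonneg_right h1).trans hM.le)
  refine le_csSup ⟨‖f x‖ + |C| * R ^ α, ?_⟩ ⟨x, hx, rfl⟩
  rintro _ ⟨y, hy, rfl⟩
  have h2 : ‖y - x‖ ≤ R := by rw [← dist_eq_norm]; exact hR hy hx
  calc ‖f y‖ = ‖f x + (f y - f x)‖ := by congr 1; ring
    _ ≤ ‖f x‖ + ‖f y - f x‖ := norm_add_le _ _
    _ ≤ ‖f x‖ + |C| * R ^ α := by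
      gcongr
      exact (hC y hy x hx).trans (mul_le_mul (le_abs_self C)
        (Real.rpow_le_rpow (norm_nonneg _) h2 hα.le) (by positivity) (abs_nonneg C))

lemma LittleHolderOn.exists_delta {α : ℝ} {E : Set ℂ} {f : ℂ → ℂ} (hf : LittleHolderOn α E f)
    (hα : 0 < α) {ε : ℝ} (hε : 0 < ε) :
    ∃ δ > 0, ∀ x ∈ E, ∀ y ∈ E, ‖x - y‖ ≤ δ → ‖f x - f y‖ ≤ ε * ‖x - y‖ ^ α := by
  obtain ⟨⟨C, hC⟩, ht⟩ := hf
  obtain ⟨δ, hδ, hδ0⟩ := ((ht.eventually (gt_mem_nhds hε)).and self_mem_nhdsWithin).exists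
  refine ⟨δ, hδ0, fun x hx y hy hxy => ?_⟩
  rcases eq_or_ne x y with rfl | hne
  · simp [Real.zero_rpow hα.ne']
  rw [← div_le_iff₀ (Real.rpow_pos_of_pos (norm_sub_pos_iff.2 hne) α)]
  refine le_trans ?_ hδ.le
  refine le_csSup ⟨C, ?_⟩ ⟨x, hx, y, hy, hne, hxy, rfl⟩
  rintro _ ⟨x, hx, y, hy, hxy, -, rfl⟩
  rw [div_le_iff₀ (Real.rpow_pos_of_pos (norm_sub_pos_iff.2 hxy) α)]
  exact hC x hx y hy

lemma exists_mul_le_mul_rpow {α : ℝ} (hα1 : α < 1) (L : ℝ) {ε : ℝ} (hε : 0 < ε) :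
    ∃ δ > 0, ∀ d, 0 ≤ d → d ≤ δ → L * d ≤ ε * d ^ α := by
  have ht : Tendsto (fun d : ℝ => L * d ^ (1 - α)) (nhds 0) (nhds (L * 0 ^ (1 - α))) :=
    ((Real.continuousAt_rpow_const 0 (1 - α) (Or.inr (by linarith))).tendsto).const_mul L
  rw [Real.zero_rpow (by linarith), mul_zero] at ht
  obtain ⟨δ, hδ, h⟩ := Metric.eventually_nhds_iff.1 (ht.eventually (gt_mem_nhds hε))
  refine ⟨δ / 2, by positivity, fun d hd hdδ => ?_⟩
  rcases hd.eq_or_lt with rfl | hd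
  · rw [mul_zero]; positivity
  have := h (y := d) (by rw [dist_zero_right, Real.norm_of_nonneg hd.le]; linarith)
  calc L * d = L * d ^ (1 - α) * d ^ α := by
        rw [mul_assoc, ← Real.rpow_add hd, sub_add_cancel, Real.rpow_one]
    _ ≤ ε * d ^ α := by gcongr

/-- A function in `H^α` that is harmonic near `b` extends to the plane with a modulus of continuity
controlled by a gauge, the constant depending only on the norm. -/
lemma exists_extension_of_memHalpha {α : ℝ} (hα : 0 < α) (hα1 : α < 1) {U : Set ℂ} {b : ℂ}
    (hb : b ∈ closure U) {f h : ℂ → ℂ} {r : ℝ} (hr : 0 < r) (hf : MemHalpha α U f)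
    (hh : HarmonicOnC h (U ∪ ball b r)) (heq : ∀ z ∈ closure U, h z = f z) {M : ℝ} (hM0 : 0 < M)
    (hM : HNorm α U f < M) :
    ∃ r₁ > 0, r₁ ≤ r ∧ ∃ (F : ℂ → ℂ) (g : ℝ → ℝ), (∀ z ∈ closure U ∪ closedBall b r₁, F z = h z) ∧
      IsGauge α g ∧ (∀ t, 0 ≤ t → 0 ≤ g t) ∧ (∀ t, 0 ≤ t → g (2 * t) ≤ 2 * g t) ∧ g 0 = 0 ∧
      ∀ z z', ‖F z - F z'‖ ≤ 2 * (3 * M) * g ‖z - z'‖ := by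
  have hc : ContDiffAt ℝ 1 h b := ((hh.1.mono subset_union_right).contDiffAt
    (isOpen_ball.mem_nhds (mem_ball_self hr))).of_le one_le_two
  obtain ⟨L, t, ht, hL⟩ := hc.exists_lipschitzOnWith
  obtain ⟨ρ₀, hρ₀, hρ₀t⟩ := Metric.nhds_basis_closedBall.mem_iff.1 ht
  obtain ⟨δ₀, hδ₀, hLM⟩ := exists_mul_le_mul_rpow hα1 L hM0
  set ρ := min (min ρ₀ r) (δ₀ / 2) with hρdef
  have hρ : 0 < ρ := lt_min (lt_min hρ₀ hr) (by positivity)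
  have hρ1 : ρ ≤ ρ₀ := (min_le_left _ _).trans (min_le_left _ _)
  have hρ2 : ρ ≤ r := (min_le_left _ _).trans (min_le_right _ _)
  have hρ3 : 2 * ρ ≤ δ₀ := by have := min_le_right (min ρ₀ r) (δ₀ / 2); linarith
  have hlip : ∀ x ∈ closedBall b ρ, ∀ y ∈ closedBall b ρ, ‖h x - h y‖ ≤ L * ‖x - y‖ :=
    fun x hx y hy => by
      simpa [dist_eq_norm] using hL.dist_le_mul x (hρ₀t (closedBall_subset_closedBall hρ1 hx)) y
        (hρ₀t (closedBall_subset_closedBall hρ1 hy))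
  have hUh : ∀ x ∈ closure U, ∀ y ∈ closure U, ‖h x - h y‖ ≤ M * ‖x - y‖ ^ α := fun x hx y hy => by
    rw [heq x hx, heq y hy]
    exact hf.2.1.norm_sub_le_of_hNorm_lt hM hx hy
  have hBh : ∀ x ∈ closedBall b ρ, ∀ y ∈ closedBall b ρ, ‖h x - h y‖ ≤ M * ‖x - y‖ ^ α :=
    fun x hx y hy => by
      refine (hlip x hx y hy).trans (hLM _ (norm_nonneg _) (le_trans ?_ hρ3))
      rw [← dist_eq_norm]
      linarith [dist_triangle_right x y b, mem_closedBall.1 hx, mem_closedBall.1 hy]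
  have hmix : ∀ x ∈ closure U, ∀ y ∈ closedBall b (ρ / 2), ‖h x - h y‖ ≤ 3 * M * ‖x - y‖ ^ α := by
    intro x hx y hy
    have hy' : y ∈ closedBall b ρ := closedBall_subset_closedBall (by linarith) hy
    by_cases hxb : x ∈ closedBall b ρ
    · refine (hBh x hxb y hy').trans ?_
      gcongr
      linarith
    · rw [mem_closedBall, not_le] at hxb
      rw [mem_closedBall] at hy
      have t1 := dist_triangle x y b
      have d1 : ‖x - b‖ ≤ 2 * ‖x - y‖ := by rw [← dist_eq_norm, ← dist_eq_norm]; linarith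
      have d2 : ‖b - y‖ ≤ ‖x - y‖ := by rw [← dist_eq_norm, ← dist_eq_norm, dist_comm b]; linarith
      have h2 : (2 : ℝ) ^ α ≤ 2 := by
        simpa using Real.rpow_le_rpow_of_exponent_le (x := 2) one_le_two hα1.le
      calc ‖h x - h y‖ ≤ ‖h x - h b‖ + ‖h b - h y‖ := norm_sub_le_norm_sub_add_norm_sub _ _ _
        _ ≤ M * ‖x - b‖ ^ α + M * ‖b - y‖ ^ α :=
          add_le_add (hUh x hx b hb) (hBh b (mem_closedBall_self hρ.le) y hy')
        _ ≤ M * (2 * ‖x - y‖) ^ α + M * ‖x - y‖ ^ α := by gcongr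
        _ = M * (2 ^ α * ‖x - y‖ ^ α) + M * ‖x - y‖ ^ α := by
          rw [Real.mul_rpow two_pos.le (norm_nonneg _)]
        _ ≤ M * (2 * ‖x - y‖ ^ α) + M * ‖x - y‖ ^ α := by gcongr
        _ = 3 * M * ‖x - y‖ ^ α := by ring
  have hsub : closedBall b (ρ / 2) ⊆ closedBall b ρ := closedBall_subset_closedBall (by linarith)
  obtain ⟨F, g, hF, hg, hg0, hg2, hg00, hFg⟩ := exists_extension_modulus (A := 3 * M) hα hα1
    (by positivity) (X := closure U ∪ closedBall b (ρ / 2)) (f := h) ⟨b, Or.inl hb⟩ (by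
      rintro x (hx | hx) y (hy | hy)
      · exact (hUh x hx y hy).trans (by gcongr; linarith)
      · exact hmix x hx y hy
      · rw [norm_sub_rev, norm_sub_rev x]
        exact hmix y hy x hx
      · exact (hBh x (hsub hx) y (hsub hy)).trans (by gcongr; linarith))
    (by
      intro ε hε
      obtain ⟨δ₁, hδ₁, h1⟩ := hf.2.exists_delta hα hε
      obtain ⟨δ₂, hδ₂, h2⟩ := exists_mul_le_mul_rpow hα1 L hε
      have loc : ∀ x ∈ closedBall b ρ, ∀ y ∈ closedBall b ρ, ‖x - y‖ ≤ δ₂ →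
          ‖h x - h y‖ ≤ ε * ‖x - y‖ ^ α := fun x hx y hy hxy =>
        (hlip x hx y hy).trans (h2 _ (norm_nonneg _) hxy)
      have near : ∀ x, ∀ y ∈ closedBall b (ρ / 2), ‖x - y‖ ≤ ρ / 2 → x ∈ closedBall b ρ := by
        intro x y hy hxy
        rw [mem_closedBall] at hy ⊢
        rw [← dist_eq_norm] at hxy
        linarith [dist_triangle x y b]
      refine ⟨min (min δ₁ δ₂) (ρ / 2), lt_min (lt_min hδ₁ hδ₂) (by positivity), ?_⟩
      intro x hx y hy hxy
      have a1 := hxy.trans ((min_le_left _ _).trans (min_le_left _ _))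
      have a2 := hxy.trans ((min_le_left _ _).trans (min_le_right _ _))
      have a3 := hxy.trans (min_le_right _ _)
      rcases hx with hx | hx <;> rcases hy with hy | hy
      · rw [heq x hx, heq y hy]
        exact h1 x hx y hy a1
      · exact loc x (near x y hy a3) y (hsub hy) a2
      · exact loc x (hsub hx) y (near y x hx (by rwa [norm_sub_rev])) a2
      · exact loc x (hsub hx) y (hsub hy) a2)
    (by positivity)
  exact ⟨ρ / 2, by positivity, by linarith, F, g, hF, hg, hg0, hg2, hg00, hFg⟩

/-- Covers by open balls of positive radius, at the cost of a factor two and a small error. -/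
lemma IsGauge.exists_open_cover {α : ℝ} (hα : 0 < α) {g : ℝ → ℝ} (hg : IsGauge α g)
    (hg0 : ∀ t, 0 ≤ t → 0 ≤ g t) (hg2 : ∀ t, 0 ≤ t → g (2 * t) ≤ 2 * g t) {E : Set ℂ}
    (hE : lowerContent α E < ⊤) {ε : ℝ≥0∞} (hε : 0 < ε) :
    ∃ c : ℕ → ℂ × ℝ, (∀ j, 0 < (c j).2) ∧ E ⊆ ⋃ j, ball (c j).1 (c j).2 ∧
      ∑' j, ENNReal.ofReal (g (c j).2) ≤ 2 * lowerContent α E + ε := by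
  have hε4 : 0 < ε / 4 := ENNReal.div_pos hε.ne' (by norm_num)
  have hlt : MhContent g E < lowerContent α E + ε / 4 := by
    refine lt_of_le_of_lt ?_ (ENNReal.lt_add_right hE.ne hε4.ne')
    rw [lowerContent_eq_iSup]
    exact le_iSup (fun h : {h : ℝ → ℝ // IsGauge α h} => MhContent h.1 E) ⟨g, hg⟩
  obtain ⟨c, hc0, hcE, hcs⟩ := exists_cover_of_MhContent_lt hlt
  obtain ⟨η, hη, hηs⟩ := ENNReal.exists_pos_sum_of_countable (ι := ℕ)
    (ENNReal.half_pos hε.ne').ne'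
  have hs : ∀ j, ∃ s, 0 < s ∧ g s < η j := fun j =>
    (((hg.tendsto_zero hα).eventually (gt_mem_nhds (NNReal.coe_pos.2 (hη j)))).and
      self_mem_nhdsWithin).exists.imp fun s hs => ⟨hs.2, hs.1⟩
  choose s hs0 hsη using hs
  refine ⟨fun j => ((c j).1, max (2 * (c j).2) (s j)), fun j => lt_max_of_lt_right (hs0 j), ?_, ?_⟩
  · refine hcE.trans (iUnion_mono fun j => closedBall_subset_ball ?_)
    rcases (hc0 j).eq_or_lt with h | h
    · rw [← h]
      exact lt_max_of_lt_right (hs0 j)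
    · exact lt_max_of_lt_left (by linarith)
  · have hj : ∀ j, ENNReal.ofReal (g (max (2 * (c j).2) (s j))) ≤
        2 * ENNReal.ofReal (g (c j).2) + η j := by
      intro j
      rw [← ENNReal.ofReal_ofNat 2, ← ENNReal.ofReal_mul two_pos.le, ← ENNReal.ofReal_coe_nnreal,
        ← ENNReal.ofReal_add (mul_nonneg two_pos.le (hg0 _ (hc0 j))) (NNReal.coe_nonneg _)]
      refine ENNReal.ofReal_le_ofReal ?_
      have h1 := hg2 _ (hc0 j)
      have h2 := hg0 _ (hc0 j)
      have h3 := (hsη j).le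
      have h4 := NNReal.coe_nonneg (η j)
      rcases max_choice (2 * (c j).2) (s j) with h | h <;> rw [h] <;> linarith
    calc ∑' j, ENNReal.ofReal (g (max (2 * (c j).2) (s j)))
        ≤ ∑' j, (2 * ENNReal.ofReal (g (c j).2) + η j) := ENNReal.tsum_le_tsum hj
      _ = 2 * ∑' j, ENNReal.ofReal (g (c j).2) + ∑' j, (η j : ℝ≥0∞) := by
        rw [ENNReal.tsum_add, ENNReal.tsum_mul_left]
      _ ≤ 2 * (lowerContent α E + ε / 4) + ε / 2 := by gcongr
      _ = 2 * lowerContent α E + ε := by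
        rw [mul_add, add_assoc]
        congr 1
        have : 2 * (ε / 4) = ε / 2 := by
          rw [show (4 : ℝ≥0∞) = 2 * 2 by norm_num, ← mul_div_assoc,
            ENNReal.mul_div_mul_left _ _ (by norm_num) (by norm_num)]
        rw [this, ENNReal.add_halves]

/-- The part of a ball lying in the open shell about the `n + 1`-st annulus. -/
def shellBall (b : ℂ) (n : ℕ) (a : ℂ) (ρ : ℝ) : Set ℂ :=
  {z | z ∈ ball a ρ ∧ (1 / 2 : ℝ) ^ (n + 3) < ‖z - b‖ ∧ ‖z - b‖ < (1 / 2) ^ n}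

lemma isOpen_shellBall (b : ℂ) (n : ℕ) (a : ℂ) (ρ : ℝ) : IsOpen (shellBall b n a ρ) := by
  have hc : Continuous fun z : ℂ => ‖z - b‖ := (continuous_id.sub continuous_const).norm
  exact isOpen_ball.inter ((isOpen_lt continuous_const hc).inter (isOpen_lt hc continuous_const))

lemma exists_dyadic_scale (b : ℂ) (n : ℕ) (a : ℂ) {ρ : ℝ} (hρ : 0 < ρ) :
    ∃ (k : ℕ) (a' : ℂ), n + 7 ≤ k ∧ (1 / 2 : ℝ) ^ k ≤ 2 * ρ ∧
      shellBall b n a ρ ⊆ closedBall a' (128 * (1 / 2) ^ k) := by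
  rcases le_or_gt ((1 / 2 : ℝ) ^ (n + 7)) ρ with h | h
  · refine ⟨n + 7, b, le_rfl, by linarith, fun z hz => ?_⟩
    rw [mem_closedBall, dist_eq_norm]
    refine hz.2.2.le.trans (le_of_eq ?_)
    rw [pow_add]
    norm_num
    ring
  · obtain ⟨k, hk1, hk2⟩ := exists_nat_pow_near_of_lt_one hρ
      (h.le.trans (pow_le_one₀ (by norm_num) (by norm_num))) (y := (1 / 2 : ℝ)) (by norm_num)
      (by norm_num)
    refine ⟨k, a, ?_, ?_, fun z hz => ?_⟩
    · by_contra hlt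
      have : (1 / 2 : ℝ) ^ (n + 7) ≤ (1 / 2) ^ (k + 1) :=
        pow_le_pow_of_le_one (by norm_num) (by norm_num) (by omega)
      linarith
    · rw [pow_succ] at hk1
      linarith
    · have hp : (0 : ℝ) < (1 / 2) ^ k := by positivity
      rw [mem_closedBall]
      have := mem_ball.1 hz.1
      linarith

lemma exists_finset_tile_inter (b a : ℂ) (k : ℕ) : ∃ t : Finset (ℤ × ℤ), t.card ≤ 261 ^ 2 ∧
    ∀ p, (tile b k p ∩ closedBall a (128 * (1 / 2) ^ k)).Nonempty → p ∈ t := by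
  have card : ∀ x : ℝ, (Finset.Icc ⌈x - 130⌉ ⌊x + 130⌋).card ≤ 261 := fun x => by
    rw [Int.card_Icc, Int.toNat_le]
    have h1 := Int.floor_le (x + 130)
    have h2 := Int.le_ceil (x - 130)
    have h3 : (⌊x + 130⌋ : ℝ) - ⌈x - 130⌉ ≤ 260 := by linarith
    have h4 : ⌊x + 130⌋ - ⌈x - 130⌉ ≤ 260 := by exact_mod_cast h3
    omega
  have mem : ∀ (x y : ℝ) (q : ℤ), |x - q| ≤ 2 → |x - y| ≤ 128 →
      q ∈ Finset.Icc ⌈y - 130⌉ ⌊y + 130⌋ := fun x y q h1 h2 => by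
    rw [abs_le] at h1 h2
    rw [Finset.mem_Icc, Int.ceil_le, Int.le_floor]
    constructor <;> linarith [h1.1, h1.2, h2.1, h2.2]
  refine ⟨Finset.Icc ⌈2 ^ k * (a - b).re - 130⌉ ⌊2 ^ k * (a - b).re + 130⌋ ×ˢ
    Finset.Icc ⌈2 ^ k * (a - b).im - 130⌉ ⌊2 ^ k * (a - b).im + 130⌋, ?_, ?_⟩
  · rw [Finset.card_product, sq]
    exact Nat.mul_le_mul (card _) (card _)
  · rintro p ⟨z, ⟨hz1, hz2⟩, hz⟩
    rw [mem_closedBall, dist_eq_norm] at hz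
    have h2 : (2 : ℝ) ^ k * (1 / 2) ^ k = 1 := by rw [← mul_pow]; norm_num
    have hp : (0 : ℝ) < 2 ^ k := by positivity
    have key : ∀ x : ℝ, |x| ≤ ‖z - a‖ → |2 ^ k * x| ≤ 128 := fun x hx => by
      rw [abs_mul, abs_of_pos hp]
      calc (2 : ℝ) ^ k * |x| ≤ 2 ^ k * (128 * (1 / 2) ^ k) := by gcongr; exact hx.trans hz
        _ = 128 := by rw [mul_left_comm, h2, mul_one]
    refine Finset.mem_product.2 ⟨mem _ _ _ hz1 ?_, mem _ _ _ hz2 ?_⟩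
    · rw [← mul_sub]
      convert key _ (Complex.abs_re_le_norm (z - a)) using 3
      simp
    · rw [← mul_sub]
      convert key _ (Complex.abs_im_le_norm (z - a)) using 3
      simp

lemma exists_finite_shell_cover {b : ℂ} {U V : Set ℂ} (hUV : U ⊆ V) (hV : IsOpen V) (hb : b ∈ V)
    {c : ℕ → ℕ → ℂ × ℝ} (hc : ∀ n, Ann b (n + 1) \ U ⊆ ⋃ j, ball (c n j).1 (c n j).2) :
    ∃ J : Finset (ℕ × ℕ), closedBall b (1 / 2) \ V ⊆
      ⋃ x ∈ J, shellBall b x.1 (c x.1 x.2).1 (c x.1 x.2).2 := by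
  refine ((isCompact_closedBall b (1 / 2)).diff hV).elim_finite_subcover _
    (fun x : ℕ × ℕ => isOpen_shellBall b x.1 _ _) ?_
  rintro z ⟨hz, hzV⟩
  rw [mem_closedBall, dist_eq_norm] at hz
  have hzb : 0 < ‖z - b‖ := norm_sub_pos_iff.2 fun h => hzV (h ▸ hb)
  obtain ⟨m, hm1, hm2⟩ := exists_nat_pow_near_of_lt_one hzb (hz.trans (by norm_num))
    (y := (1 / 2 : ℝ)) (by norm_num) (by norm_num)
  obtain ⟨n, rfl⟩ : ∃ n, m = n + 1 := by
    refine Nat.exists_eq_succ_of_ne_zero ?_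
    rintro rfl
    norm_num at hm1 hz
    linarith
  obtain ⟨j, hj⟩ := mem_iUnion.1 (hc n ⟨mem_Ann_iff.2 ⟨hm1.le, hm2⟩, fun h => hzV (hUV h)⟩)
  refine mem_iUnion.2 ⟨(n, j), hj, ?_, ?_⟩
  · exact (pow_lt_pow_right_of_lt_one₀ (by norm_num) (by norm_num) (by omega)).trans hm1
  · exact hm2.trans_lt (pow_lt_pow_right_of_lt_one₀ (by norm_num) (by norm_num) (by omega))

section

open MeasureTheory

lemma HarmonicOnC.mono {f : ℂ → ℂ} {V W : Set ℂ} (hf : HarmonicOnC f V) (h : W ⊆ V) :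
    HarmonicOnC f W := ⟨hf.1.mono h, fun z hz => hf.2 z (h hz)⟩

lemma kelvinLap_sub {u v : ℂ → ℂ} (hu : ContDiff ℝ 2 u) (hv : ContDiff ℝ 2 v) (b w : ℂ) :
    kelvinLap b (fun z => u z - v z) w = kelvinLap b u w - kelvinLap b v w := by
  have h := kelvinLap_sum (Finset.univ : Finset (Fin 2)) ![1, -1] ![u, v] b w
    (by intro i _; fin_cases i <;> assumption)
  simpa [Fin.sum_univ_two, ← sub_eq_add_neg] using h

/-- The complex-valued fixed bump, equal to one near `b`. -/
def baseFun (b z : ℂ) : ℂ := baseBump b z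

lemma baseFun_eq_sum (b : ℂ) : baseFun b = fun z => ∑ p ∈ idxBlock, tileFun b 7 p z := by
  ext z
  simp [baseFun, baseBump, tileFun]

lemma tsupport_baseFun_subset (b : ℂ) : tsupport (baseFun b) ⊆ closedBall b (1 / 16) := by
  refine closure_minimal (fun z hz => ?_) isClosed_closedBall
  by_contra h
  refine hz ?_
  rw [baseFun_eq_sum]
  refine Finset.sum_eq_zero fun p hp => ?_
  rw [tileFun, tileVal_eq_zero fun h' => h (tile_subset_closedBall hp h'), Complex.ofReal_zero]

lemma baseFun_eventuallyEq (b : ℂ) : baseFun b =ᶠ[nhds b] fun _ => 1 := by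
  filter_upwards [ball_mem_nhds b (ε := (1 / 2) ^ 7) (by norm_num)] with z hz
  rw [mem_ball, dist_eq_norm] at hz
  rw [baseFun, baseBump_eq_one hz.le, Complex.ofReal_one]

lemma isTest_baseFun (b : ℂ) : IsTest b (baseFun b) := by
  refine ⟨?_, ?_, 1, baseFun_eventuallyEq b⟩
  · rw [baseFun_eq_sum]
    exact ContDiff.sum fun p _ => contDiff_tileFun b 7 p
  · exact (isCompact_closedBall b (1 / 16)).of_isClosed_subset (isClosed_tsupport _)
      (tsupport_baseFun_subset b)

lemma norm_dzDeriv_le_of_decomposition {b : ℂ} {V : Set ℂ} (hV : IsOpen V) {r : ℝ} (hr : 0 < r)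
    (hrV : ball b r ⊆ V) {F h : ℂ → ℂ} (hF : Continuous F) (hh : HarmonicOnC h V)
    (hFh : ∀ z ∈ V, F z = h z) {K : ℕ} {D : Finset (ℕ × (ℤ × ℤ))} {a : ℕ × (ℤ × ℤ) → ℝ}
    {s : Finset (ℤ × ℤ)} {w : ℤ × ℤ → ℝ} (ha : ∀ x, 0 ≤ a x ∧ a x ≤ 1)
    (hD : ∀ x ∈ D, IsTest b (tileFun b x.1 x.2) ∧ tileFun b x.1 x.2 =ᶠ[nhds b] fun _ => 0)
    (hs : ∀ p ∈ s, tile b K p ⊆ V)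
    (hsum : ∀ z, baseBump b z =
      ∑ x ∈ D, a x * tileVal b x.1 x.2 z + ∑ p ∈ s, w p * tileVal b K p z) :
    4 * (∫ z, discKernel 0 1 z) * ‖dzDeriv h b‖ ≤ ‖∫ z, F z * kelvinLap b (baseFun b) z‖ +
      ∑ x ∈ D, ‖∫ z, F z * kelvinLap b (tileFun b x.1 x.2) z‖ := by
  have hc0 := integral_discKernel_pos
  refine le_of_forall_pos_le_add fun ε hε => ?_
  obtain ⟨u, hu, hu1, huV, hue⟩ := exists_cutoff_approx (b := b) (h := h) (r := r)
    (ε := ε / (4 * ∫ z, discKernel 0 1 z)) hr (by positivity) (hh.1.mono hrV)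
  rw [mul_div_cancel₀ _ (by positivity)] at hue
  have huV' : tsupport u ⊆ V := huV.trans hrV
  set Φ : ℂ → ℂ := fun z => ∑ x ∈ D, (a x : ℂ) * tileFun b x.1 x.2 z with hΦ
  have hΦc : ContDiff ℝ 2 Φ :=
    ContDiff.sum fun x _ => contDiff_const.mul (contDiff_tileFun b x.1 x.2)
  have hΨ := isTest_baseFun b
  set q : ℂ → ℂ := fun z => (baseFun b z - Φ z) - u z with hq
  have hqc : ContDiff ℝ 2 q := (hΨ.1.sub hΦc).sub hu.1
  set S : Set ℂ := (⋃ p ∈ s, tile b K p) ∪ tsupport u with hS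
  have hScomp : IsCompact S :=
    (s.isCompact_biUnion fun p _ => Metric.isCompact_of_isClosed_isBounded (isClosed_tile b K p)
      (isBounded_tile b K p)).union hu.2.1
  have hSV : S ⊆ V := union_subset (iUnion₂_subset hs) huV'
  have hqS : tsupport q ⊆ S := by
    refine closure_minimal (fun z hz => ?_) hScomp.isClosed
    by_contra hzS
    refine hz ?_
    have h1 : u z = 0 := image_eq_zero_of_notMem_tsupport fun h => hzS (Or.inr h)
    have h2 : ∑ p ∈ s, w p * tileVal b K p z = 0 := Finset.sum_eq_zero fun p hp => by
      rw [tileVal_eq_zero fun h => hzS (Or.inl (mem_biUnion hp h)), mul_zero]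
    simp only [hq, hΦ, h1, baseFun, tileFun, hsum z, h2]
    push_cast
    ring
  have hq0 : q =ᶠ[nhds b] fun _ => 0 := by
    have h1 : ∀ᶠ z in nhds b, ∀ x ∈ D, tileFun b x.1 x.2 z = 0 :=
      (Finset.eventually_all D).2 fun x hx => (hD x hx).2
    filter_upwards [h1, hu1, baseFun_eventuallyEq b] with z h1 h2 h3
    simp only [hq, hΦ, h2, h3]
    rw [Finset.sum_eq_zero fun x hx => by rw [h1 x hx, mul_zero]]
    ring
  have hswap : ∀ v : ℂ → ℂ, tsupport v ⊆ V →
      ∫ z, h z * kelvinLap b v z = ∫ z, F z * kelvinLap b v z := fun v hv => by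
    congr 1
    ext z
    by_cases hz : z ∈ V
    · rw [hFh z hz]
    · rw [image_eq_zero_of_notMem_tsupport fun h => hz (hv (tsupport_kelvinLap_subset b v h)),
        mul_zero, mul_zero]
  have hzero : ∫ z, F z * kelvinLap b q z = 0 := by
    rw [← hswap q (hqS.trans hSV)]
    exact integral_mul_kelvinLap_eq_zero hV hh hqc (hqS.trans hSV)
      (hScomp.of_isClosed_subset (isClosed_tsupport _) hqS) hq0
  have iD : ∀ x ∈ D, Integrable fun z => (a x : ℂ) * (F z * kelvinLap b (tileFun b x.1 x.2) z) :=
    fun x hx => ((hD x hx).1.integrable hF).const_mul _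
  have hexp : ∀ z, F z * kelvinLap b q z = F z * kelvinLap b (baseFun b) z -
      (∑ x ∈ D, (a x : ℂ) * (F z * kelvinLap b (tileFun b x.1 x.2) z)) -
        F z * kelvinLap b u z := fun z => by
    rw [hq, kelvinLap_sub (hΨ.1.sub hΦc) hu.1, kelvinLap_sub hΨ.1 hΦc, hΦ,
      kelvinLap_sum D _ (fun x => tileFun b x.1 x.2) b z fun x hx => (hD x hx).1.1, mul_sub, mul_sub,
      Finset.mul_sum]
    congr 2
    exact Finset.sum_congr rfl fun x _ => by ring
  have iS : Integrable fun z => F z * kelvinLap b (baseFun b) z -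
      ∑ x ∈ D, (a x : ℂ) * (F z * kelvinLap b (tileFun b x.1 x.2) z) :=
    (hΨ.integrable hF).sub (integrable_finsetSum D iD)
  simp only [hexp] at hzero
  rw [integral_sub iS (hu.integrable hF),
    integral_sub (hΨ.integrable hF) (integrable_finsetSum D iD), integral_finsetSum D iD,
    sub_eq_zero] at hzero
  simp only [integral_const_mul] at hzero
  rw [hswap u huV', ← hzero] at hue
  set c₀ := ∫ z, discKernel 0 1 z with hc₀
  set T := ∫ z, F z * kelvinLap b (baseFun b) z with hT
  have hsumle : ‖∑ x ∈ D, (a x : ℂ) * ∫ z, F z * kelvinLap b (tileFun b x.1 x.2) z‖ ≤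
      ∑ x ∈ D, ‖∫ z, F z * kelvinLap b (tileFun b x.1 x.2) z‖ :=
    norm_sum_le_of_le D fun x _ => by
      rw [norm_mul, Complex.norm_real, Real.norm_of_nonneg (ha x).1]
      exact mul_le_of_le_one_left (norm_nonneg _) (ha x).2
  have hn : ‖4 * (c₀ : ℂ) * dzDeriv h b‖ = 4 * c₀ * ‖dzDeriv h b‖ := by
    rw [norm_mul, norm_mul, Complex.norm_real, Real.norm_of_nonneg hc0.le]
    norm_num
  rw [← hn]
  set Y := ∑ x ∈ D, (a x : ℂ) * ∫ z, F z * kelvinLap b (tileFun b x.1 x.2) z with hY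
  have t1 := norm_sub_le_norm_sub_add_norm_sub (4 * (c₀ : ℂ) * dzDeriv h b) (T - Y) 0
  rw [sub_zero, sub_zero, norm_sub_rev _ (T - Y)] at t1
  have t2 := norm_sub_le T Y
  linarith

end

section

open MeasureTheory

lemma sum_le_mul_sum_of_rel {ι κ : Type*} {D : Finset ι} {J : Finset κ} {R : ι → κ → Prop}
    {t : ι → ℝ} {m : κ → ℝ} {N : ℕ} (hm : ∀ y ∈ J, 0 ≤ m y) (hcov : ∀ x ∈ D, ∃ y ∈ J, R x y)
    (hle : ∀ x ∈ D, ∀ y ∈ J, R x y → t x ≤ m y)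
    (hcard : ∀ y ∈ J, ∃ s : Finset ι, s.card ≤ N ∧ ∀ x ∈ D, R x y → x ∈ s) :
    ∑ x ∈ D, t x ≤ N * ∑ y ∈ J, m y := by
  classical
  calc ∑ x ∈ D, t x ≤ ∑ x ∈ D, ∑ y ∈ J, if R x y then m y else 0 := by
        refine Finset.sum_le_sum fun x hx => ?_
        obtain ⟨y, hy, hxy⟩ := hcov x hx
        refine (hle x hx y hy hxy).trans ?_
        have := Finset.single_le_sum (f := fun y => if R x y then m y else 0) (s := J)
          (fun z hz => by split_ifs; exacts [hm z hz, le_rfl]) hy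
        simpa [hxy] using this
    _ = ∑ y ∈ J, ∑ x ∈ D, if R x y then m y else 0 := Finset.sum_comm
    _ ≤ ∑ y ∈ J, N * m y := by
        refine Finset.sum_le_sum fun y hy => ?_
        obtain ⟨s, hs, hsub⟩ := hcard y hy
        rw [← Finset.sum_filter, Finset.sum_const, nsmul_eq_mul]
        refine mul_le_mul_of_nonneg_right ?_ (hm y hy)
        exact_mod_cast (Finset.card_le_card fun x hx =>
          hsub x (Finset.mem_filter.1 hx).1 (Finset.mem_filter.1 hx).2).trans hs
    _ = N * ∑ y ∈ J, m y := (Finset.mul_sum ..).symm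

/-- The pointwise bound for the derivative with an arbitrary majorant of the norm. -/
lemma four_mul_norm_dzDeriv_le {α : ℝ} (hα : 0 < α) (hα1 : α < 1) {U : Set ℂ} (hU : IsOpen U)
    (hUb : Bornology.IsBounded U) {b : ℂ} (hb : b ∈ closure U)
    (hsum : ∑' n : ℕ, (2 : ℝ≥0∞) ^ (n + 1) * lowerContent α (Ann b (n + 1) \ U) < ⊤) {B : ℝ}
    (hB : ∀ x, |spline x| ≤ B ∧ |splineD x| ≤ B ∧ |splineDD x| ≤ B)
    {f h : ℂ → ℂ} {r : ℝ} (hr : 0 < r) (hf : MemHalpha α U f) (hh : HarmonicOnC h (U ∪ ball b r))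
    (heq : ∀ z ∈ closure U, h z = f z) {M : ℝ} (hM0 : 0 < M) (hM : HNorm α U f < M) :
    4 * (∫ z, discKernel 0 1 z) * ‖dzDeriv h b‖ ≤
      (7 * ∫ z, ‖kelvinLap b (baseFun b) z‖) * M + (261 ^ 2 * (2 ^ 17 * Real.pi * B ^ 2 * 6 *
        (∑' n : ℕ, (2 : ℝ≥0∞) ^ (n + 1) * lowerContent α (Ann b (n + 1) \ U) + 2).toReal)) * M := by
  obtain ⟨r₁, hr₁, hr₁r, F, g, hFh, hg, hg0, hg2, hg00, hFg⟩ :=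
    exists_extension_of_memHalpha hα hα1 hb hr hf hh heq hM0 hM
  have hL : ∀ n, lowerContent α (Ann b (n + 1) \ U) < ⊤ := fun n => by
    refine lt_of_le_of_lt ?_ ((ENNReal.le_tsum n).trans_lt hsum)
    exact le_mul_of_one_le_left zero_le (one_le_pow₀ one_le_two)
  have hε : ∀ n : ℕ, (0 : ℝ≥0∞) < 2⁻¹ ^ n * 2⁻¹ ^ n := fun n => by
    rw [← pow_add]
    exact ENNReal.pow_pos (by simp) _
  choose c hc0 hcE hcs using fun n => hg.exists_open_cover hα hg0 hg2 (hL n) (hε n)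
  choose lev ctr hlev hlevr hsub using fun x : ℕ × ℕ =>
    exists_dyadic_scale b x.1 (c x.1 x.2).1 (hc0 x.1 x.2)
  have hV : IsOpen (U ∪ ball b r₁) := hU.union isOpen_ball
  obtain ⟨J, hJ⟩ := exists_finite_shell_cover subset_union_left hV
    (Or.inr (mem_ball_self hr₁)) hcE
  set R : ℕ × (ℤ × ℤ) → ℕ × ℕ → Prop := fun x y =>
    x.1 = lev y ∧ (tile b x.1 x.2 ∩ shellBall b y.1 (c y.1 y.2).1 (c y.1 y.2).2).Nonempty with hR
  obtain ⟨D, a, s, w, ha, -, hD, hs, hdec⟩ := exists_stopping_decomposition b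
    (fun k p => ∃ y ∈ J, R (k, p) y) (le_max_left 7 (J.sup lev + 1))
  have hFc : Continuous F := by
    refine continuous_iff_continuousAt.2 fun z => ?_
    rw [ContinuousAt, tendsto_iff_norm_sub_tendsto_zero]
    have ht : Tendsto (fun z' => 2 * (3 * M) * ‖z' - z‖ ^ α) (nhds z) (nhds 0) := by
      have : ContinuousAt (fun z' => 2 * (3 * M) * ‖z' - z‖ ^ α) z :=
        (((continuous_id.sub continuous_const).norm.rpow_const fun _ => Or.inr hα.le).const_mul
          _).continuousAt
      simpa [ContinuousAt, Real.zero_rpow hα.ne'] using this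
    refine squeeze_zero (fun _ => norm_nonneg _) (fun z' => (hFg z' z).trans ?_) ht
    gcongr
    rcases (norm_nonneg (z' - z)).eq_or_lt with h0 | h0
    · rw [← h0, hg00]
      positivity
    · exact (hg.2.1 _ h0).2
  have hbound : ∀ x y, R x y → IsTest b (tileFun b x.1 x.2) ∧
      tileFun b x.1 x.2 =ᶠ[nhds b] (fun _ => 0) ∧
      ‖∫ z, F z * kelvinLap b (tileFun b x.1 x.2) z‖ ≤
        (2 ^ 17 * Real.pi * B ^ 2 * 6 * M) * (2 ^ y.1 * g (c y.1 y.2).2) := by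
    rintro ⟨k, p⟩ y ⟨rfl, e, he, hey⟩
    obtain ⟨h1, h2, h3⟩ := norm_integral_kelvinLap_tileFun_le hB (hlev y) he hey.2.1 (A := 3 * M)
      (by positivity) hFc hFg hg.1 hg0 hg2
    refine ⟨h1, h2, h3.trans ?_⟩
    have hgk : g ((1 / 2) ^ lev y) ≤ 2 * g (c y.1 y.2).2 :=
      (hg.1 (mem_Ici.2 (by positivity)) (mem_Ici.2 (by linarith [hc0 y.1 y.2])) (hlevr y)).trans
        (hg2 _ (hc0 y.1 y.2).le)
    calc 2 ^ 17 * Real.pi * B ^ 2 * (3 * M) * (2 ^ y.1 * g ((1 / 2) ^ lev y))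
        ≤ 2 ^ 17 * Real.pi * B ^ 2 * (3 * M) * (2 ^ y.1 * (2 * g (c y.1 y.2).2)) := by
          have := Real.pi_pos
          gcongr
      _ = _ := by ring
  have hDR : ∀ x ∈ D, ∃ y ∈ J, R x y := fun x hx => (hD x hx).2.2
  have hsV : ∀ p ∈ s, tile b (max 7 (J.sup lev + 1)) p ⊆ U ∪ ball b r₁ := by
    intro p hp e he
    by_contra heV
    obtain ⟨he1, he2⟩ := hs p hp e he
    obtain ⟨y, hyJ, hy⟩ := mem_iUnion₂.1
      (hJ ⟨closedBall_subset_closedBall (by norm_num) he1, heV⟩)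
    have hle : lev y ≤ J.sup lev := Finset.le_sup hyJ
    obtain ⟨p', hp', hep'⟩ := he2 (lev y) ((Nat.le_add_left 7 _).trans (hlev y))
      (lt_max_of_lt_right (by omega))
    exact hp' ⟨y, hyJ, rfl, e, hep', hy⟩
  have main := norm_dzDeriv_le_of_decomposition hV hr₁ subset_union_right hFc
    (hh.mono (union_subset_union_right U (ball_subset_ball hr₁r)))
    (fun z hz => hFh z (union_subset_union subset_closure ball_subset_closedBall hz)) ha
    (fun x hx => by
      obtain ⟨y, -, hxy⟩ := hDR x hx
      exact ⟨(hbound x y hxy).1, (hbound x y hxy).2.1⟩) hsV hdec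
  have hbase : ‖∫ z, F z * kelvinLap b (baseFun b) z‖ ≤
      (7 * ∫ z, ‖kelvinLap b (baseFun b) z‖) * M := by
    have hi : Integrable (kelvinLap b (baseFun b)) :=
      (isTest_baseFun b).continuous_kelvinLap.integrable_of_hasCompactSupport
        (isTest_baseFun b).hasCompactSupport_kelvinLap
    have e : (7 * ∫ z, ‖kelvinLap b (baseFun b) z‖) * M =
        ∫ z, 7 * M * ‖kelvinLap b (baseFun b) z‖ := by
      rw [integral_const_mul]
      ring
    rw [e]
    refine norm_integral_le_of_norm_le (hi.norm.const_mul _) (Eventually.of_forall fun z => ?_)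
    rw [norm_mul]
    by_cases hz : z ∈ closedBall b (1 / 16)
    · refine mul_le_mul_of_nonneg_right ?_ (norm_nonneg _)
      rw [mem_closedBall, dist_eq_norm] at hz
      have h1 : ‖F b‖ ≤ M := by
        rw [hFh b (Or.inl hb), heq b hb]
        exact hf.2.1.norm_le_of_hNorm_lt hα hUb hM hb
      have h2 : g ‖z - b‖ ≤ 1 := by
        rcases (norm_nonneg (z - b)).eq_or_lt with h0 | h0
        · rw [← h0, hg00]
          exact zero_le_one
        · exact (hg.2.1 _ h0).2.trans (Real.rpow_le_one (norm_nonneg _) (by linarith) hα.le)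
      have h3 : ‖F z‖ ≤ ‖F b‖ + ‖F z - F b‖ := by
        simpa using norm_add_le (F b) (F z - F b)
      have h4 := hFg z b
      nlinarith
    · rw [image_eq_zero_of_notMem_tsupport fun h =>
        hz (tsupport_baseFun_subset b (tsupport_kelvinLap_subset b _ h)), norm_zero, mul_zero,
        mul_zero]
  have hcount : ∑ x ∈ D, ‖∫ z, F z * kelvinLap b (tileFun b x.1 x.2) z‖ ≤ (261 ^ 2 : ℕ) *
      ∑ y ∈ J, (2 ^ 17 * Real.pi * B ^ 2 * 6 * M) * (2 ^ y.1 * g (c y.1 y.2).2) := by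
    have hpi := Real.pi_pos
    refine sum_le_mul_sum_of_rel (R := R) (fun y _ => ?_) hDR (fun x _ y _ h => (hbound x y h).2.2)
      fun y _ => ?_
    · have := hg0 _ (hc0 y.1 y.2).le
      positivity
    · obtain ⟨t, ht, htm⟩ := exists_finset_tile_inter b (ctr y) (lev y)
      refine ⟨t.map ⟨fun p => (lev y, p), fun p q hpq => (Prod.ext_iff.1 hpq).2⟩,
        by rwa [Finset.card_map], ?_⟩
      rintro ⟨k, p⟩ - ⟨rfl, hne⟩
      exact Finset.mem_map.2 ⟨p, htm p (hne.mono (inter_subset_inter_right _ (hsub y))), rfl⟩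
  set Q := ∑' n : ℕ, (2 : ℝ≥0∞) ^ (n + 1) * lowerContent α (Ann b (n + 1) \ U) with hQ
  have hgsum : ∑ y ∈ J, 2 ^ y.1 * g (c y.1 y.2).2 ≤ (Q + 2).toReal := by
    have hpos : ∀ y : ℕ × ℕ, 0 ≤ (2 : ℝ) ^ y.1 * g (c y.1 y.2).2 := fun y =>
      mul_nonneg (by positivity) (hg0 _ (hc0 y.1 y.2).le)
    refine (ENNReal.ofReal_le_iff_le_toReal (by finiteness)).1 ?_
    rw [ENNReal.ofReal_sum_of_nonneg fun y _ => hpos y]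
    calc ∑ y ∈ J, ENNReal.ofReal (2 ^ y.1 * g (c y.1 y.2).2)
        ≤ ∑' y : ℕ × ℕ, ENNReal.ofReal (2 ^ y.1 * g (c y.1 y.2).2) := ENNReal.sum_le_tsum J
      _ = ∑' n : ℕ, (2 : ℝ≥0∞) ^ n * ∑' j, ENNReal.ofReal (g (c n j).2) := by
        rw [ENNReal.tsum_prod']
        refine tsum_congr fun n => ?_
        rw [← ENNReal.tsum_mul_left]
        refine tsum_congr fun j => ?_
        rw [ENNReal.ofReal_mul (by positivity), ENNReal.ofReal_pow two_pos.le, ENNReal.ofReal_ofNat]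
      _ ≤ ∑' n : ℕ, ((2 : ℝ≥0∞) ^ (n + 1) * lowerContent α (Ann b (n + 1) \ U) + 2⁻¹ ^ n) := by
        refine ENNReal.tsum_le_tsum fun n => (mul_le_mul_right (hcs n) _).trans (le_of_eq ?_)
        rw [mul_add, ← mul_assoc, ← pow_succ, ← mul_assoc, ← mul_pow,
          ENNReal.mul_inv_cancel two_ne_zero ENNReal.ofNat_ne_top, one_pow, one_mul]
      _ = Q + 2 := by
        rw [ENNReal.tsum_add, ENNReal.tsum_geometric, ENNReal.one_sub_inv_two, inv_inv]
  refine main.trans (add_le_add hbase (hcount.trans ?_))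
  rw [← Finset.mul_sum, Nat.cast_pow, Nat.cast_ofNat]
  have hpi := Real.pi_pos
  calc (261 : ℝ) ^ 2 * (2 ^ 17 * Real.pi * B ^ 2 * 6 * M * ∑ y ∈ J, 2 ^ y.1 * g (c y.1 y.2).2)
      ≤ 261 ^ 2 * (2 ^ 17 * Real.pi * B ^ 2 * 6 * M * (Q + 2).toReal) := by gcongr
    _ = _ := by ring

lemma hNorm_nonneg (α : ℝ) (U : Set ℂ) (f : ℂ → ℂ) : 0 ≤ HNorm α U f :=
  add_nonneg (Real.sSup_nonneg (by rintro _ ⟨x, -, rfl⟩; exact norm_nonneg _))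
    (Real.sSup_nonneg (by rintro _ ⟨x, -, y, -, -, rfl⟩; positivity))

/-- Convergence of the series of contents implies that the derivation is bounded. -/
theorem exists_derivation_bound_of_tsum_lt_top {α : ℝ} (hα : 0 < α) (hα1 : α < 1) {U : Set ℂ}
    (hU : IsOpen U) (hUb : Bornology.IsBounded U) {b : ℂ} (hb : b ∈ closure U)
    (hsum : ∑' n : ℕ, (2 : ℝ≥0∞) ^ (n + 1) * lowerContent α (Ann b (n + 1) \ U) < ⊤) :
    ∃ κ : ℝ, 0 < κ ∧ ∀ f h : ℂ → ℂ, ∀ r : ℝ, 0 < r → MemHalpha α U f →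
      HarmonicOnC h (U ∪ ball b r) → (∀ z ∈ closure U, h z = f z) →
        ‖dzDeriv h b‖ ≤ κ * HNorm α U f := by
  obtain ⟨B, -, hB⟩ := exists_spline_bound
  have hc := integral_discKernel_pos
  have hpi := Real.pi_pos
  set c₀ := ∫ z, discKernel 0 1 z with hc₀
  set C := (7 * ∫ z, ‖kelvinLap b (baseFun b) z‖) + (261 ^ 2 * (2 ^ 17 * Real.pi * B ^ 2 * 6 *
    (∑' n : ℕ, (2 : ℝ≥0∞) ^ (n + 1) * lowerContent α (Ann b (n + 1) \ U) + 2).toReal)) + 1 with hC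
  have hI : 0 ≤ ∫ z, ‖kelvinLap b (baseFun b) z‖ := integral_nonneg fun _ => norm_nonneg _
  have hCpos : 0 < C := by positivity
  refine ⟨C / (4 * c₀), by positivity, fun f h r hr hf hh heq => ?_⟩
  refine le_of_forall_pos_le_add fun ε hε => ?_
  have hN := hNorm_nonneg α U f
  have hκ : 0 < C / (4 * c₀) := by positivity
  have hη : 0 < ε / (C / (4 * c₀)) := by positivity
  have key := four_mul_norm_dzDeriv_le hα hα1 hU hUb hb hsum hB hr hf hh heq
    (M := HNorm α U f + ε / (C / (4 * c₀))) (by linarith) (by linarith)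
  rw [← add_mul] at key
  have e : C / (4 * c₀) * HNorm α U f + ε = C * (HNorm α U f + ε / (C / (4 * c₀))) / (4 * c₀) := by
    field_simp
  rw [e, le_div_iff₀ (by positivity), mul_comm]
  refine key.trans (mul_le_mul_of_nonneg_right ?_ (by linarith))
  rw [hC]
  linarith

end

/-- For `0 < α < 1`, `U ⊆ ℂ` bounded open and `b ∈ ∂U`, the functional
`h ↦ (∂h/∂z)(b)` (computed from the harmonic extension near `b`) is bounded on `H^α_b(U)`
with respect to the `H^α` norm if and only if `∑ 2^n M_*^α(A_n(b) \ U) < ∞`. -/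
theorem statement1 (α : ℝ) (hα0 : 0 < α) (hα1 : α < 1)
    (U : Set ℂ) (hUopen : IsOpen U) (hUbdd : Bornology.IsBounded U)
    (b : ℂ) (hb : b ∈ frontier U) :
    (∃ κ : ℝ, 0 < κ ∧ ∀ f h : ℂ → ℂ, ∀ r : ℝ, 0 < r →
        MemHalpha α U f → HarmonicOnC h (U ∪ Metric.ball b r) →
        (∀ z ∈ closure U, h z = f z) →
        ‖dzDeriv h b‖ ≤ κ * HNorm α U f) ↔
      ∑' n : ℕ, (2:ℝ≥0∞) ^ (n + 1) * lowerContent α (Ann b (n + 1) \ U) < ⊤ := by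
  exact ⟨fun ⟨_, hκ, hder⟩ => tsum_lowerContent_lt_top_of_derivation hα0 hα1 hUopen hUbdd hκ hder,
    exists_derivation_bound_of_tsum_lt_top hα0 hα1 hUopen hUbdd (frontier_subset_closure hb)⟩

end
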